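/- arXiv:1709.04089 — 2 statements merged into one kernel-verified Lean document; each statement's English description precedes it below -/
import Mathlib

section
/- Let d ≥ 2 and g(x) = |x|^{2-d} if d ≥ 3, g(x) = -log|x| if d = 2. Let μ be an absolutely continuous probability measure on ℝ^d with bounded density. Given (x₁,...,x_N) ∈ (ℝ^d)^N and η₁,...,η_N ∈ (0, 1/2], let δ_{x_i}^{(η_i)} denote the uniform probability measure on the sphere ∂B(x_i, η_i). Then F_N^μ(x₁,...,x_N) ≥ ∬ g(x-y) d(Σ_i δ_{x_i}^{(η_i)} - Nμ)(x) d(Σ_i δ_{x_i}^{(η_i)} - Nμ)(y) - Σ_{i=1}^N g(η_i) - C_d N ‖μ‖_{L^∞} Σ_{i=1}^N η_i², where C_d depends only on d; moreover, if the balls B(x_i, η_i) are pairwise disjoint, then also F_N^μ(x₁,...,x_N) ≤ ∬ g(x-y) d(Σ_i δ_{x_i}^{(η_i)} - Nμ)(x) d(Σ_i δ_{x_i}^{(η_i)} - Nμ)(y) - Σ_{i=1}^N g(η_i) + C_d N ‖μ‖_{L^∞} Σ_{i=1}^N η_i². -/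
open MeasureTheory Filter Topology
open scoped ENNReal

noncomputable section

/-- The ambient Euclidean space `ℝ^d`. -/
abbrev Esp (d : ℕ) := EuclideanSpace ℝ (Fin d)

/-- The real-valued log/Coulomb kernel: `g(x) = -log|x|` if `d = 2`, `g(x) = |x|^(2-d)`
if `d ≥ 3`. -/
def gR (d : ℕ) (x : Esp d) : ℝ :=
  if d = 2 then - Real.log ‖x‖ else ‖x‖ ^ (2 - (d : ℝ))

open scoped Classical in
/-- The extended-real-valued log/Coulomb kernel, equal to `+∞` at the origin. -/
def gE (d : ℕ) (x : Esp d) : EReal := if x = 0 then ⊤ else ((gR d x : ℝ) : EReal)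

/-- The integral of an extended-real-valued function, defined as the (extended-real)
difference of the integrals of the positive and negative parts. -/
def eIntE {α : Type*} [MeasurableSpace α] (μ : Measure α) (f : α → EReal) : EReal :=
  ((∫⁻ x, (if f x = ⊤ then ⊤ else ENNReal.ofReal (f x).toReal) ∂μ : ℝ≥0∞) : EReal)
    - ((∫⁻ x, (if f x = ⊥ then ⊤ else ENNReal.ofReal (-(f x)).toReal) ∂μ : ℝ≥0∞) : EReal)

/-- The energy functional `I_V(μ) = ∬ g(x-y) dμ(x)dμ(y) + ∫ V dμ`, written as the double
integral `∬ [g(x-y) + V(x)/2 + V(y)/2] dμ(x)dμ(y)` with values in the extended reals;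
used to characterize the equilibrium measure. -/
def IVE (d : ℕ) (V : Esp d → ℝ) (μ : Measure (Esp d)) : EReal :=
  eIntE (μ.prod μ)
    (fun p => gE d (p.1 - p.2) + ((V p.1 / 2 + V p.2 / 2 : ℝ) : EReal))

/-- The electrostatic potential `h^μ(x) = ∫ g(x-y) dμ(y)` (Bochner integral). -/
def hpot (d : ℕ) (μ : Measure (Esp d)) (x : Esp d) : ℝ :=
  ∫ y, gR d (x - y) ∂μ

/-- The interaction energy `∬ g(x-y) dμ(x) dμ(y)` (Bochner integral). -/
def Dg (d : ℕ) (μ : Measure (Esp d)) : ℝ :=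
  ∫ p : Esp d × Esp d, gR d (p.1 - p.2) ∂(μ.prod μ)

/-- The (real) value `I_V(μ) = ∬ g(x-y) dμ(x)dμ(y) + ∫ V dμ`. -/
def IVr (d : ℕ) (V : Esp d → ℝ) (μ : Measure (Esp d)) : ℝ :=
  Dg d μ + ∫ x, V x ∂μ

/-- The constant `c = I_V(μ_V) - (1/2) ∫ V dμ_V`. -/
def cV (d : ℕ) (V : Esp d → ℝ) (μ : Measure (Esp d)) : ℝ :=
  IVr d V μ - (∫ x, V x ∂μ) / 2

/-- The effective confinement potential `ζ = h^{μ_V} + V/2 - c`. -/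
def zeta (d : ℕ) (V : Esp d → ℝ) (μ : Measure (Esp d)) (x : Esp d) : ℝ :=
  hpot d μ x + V x / 2 - cV d V μ

/-- The `N`-point Hamiltonian `H_N = Σ_{i≠j} g(x_i-x_j) + N Σ_i V(x_i)`, with values in
the extended reals (`+∞` when two points coincide). -/
def HNe (d N : ℕ) (V : Esp d → ℝ) (X : Fin N → Esp d) : EReal :=
  (∑ i, ∑ j, if i ≠ j then gE d (X i - X j) else 0) + ((N * ∑ i, V (X i) : ℝ) : EReal)

/-- The next-order energy
`F_N^μ(X_N) = ∬_{Δᶜ} g(x-y) d(Σᵢ δ_{x_i} - Nμ)(x) d(Σᵢ δ_{x_i} - Nμ)(y)`, i.e.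
`Σ_{i≠j} g(x_i-x_j) - 2N Σᵢ h^μ(x_i) + N² ∬ g dμ dμ`, valued in the extended reals. -/
def FNe (d N : ℕ) (μ : Measure (Esp d)) (X : Fin N → Esp d) : EReal :=
  (∑ i, ∑ j, if i ≠ j then gE d (X i - X j) else 0)
    + ((- 2 * N * ∑ i, hpot d μ (X i) + (N : ℝ) ^ 2 * Dg d μ : ℝ) : EReal)


/-- The uniform probability measure on the sphere `∂B(x, η)`, defined as the normalized
`(d-1)`-dimensional Hausdorff measure on the sphere. -/
def sphereUnif (d : ℕ) (x : Esp d) (η : ℝ) : Measure (Esp d) :=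
  ((Measure.hausdorffMeasure ((d : ℝ) - 1) : Measure (Esp d)) (Metric.sphere x η))⁻¹ •
    ((Measure.hausdorffMeasure ((d : ℝ) - 1) : Measure (Esp d)).restrict (Metric.sphere x η))

/-- The value `g(η)` of the kernel at distance `η > 0`:
`-log η` if `d = 2`, `η^(2-d)` if `d ≥ 3`. -/
def gval (d : ℕ) (η : ℝ) : ℝ := if d = 2 then - Real.log η else η ^ (2 - (d : ℝ))

/-- The smeared interaction energy
`∬ g(x-y) d(Σᵢ δ_{x_i}^{(η_i)} - Nμ)(x) d(Σᵢ δ_{x_i}^{(η_i)} - Nμ)(y)`, where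
`δ_x^{(η)}` is the uniform measure on `∂B(x,η)`; expanded as
`Σ_{i,j} ∬ g dδᵢdδⱼ - 2N Σᵢ ∬ g dδᵢdμ + N² ∬ g dμdμ`. -/
def smeared (d N : ℕ) (μ : Measure (Esp d)) (X : Fin N → Esp d) (η : Fin N → ℝ) : ℝ :=
  (∑ i, ∑ j, ∫ p : Esp d × Esp d, gR d (p.1 - p.2)
      ∂((sphereUnif d (X i) (η i)).prod (sphereUnif d (X j) (η j))))
    - 2 * N * ∑ i, ∫ p : Esp d × Esp d, gR d (p.1 - p.2)
        ∂((sphereUnif d (X i) (η i)).prod μ)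
    + (N : ℝ) ^ 2 * Dg d μ

theorem hausdorffMeasure_sphere_lt_top (n : ℕ) (x : Esp (n + 1)) {η : ℝ} (hη : 0 < η) :
    (Measure.hausdorffMeasure (n : ℝ) : Measure (Esp (n + 1))) (Metric.sphere x η) < ⊤ := by
  let v : Fin (n + 1) → ℝ → (Fin n → ℝ) → Esp (n + 1) :=
    fun i ε y => WithLp.toLp 2 (i.insertNth (α := fun _ => ℝ) ε y)
  let f : Fin (n + 1) → ℝ → (Fin n → ℝ) → Esp (n + 1) :=
    fun i ε y => x + (η / ‖v i ε y‖) • v i ε y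
  have hv : ∀ i ε, ContDiff ℝ 1 (v i ε) := by
    intro i ε
    rw [contDiff_euclidean]
    intro j
    refine Fin.succAboveCases i ?_ (fun k => ?_) j
    · simpa [v] using contDiff_const
    · simpa [v] using contDiff_apply ℝ ℝ k
  have hv0 : ∀ i ε y, ε ≠ 0 → v i ε y ≠ 0 := by
    intro i ε y hε h
    have : v i ε y i = 0 := by rw [h]; rfl
    simp [v] at this
    exact hε this
  have hf : ∀ i ε, ε ≠ 0 → ContDiff ℝ 1 (f i ε) := by
    intro i ε hε
    refine contDiff_const.add (ContDiff.fun_smul ?_ (hv i ε))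
    exact contDiff_const.div ((hv i ε).norm ℝ fun y => hv0 i ε y hε)
      fun y => norm_ne_zero_iff.2 (hv0 i ε y hε)
  let B : Set (Fin n → ℝ) := Metric.closedBall 0 1
  have hfin : ∀ i ε, ε ≠ 0 →
      (Measure.hausdorffMeasure (n : ℝ) : Measure (Esp (n + 1))) (f i ε '' B) < ⊤ := by
    intro i ε hε
    obtain ⟨K, hK⟩ := LocallyLipschitzOn.exists_lipschitzOnWith_of_compact
      (isCompact_closedBall (0 : Fin n → ℝ) 1) ((hf i ε hε).locallyLipschitz.locallyLipschitzOn)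
    refine (hK.hausdorffMeasure_image_le (Nat.cast_nonneg n)).trans_lt ?_
    refine ENNReal.mul_lt_top (by finiteness) ?_
    have := hausdorffMeasure_pi_real (ι := Fin n)
    rw [Fintype.card_fin] at this
    rw [this]
    exact measure_closedBall_lt_top
  have hcov : Metric.sphere x η ⊆ ⋃ i : Fin (n + 1), (f i 1 '' B ∪ f i (-1) '' B) := by
    intro z hz
    rw [mem_sphere_iff_norm] at hz
    set w := z - x with hw
    obtain ⟨i, -, hi⟩ := Finset.exists_max_image Finset.univ (fun i => |w i|) Finset.univ_nonempty
    have hi0 : 0 < |w i| := by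
      by_contra h
      have : w = 0 := by
        ext j
        have := hi j (Finset.mem_univ j)
        have h2 := abs_nonneg (w j)
        exact abs_eq_zero.1 (by linarith)
      rw [this, norm_zero] at hz
      linarith
    have key : ∀ ε : ℝ, ε = w i / |w i| → z ∈ f i ε '' B := by
      intro ε hε
      refine ⟨fun k => w (i.succAbove k) / |w i|, ?_, ?_⟩
      · rw [mem_closedBall_zero_iff, pi_norm_le_iff_of_nonneg zero_le_one]
        intro k
        rw [Real.norm_eq_abs, abs_div, abs_abs, div_le_one hi0]
        exact hi _ (Finset.mem_univ _)
      · have : v i ε (fun k => w (i.succAbove k) / |w i|) = |w i|⁻¹ • w := by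
          ext j
          refine Fin.succAboveCases i ?_ (fun k => ?_) j
          · simp [v, hε]; field_simp
          · simp [v]; field_simp
        simp only [f]
        rw [this, norm_smul, hz, Real.norm_eq_abs, abs_inv, abs_abs, smul_smul]
        have : η / (|w i|⁻¹ * η) * |w i|⁻¹ = 1 := by field_simp
        rw [this, one_smul, hw]
        abel
    refine Set.mem_iUnion.2 ⟨i, ?_⟩
    rcases lt_or_gt_of_ne (abs_pos.1 hi0) with h | h
    · right; apply key; rw [abs_of_neg h, div_neg, div_self h.ne]
    · left; apply key; rw [abs_of_pos h, div_self h.ne']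
  refine (measure_mono hcov).trans_lt ((measure_iUnion_le _).trans_lt ?_)
  rw [tsum_fintype]
  refine ENNReal.sum_lt_top.2 fun i _ => (measure_union_le _ _).trans_lt ?_
  exact ENNReal.add_lt_top.2 ⟨hfin i 1 one_ne_zero, hfin i (-1) (by norm_num)⟩

theorem hausdorffMeasure_sphere_pos (n : ℕ) (x : Esp (n + 1)) {η : ℝ} (hη : 0 < η) :
    0 < (Measure.hausdorffMeasure (n : ℝ) : Measure (Esp (n + 1))) (Metric.sphere x η) := by
  let p : Esp (n + 1) → (Fin n → ℝ) := fun z k => z k.succ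
  have hp : LipschitzWith 1 p := by
    refine LipschitzWith.of_dist_le_mul fun a b => ?_
    rw [NNReal.coe_one, one_mul, dist_pi_le_iff dist_nonneg]
    intro k
    rw [dist_eq_norm, dist_eq_norm]
    exact PiLp.norm_apply_le (a - b) k.succ
  let U : Set (Fin n → ℝ) := {y | ∑ k, (y k - x k.succ) ^ 2 < η ^ 2}
  have hU : IsOpen U := isOpen_lt (by fun_prop) continuous_const
  have hUne : U.Nonempty := ⟨fun k => x k.succ, by simp [U]; positivity⟩
  have hsub : U ⊆ p '' Metric.sphere x η := by
    intro y hy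
    have hy' : ∑ k, (y k - x k.succ) ^ 2 < η ^ 2 := hy
    refine ⟨WithLp.toLp 2 (Fin.cons (x 0 + √(η ^ 2 - ∑ k, (y k - x k.succ) ^ 2)) y), ?_, ?_⟩
    · rw [mem_sphere_iff_norm, EuclideanSpace.norm_eq, Real.sqrt_eq_iff_mul_self_eq_of_pos hη,
        Fin.sum_univ_succ]
      simp only [Real.norm_eq_abs, sq_abs, PiLp.sub_apply, Fin.cons_zero, Fin.cons_succ,
        add_sub_cancel_left]
      rw [Real.sq_sqrt (by linarith)]
      ring
    · ext k
      simp [p]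
  have h1 := hp.hausdorffMeasure_image_le (Nat.cast_nonneg n) (Metric.sphere x η)
  have h2 := hausdorffMeasure_pi_real (ι := Fin n)
  rw [Fintype.card_fin] at h2
  rw [h2] at h1
  have h3 : 0 < volume U := hU.measure_pos _ hUne
  have h4 := (h3.trans_le (measure_mono hsub)).trans_le h1
  simpa using h4

theorem isProbabilityMeasure_sphereUnif {d : ℕ} (hd : 2 ≤ d) (x : Esp d) {η : ℝ} (hη : 0 < η) :
    IsProbabilityMeasure (sphereUnif d x η) := by
  obtain ⟨n, rfl⟩ : ∃ n, d = n + 1 := ⟨d - 1, by omega⟩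
  have hn : ((n + 1 : ℕ) : ℝ) - 1 = n := by push_cast; ring
  constructor
  rw [sphereUnif, hn, Measure.smul_apply, Measure.restrict_apply_univ, smul_eq_mul]
  exact ENNReal.inv_mul_cancel (hausdorffMeasure_sphere_pos n x hη).ne'
    (hausdorffMeasure_sphere_lt_top n x hη).ne

theorem sphereUnif_singleton {d : ℕ} (hd : 2 ≤ d) (x : Esp d) (η : ℝ) (y : Esp d) :
    sphereUnif d x η {y} = 0 := by
  have h : (0 : ℝ) < (d : ℝ) - 1 := by
    have : (2 : ℝ) ≤ d := by exact_mod_cast hd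
    linarith
  have := Measure.nullSingletonClass_hausdorff (X := Esp d) h
  rw [sphereUnif, Measure.smul_apply]
  simp

theorem ae_norm_sub_eq_sphereUnif (d : ℕ) (x : Esp d) (η : ℝ) :
    ∀ᵐ z ∂(sphereUnif d x η), ‖z - x‖ = η := by
  refine Measure.ae_smul_measure ?_ _
  filter_upwards [ae_restrict_mem Metric.isClosed_sphere.measurableSet] with z hz
  exact mem_sphere_iff_norm.1 hz

theorem map_sphereUnif {d : ℕ} (x : Esp d) (η : ℝ) (e : Esp d ≃ᵢ Esp d) (he : e x = x) :
    (sphereUnif d x η).map e = sphereUnif d x η := by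
  rw [sphereUnif, Measure.map_smul]
  congr 1
  have h : e ⁻¹' Metric.sphere x η = Metric.sphere x η := by
    rw [e.preimage_sphere, ← he, e.symm_apply_apply, he]
  conv_lhs => rw [← h]
  have := (e.measurePreserving_hausdorffMeasure ((d : ℝ) - 1)).restrict_preimage
    (Metric.isClosed_sphere (x := x) (ε := η)).measurableSet
  exact this.map_eq

/-- A measure concentrated on the unit sphere, invariant under linear isometries and without
atoms. -/
structure IsRotInvariant {d : ℕ} (σ : Measure (Esp d)) : Prop where
  ae_norm : ∀ᵐ z ∂σ, ‖z‖ = 1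
  map_eq : ∀ L : Esp d ≃ₗᵢ[ℝ] Esp d, σ.map L = σ
  singleton : ∀ y, σ {y} = 0

theorem exists_isRotInvariant_sphereUnif {d : ℕ} (hd : 2 ≤ d) (x : Esp d) {η : ℝ} (hη : 0 < η) :
    ∃ σ : Measure (Esp d), IsProbabilityMeasure σ ∧ IsRotInvariant σ ∧
      (sphereUnif d x η) = σ.map (fun z => x + η • z) := by
  have := isProbabilityMeasure_sphereUnif hd x hη
  have hm : Measurable (fun z : Esp d => η⁻¹ • (z - x)) := by fun_prop
  have hm' : Measurable (fun z : Esp d => x + η • z) := by fun_prop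
  refine ⟨(sphereUnif d x η).map (fun z => η⁻¹ • (z - x)),
    Measure.isProbabilityMeasure_map hm.aemeasurable, ⟨?_, fun L => ?_, fun y => ?_⟩, ?_⟩
  · rw [ae_map_iff hm.aemeasurable (measurableSet_eq_fun (by fun_prop) (by fun_prop))]
    filter_upwards [ae_norm_sub_eq_sphereUnif d x η] with z hz
    rw [norm_smul, hz, norm_inv, Real.norm_of_nonneg hη.le, inv_mul_cancel₀ hη.ne']
  · let e : Esp d ≃ᵢ Esp d :=
      ((IsometryEquiv.subRight x).trans L.toIsometryEquiv).trans (IsometryEquiv.addRight x)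
    have he : ∀ z, e z = L (z - x) + x := fun z => rfl
    have hx : e x = x := by simp [he]
    rw [Measure.map_map L.continuous.measurable hm]
    conv_rhs => rw [← map_sphereUnif x η e hx, Measure.map_map hm e.continuous.measurable]
    congr 1
    ext1 z
    simp [he]
  · rw [Measure.map_apply hm (measurableSet_singleton y)]
    have : (fun z : Esp d => η⁻¹ • (z - x)) ⁻¹' {y} ⊆ {x + η • y} := by
      intro z hz
      have hz' : η⁻¹ • (z - x) = y := hz
      rw [Set.mem_singleton_iff, ← hz', smul_inv_smul₀ hη.ne']
      abel
    exact measure_mono_null this (sphereUnif_singleton hd x η _)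
  · rw [Measure.map_map hm' hm]
    have : (fun z => x + η • z) ∘ (fun z : Esp d => η⁻¹ • (z - x)) = id := by
      ext1 z
      simp [smul_inv_smul₀ hη.ne']
    rw [this, Measure.map_id]

theorem integrable_of_continuousOn_of_ae_mem {E : Type*} [TopologicalSpace E] [T2Space E]
    [MeasurableSpace E] [BorelSpace E] {σ : Measure E} [IsFiniteMeasure σ] {K : Set E}
    (hKc : IsCompact K) (hK : ∀ᵐ z ∂σ, z ∈ K) {F : E → ℝ} (hF : ContinuousOn F K) :
    Integrable F σ := by
  rw [← Measure.restrict_eq_self_of_ae_mem hK]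
  exact hF.integrableOn_compact hKc

theorem hasDerivAt_integral_of_continuousOn {E : Type*} [TopologicalSpace E] [T2Space E]
    [MeasurableSpace E] [BorelSpace E] {σ : Measure E} [IsFiniteMeasure σ] {K : Set E}
    (hKc : IsCompact K) (hK : ∀ᵐ z ∂σ, z ∈ K) {F F' : ℝ → E → ℝ} {a ε : ℝ} (hε : 0 < ε)
    (hF : ∀ r ∈ Metric.ball a ε, ContinuousOn (F r) K)
    (hF' : ContinuousOn (Function.uncurry F') (Metric.closedBall a ε ×ˢ K))
    (hd : ∀ r ∈ Metric.ball a ε, ∀ z ∈ K, HasDerivAt (F · z) (F' r z) r) :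
    HasDerivAt (fun r => ∫ z, F r z ∂σ) (∫ z, F' a z ∂σ) a := by
  obtain ⟨C, hC⟩ := ((isCompact_closedBall a ε).prod hKc).exists_bound_of_continuousOn hF'
  have hF'a : ContinuousOn (F' a) K :=
    hF'.comp (f := fun z => (a, z)) (by fun_prop)
      fun z hz => ⟨Metric.mem_closedBall_self hε.le, hz⟩
  refine (hasDerivAt_integral_of_dominated_loc_of_deriv_le (bound := fun _ => C)
    (Metric.ball_mem_nhds a hε) ?_
    (integrable_of_continuousOn_of_ae_mem hKc hK (hF a (Metric.mem_ball_self hε)))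
    (integrable_of_continuousOn_of_ae_mem hKc hK hF'a).aestronglyMeasurable ?_
    (integrable_const C) ?_).2
  · filter_upwards [Metric.ball_mem_nhds a hε] with r hr
    exact (integrable_of_continuousOn_of_ae_mem hKc hK (hF r hr)).aestronglyMeasurable
  · filter_upwards [hK] with z hz r hr
    exact hC (r, z) ⟨Metric.ball_subset_closedBall hr, hz⟩
  · filter_upwards [hK] with z hz r hr
    exact hd r hr z hz

theorem inner_reflection_orthogonal_singleton {d : ℕ} {u : Esp d} (hu : ‖u‖ = 1) (w z : Esp d) :
    inner ℝ w ((ℝ ∙ u)ᗮ.reflection z) = inner ℝ w z - 2 * inner ℝ u z * inner ℝ w u := by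
  rw [Submodule.reflection_orthogonal_apply, Submodule.reflection_singleton_apply, hu,
    inner_neg_right, inner_sub_right, two_smul, inner_add_right, inner_smul_right]
  simp
  ring

namespace IsRotInvariant

variable {d : ℕ} {σ : Measure (Esp d)}

theorem ae_mem_sphere (hσ : IsRotInvariant σ) : ∀ᵐ z ∂σ, z ∈ Metric.sphere (0 : Esp d) 1 := by
  filter_upwards [hσ.ae_norm] with z hz
  simpa using hz

theorem integral_comp_isometry (hσ : IsRotInvariant σ) (L : Esp d ≃ₗᵢ[ℝ] Esp d) (f : Esp d → ℝ) :
    ∫ z, f (L z) ∂σ = ∫ z, f z ∂σ := by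
  conv_rhs => rw [← hσ.map_eq L]
  exact (integral_map_equiv L.toHomeomorph.toMeasurableEquiv f).symm

theorem integral_deriv_mul_sq_sub [IsFiniteMeasure σ] (hσ : IsRotInvariant σ) {e e' : Esp d}
    (he : ‖e‖ = 1) (he' : ‖e'‖ = 1) (hee' : inner ℝ e e' = 0) {h h' : ℝ → ℝ}
    (hd : ∀ t ∈ Set.Icc (-1 : ℝ) 1, HasDerivAt h (h' t) t)
    (hc : ContinuousOn h' (Set.Icc (-1) 1)) :
    ∫ z, (h' (inner ℝ e z) * inner ℝ e' z ^ 2 - inner ℝ e z * h (inner ℝ e z)) ∂σ = 0 := by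
  let T : ℝ → Esp d → ℝ := fun θ z => inner ℝ e z * Real.cos θ + inner ℝ e' z * Real.sin θ
  let S : ℝ → Esp d → ℝ := fun θ z => inner ℝ e z * Real.sin θ - inner ℝ e' z * Real.cos θ
  let u : ℝ → Esp d := fun θ => -Real.sin (θ / 2) • e + Real.cos (θ / 2) • e'
  have hu : ∀ θ, ‖u θ‖ = 1 := by
    intro θ
    have : ‖u θ‖ ^ 2 = 1 := by
      rw [norm_add_sq_real, norm_smul, norm_smul, he, he', inner_smul_left, inner_smul_right, hee']
      simp
    exact (pow_eq_one_iff_of_nonneg (norm_nonneg _) two_ne_zero).1 this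
  have hTe : ∀ θ z, inner ℝ e ((ℝ ∙ u θ)ᗮ.reflection z) = T θ z := by
    intro θ z
    rw [inner_reflection_orthogonal_singleton (hu θ)]
    have h1 : Real.sin θ = 2 * Real.sin (θ / 2) * Real.cos (θ / 2) := by
      rw [← Real.sin_two_mul]; congr 1; ring
    have h2 : Real.cos θ = 1 - 2 * Real.sin (θ / 2) ^ 2 := by
      rw [Real.sin_sq, ← sub_eq_zero]
      have := Real.cos_two_mul (θ / 2)
      rw [show 2 * (θ / 2) = θ by ring] at this
      rw [this]; ring
    simp only [u, T, inner_add_left, inner_add_right, inner_smul_left, inner_smul_right, hee',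
      real_inner_self_eq_norm_sq, he, h1, h2]
    simp
    ring
  have hSe : ∀ θ z, inner ℝ e' ((ℝ ∙ u θ)ᗮ.reflection z) = S θ z := by
    intro θ z
    rw [inner_reflection_orthogonal_singleton (hu θ)]
    have h1 : Real.sin θ = 2 * Real.sin (θ / 2) * Real.cos (θ / 2) := by
      rw [← Real.sin_two_mul]; congr 1; ring
    have h2 : Real.cos θ = 2 * Real.cos (θ / 2) ^ 2 - 1 := by
      have := Real.cos_two_mul (θ / 2)
      rwa [show 2 * (θ / 2) = θ by ring] at this
    have hee : inner ℝ e' e = 0 := by rw [real_inner_comm]; exact hee'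
    simp only [u, S, inner_add_left, inner_add_right, inner_smul_left, inner_smul_right, hee,
      real_inner_self_eq_norm_sq, he', h1, h2]
    simp
    ring
  have hTmem : ∀ θ z, z ∈ Metric.sphere (0 : Esp d) 1 → T θ z ∈ Set.Icc (-1 : ℝ) 1 := by
    intro θ z hz
    rw [← hTe, Set.mem_Icc, ← abs_le]
    refine (abs_real_inner_le_norm _ _).trans ?_
    rw [he, LinearIsometryEquiv.norm_map]
    simpa using hz.le
  have hhc : ContinuousOn h (Set.Icc (-1) 1) := fun t ht =>
    (hd t ht).continuousAt.continuousWithinAt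
  have hconst : ∀ θ, ∫ z, h (T θ z) * S θ z ∂σ = ∫ z, h (inner ℝ e z) * inner ℝ e' z ∂σ := by
    intro θ
    rw [← hσ.integral_comp_isometry ((ℝ ∙ u θ)ᗮ.reflection)
      (fun z => h (inner ℝ e z) * inner ℝ e' z)]
    simp only [hTe, hSe]
  have hder : HasDerivAt (fun θ => ∫ z, h (T θ z) * S θ z ∂σ)
      (∫ z, (h' (T 0 z) * (-S 0 z) * S 0 z + h (T 0 z) * T 0 z) ∂σ) 0 := by
    refine hasDerivAt_integral_of_continuousOn (isCompact_sphere (0 : Esp d) 1) hσ.ae_mem_sphere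
      (F' := fun θ z => h' (T θ z) * (-S θ z) * S θ z + h (T θ z) * T θ z)
      one_pos (fun θ _ => ?_) ?_ (fun θ _ z hz => ?_)
    · have hT : ContinuousOn (T θ) (Metric.sphere (0 : Esp d) 1) := by
        simp only [T]; fun_prop
      have hS : ContinuousOn (S θ) (Metric.sphere (0 : Esp d) 1) := by
        simp only [S]; fun_prop
      exact (hhc.comp hT (hTmem θ)).mul hS
    · have hT : Continuous (fun p : ℝ × Esp d => T p.1 p.2) := by
        simp only [T]; fun_prop
      have hS : Continuous (fun p : ℝ × Esp d => S p.1 p.2) := by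
        simp only [S]; fun_prop
      have hm : Set.MapsTo (fun p : ℝ × Esp d => T p.1 p.2)
          (Metric.closedBall 0 1 ×ˢ Metric.sphere 0 1) (Set.Icc (-1 : ℝ) 1) :=
        fun p hp => hTmem _ _ hp.2
      exact (((hc.comp hT.continuousOn hm).mul hS.neg.continuousOn).mul hS.continuousOn).add
        ((hhc.comp hT.continuousOn hm).mul hT.continuousOn)
    · have hT : HasDerivAt (T · z) (-S θ z) θ := by
        have := ((Real.hasDerivAt_cos θ).const_mul (inner ℝ e z)).add
          ((Real.hasDerivAt_sin θ).const_mul (inner ℝ e' z))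
        exact this.congr_deriv (by simp only [S]; ring)
      have hS : HasDerivAt (S · z) (T θ z) θ := by
        have := ((Real.hasDerivAt_sin θ).const_mul (inner ℝ e z)).sub
          ((Real.hasDerivAt_cos θ).const_mul (inner ℝ e' z))
        exact this.congr_deriv (by simp only [T]; ring)
      exact ((hd _ (hTmem θ z hz)).comp θ hT).mul hS
  simp only [hconst] at hder
  have h0 := hder.unique (hasDerivAt_const _ _)
  rw [← neg_eq_zero, ← integral_neg, ← h0]
  refine integral_congr_ae (Eventually.of_forall fun z => ?_)
  simp [T, S]
  ring

theorem integral_one_sub_sq_mul_deriv [IsFiniteMeasure σ] (hσ : IsRotInvariant σ) {e : Esp d}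
    (he : ‖e‖ = 1) {h h' : ℝ → ℝ}
    (hd : ∀ t ∈ Set.Icc (-1 : ℝ) 1, HasDerivAt h (h' t) t)
    (hc : ContinuousOn h' (Set.Icc (-1) 1)) :
    ∫ z, ((1 - inner ℝ e z ^ 2) * h' (inner ℝ e z)
      - ((d : ℝ) - 1) * (inner ℝ e z * h (inner ℝ e z))) ∂σ = 0 := by
  have hd0 : 0 < d := by
    rcases Nat.eq_zero_or_pos d with rfl | h
    · rw [Subsingleton.elim e 0, norm_zero] at he
      exact absurd he zero_ne_one
    · exact h
  let i₀ : Fin d := ⟨0, hd0⟩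
  obtain ⟨b, hb⟩ := Orthonormal.exists_orthonormalBasis_extension_of_card_eq (𝕜 := ℝ) (E := Esp d)
    (ι := Fin d) (by simp) (v := fun _ => e) (s := {i₀}) (by
      refine ⟨fun i => he, fun i j hij => absurd (Subsingleton.elim i j) hij⟩)
  have hb0 : b i₀ = e := hb i₀ rfl
  have hmem : ∀ z ∈ Metric.sphere (0 : Esp d) 1, inner ℝ e z ∈ Set.Icc (-1 : ℝ) 1 := by
    intro z hz
    rw [Set.mem_Icc, ← abs_le]
    refine (abs_real_inner_le_norm _ _).trans ?_
    rw [he, one_mul]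
    simpa using hz.le
  have hhc : ContinuousOn h (Set.Icc (-1) 1) := fun t ht =>
    (hd t ht).continuousAt.continuousWithinAt
  have hin : ∀ w : Esp d, ContinuousOn (fun z : Esp d => inner ℝ w z) (Metric.sphere 0 1) :=
    fun w => by fun_prop
  have hsum : ∑ i ∈ Finset.univ.erase i₀,
      ∫ z, (h' (inner ℝ e z) * inner ℝ (b i) z ^ 2 - inner ℝ e z * h (inner ℝ e z)) ∂σ = 0 := by
    refine Finset.sum_eq_zero fun i hi => ?_
    refine hσ.integral_deriv_mul_sq_sub he (b.norm_eq_one i) ?_ hd hc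
    rw [← hb0]
    exact b.inner_eq_zero (Finset.ne_of_mem_erase hi).symm
  rw [← integral_finsetSum] at hsum
  · rw [← hsum]
    refine integral_congr_ae ?_
    filter_upwards [hσ.ae_norm] with z hz
    have h1 := b.sum_sq_norm_inner_right z
    rw [← Finset.add_sum_erase _ _ (Finset.mem_univ i₀), hz, hb0] at h1
    simp only [Real.norm_eq_abs, sq_abs] at h1
    rw [Finset.sum_sub_distrib, ← Finset.mul_sum, Finset.sum_const,
      Finset.card_erase_of_mem (Finset.mem_univ _), Finset.card_univ, Fintype.card_fin,
      nsmul_eq_mul,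
      Nat.cast_sub hd0, Nat.cast_one]
    linear_combination (- h' (inner ℝ e z)) * h1
  · intro i _
    exact integrable_of_continuousOn_of_ae_mem (isCompact_sphere (0 : Esp d) 1) hσ.ae_mem_sphere
      (((hc.comp (hin e) hmem).mul ((hin _).pow 2)).sub ((hin e).mul (hhc.comp (hin e) hmem)))

end IsRotInvariant

theorem hasDerivAt_gval_sqrt {d : ℕ} {q : ℝ} (hq : 0 < q) :
    HasDerivAt (fun q => gval d √q)
      (-(if d = 2 then 1 else (d : ℝ) - 2) / 2 * q ^ (-(d : ℝ) / 2)) q := by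
  by_cases h : d = 2
  · subst h
    simp only [gval, if_true]
    have := (((hasDerivAt_id q).sqrt hq.ne').log (Real.sqrt_ne_zero'.2 hq)).neg
    refine this.congr_deriv ?_
    have h2 : q ^ (-((2 : ℕ) : ℝ) / 2) = q⁻¹ := by
      rw [← Real.rpow_neg_one]; norm_num
    rw [h2]
    have := Real.sq_sqrt hq.le
    have h3 := Real.sqrt_pos.2 hq
    simp only [id]
    field_simp
    rw [this]
  · simp only [gval, if_neg h]
    have h1 : (fun q : ℝ => √q ^ (2 - (d : ℝ))) =ᶠ[𝓝 q] fun q => q ^ ((2 - (d : ℝ)) / 2) := by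
      filter_upwards [lt_mem_nhds hq] with p hp
      rw [Real.sqrt_eq_rpow, ← Real.rpow_mul hp.le]
      congr 1; ring
    refine ((Real.hasDerivAt_rpow_const (Or.inl hq.ne')).congr_of_eventuallyEq h1).congr_deriv ?_
    rw [show (2 - (d : ℝ)) / 2 - 1 = -(d : ℝ) / 2 by ring]
    ring

theorem sq_add_sq_sub_pos {s r t : ℝ} (hr : |r| < s) (ht : t ∈ Set.Icc (-1 : ℝ) 1) :
    0 < s ^ 2 + r ^ 2 - 2 * s * r * t := by
  have h1 := abs_le.2 ht
  have h2 : r * t ≤ |r| := by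
    calc r * t ≤ |r * t| := le_abs_self _
      _ = |r| * |t| := abs_mul _ _
      _ ≤ |r| * 1 := by gcongr
      _ = |r| := mul_one _
  have h3 : 0 ≤ |r| := abs_nonneg r
  nlinarith [sq_abs r, mul_pos (sub_pos.2 hr) (sub_pos.2 hr),
    mul_le_mul_of_nonneg_left h2 (h3.trans hr.le)]

namespace IsRotInvariant

variable {d : ℕ} {σ : Measure (Esp d)}

theorem inner_mem_Icc_of_mem_sphere {e z : Esp d} (he : ‖e‖ = 1)
    (hz : z ∈ Metric.sphere (0 : Esp d) 1) : inner ℝ e z ∈ Set.Icc (-1 : ℝ) 1 := by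
  rw [Set.mem_Icc, ← abs_le]
  refine (abs_real_inner_le_norm _ _).trans ?_
  rw [he, one_mul]
  simpa using hz.le

theorem integral_inner_eq_zero (hσ : IsRotInvariant σ) (e : Esp d) :
    ∫ z, inner ℝ e z ∂σ = 0 := by
  have := hσ.integral_comp_isometry (LinearIsometryEquiv.neg ℝ) (fun z => inner ℝ e z)
  simp only [LinearIsometryEquiv.coe_neg, inner_neg_right, integral_neg] at this
  linarith

theorem integral_flux_eq_zero [IsFiniteMeasure σ] (hσ : IsRotInvariant σ) (hd : 2 ≤ d) {e : Esp d}
    (he : ‖e‖ = 1) {s r : ℝ} (hr : 0 < r) (hrs : r < s) :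
    ∫ z, ((s ^ 2 + r ^ 2 - 2 * s * r * inner ℝ e z) ^ (-(d : ℝ) / 2) *
      (r - s * inner ℝ e z)) ∂σ = 0 := by
  obtain ⟨n, rfl⟩ : ∃ n, d = n + 2 := ⟨d - 2, by omega⟩
  let D : ℝ := ((n + 2 : ℕ) : ℝ)
  have hD : D = n + 2 := by simp [D]
  let Q : ℝ → ℝ → ℝ := fun r t => s ^ 2 + r ^ 2 - 2 * s * r * t
  let P : ℝ → Esp (n + 2) → ℝ := fun r z =>
    r ^ (n + 1) * (r - s * inner ℝ e z) * Q r (inner ℝ e z) ^ (-D / 2)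
  let P' : ℝ → ℝ → ℝ := fun r t =>
    ((n + 1) * r ^ n * (r - s * t) + r ^ (n + 1)) * Q r t ^ (-D / 2) +
      r ^ (n + 1) * (r - s * t) * ((2 * r - 2 * s * t) * (-D / 2) * Q r t ^ (-D / 2 - 1))
  have hS := isCompact_sphere (0 : Esp (n + 2)) 1
  have hder : ∀ r₀ : ℝ, |r₀| < s → HasDerivAt (fun r => ∫ z, P r z ∂σ) 0 r₀ := by
    intro r₀ hr₀
    have hε : 0 < (s - |r₀|) / 2 := by linarith
    have hball : ∀ r ∈ Metric.closedBall r₀ ((s - |r₀|) / 2), |r| < s := by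
      intro r hr
      rw [Metric.mem_closedBall, Real.dist_eq] at hr
      have := abs_sub_abs_le_abs_sub r r₀
      linarith
    have key : ∫ z, P' r₀ (inner ℝ e z) ∂σ = 0 := by
      rw [← hσ.integral_one_sub_sq_mul_deriv he (h := fun t => s * r₀ ^ n * Q r₀ t ^ (-D / 2))
        (h' := fun t => s * r₀ ^ n * (-(2 * s * r₀) * (-D / 2) * Q r₀ t ^ (-D / 2 - 1)))]
      · refine integral_congr_ae ?_
        filter_upwards [hσ.ae_mem_sphere] with z hz
        have ht := inner_mem_Icc_of_mem_sphere he hz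
        have hQ : 0 < Q r₀ (inner ℝ e z) := sq_add_sq_sub_pos hr₀ ht
        have hW : Q r₀ (inner ℝ e z) ^ (-D / 2) =
            Q r₀ (inner ℝ e z) ^ (-D / 2 - 1) * Q r₀ (inner ℝ e z) := by
          rw [Real.rpow_sub_one hQ.ne']; field_simp
        simp only [P', hW]
        have hD' : ((n + 2 : ℕ) : ℝ) = n + 2 := hD
        rw [hD', hD]
        generalize Q r₀ (inner ℝ e z) ^ (-((n : ℝ) + 2) / 2 - 1) = W
        simp only [Q]
        ring
      · intro t ht
        have hQ : 0 < Q r₀ t := sq_add_sq_sub_pos hr₀ ht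
        have h1 : HasDerivAt (Q r₀) (-(2 * s * r₀)) t := by
          simpa [Q] using ((hasDerivAt_id t).const_mul (2 * s * r₀)).const_sub (s ^ 2 + r₀ ^ 2)
        exact (h1.rpow_const (Or.inl hQ.ne')).const_mul _
      · have : ContinuousOn (fun t => Q r₀ t ^ (-D / 2 - 1)) (Set.Icc (-1) 1) := by
          refine ContinuousOn.rpow_const (by fun_prop) fun t ht => Or.inl ?_
          exact (sq_add_sq_sub_pos hr₀ ht).ne'
        fun_prop
    rw [← key]
    refine hasDerivAt_integral_of_continuousOn hS hσ.ae_mem_sphere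
      (F' := fun r z => P' r (inner ℝ e z)) hε (fun r hr => ?_) ?_ (fun r hr z hz => ?_)
    · have : ContinuousOn (fun z => Q r (inner ℝ e z) ^ (-D / 2))
          (Metric.sphere (0 : Esp (n + 2)) 1) := by
        refine ContinuousOn.rpow_const (by fun_prop) fun z hz => Or.inl ?_
        exact (sq_add_sq_sub_pos (hball r (Metric.ball_subset_closedBall hr))
          (inner_mem_Icc_of_mem_sphere he hz)).ne'
      exact ContinuousOn.mul (by fun_prop) this
    · have hpow : ∀ p : ℝ, ContinuousOn (fun x : ℝ × Esp (n + 2) => Q x.1 (inner ℝ e x.2) ^ p)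
          (Metric.closedBall r₀ ((s - |r₀|) / 2) ×ˢ Metric.sphere (0 : Esp (n + 2)) 1) := by
        intro p
        refine ContinuousOn.rpow_const (by fun_prop) fun x hx => Or.inl ?_
        exact (sq_add_sq_sub_pos (hball _ hx.1) (inner_mem_Icc_of_mem_sphere he hx.2)).ne'
      have h1 := hpow (-D / 2)
      have h2 := hpow (-D / 2 - 1)
      simp only [Function.uncurry_def, P']
      fun_prop
    · have hQ : 0 < Q r (inner ℝ e z) :=
        sq_add_sq_sub_pos (hball r (Metric.ball_subset_closedBall hr))
          (inner_mem_Icc_of_mem_sphere he hz)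
      have h1 : HasDerivAt (Q · (inner ℝ e z)) (2 * r - 2 * s * inner ℝ e z) r := by
        have := ((hasDerivAt_pow 2 r).const_add (s ^ 2)).sub
          (((hasDerivAt_id r).const_mul (2 * s)).mul_const (inner ℝ e z))
        exact this.congr_deriv (by simp)
      have h2 := ((hasDerivAt_pow (n + 1) r).mul
        ((hasDerivAt_id r).sub_const (s * inner ℝ e z))).mul
          (h1.rpow_const (p := -D / 2) (Or.inl hQ.ne'))
      exact h2.congr_deriv (by simp [P'])
  have hconst := constant_of_has_deriv_right_zero (f := fun r => ∫ z, P r z ∂σ) (a := 0) (b := r)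
    (fun x hx => (hder x
      (by rw [abs_of_nonneg hx.1]; exact hx.2.trans_lt hrs)).continuousAt.continuousWithinAt)
    (fun x hx => (hder x (by rw [abs_of_nonneg hx.1]; exact hx.2.trans hrs)).hasDerivWithinAt)
    r ⟨hr.le, le_rfl⟩
  have h0 : ∀ z, P 0 z = 0 := fun z => by simp [P]
  simp only [h0, integral_zero] at hconst
  have : ∀ z, P r z = r ^ (n + 1) * (Q r (inner ℝ e z) ^ (-D / 2) * (r - s * inner ℝ e z)) :=
    fun z => by simp only [P]; ring
  simp only [this, integral_const_mul] at hconst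
  exact (mul_eq_zero.1 hconst).resolve_left (by positivity)

theorem integral_gval_sqrt [IsProbabilityMeasure σ] (hσ : IsRotInvariant σ) (hd : 2 ≤ d) {e : Esp d}
    (he : ‖e‖ = 1) {s r : ℝ} (hr : 0 ≤ r) (hrs : r < s) :
    ∫ z, gval d √(s ^ 2 + r ^ 2 - 2 * s * r * inner ℝ e z) ∂σ = gval d s := by
  let Q : ℝ → ℝ → ℝ := fun r t => s ^ 2 + r ^ 2 - 2 * s * r * t
  let c : ℝ := -(if d = 2 then 1 else (d : ℝ) - 2) / 2
  have hder : ∀ r₀ : ℝ, 0 ≤ r₀ → r₀ < s →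
      HasDerivAt (fun r => ∫ z, gval d √(Q r (inner ℝ e z)) ∂σ) 0 r₀ := by
    intro r₀ hr₀ hr₀s
    have hε : 0 < (s - |r₀|) / 2 := by rw [abs_of_nonneg hr₀]; linarith
    have hball : ∀ r ∈ Metric.closedBall r₀ ((s - |r₀|) / 2), |r| < s := by
      intro r hr
      rw [Metric.mem_closedBall, Real.dist_eq] at hr
      have := abs_sub_abs_le_abs_sub r r₀
      linarith
    have key : ∫ z, c * Q r₀ (inner ℝ e z) ^ (-(d : ℝ) / 2) *
        (2 * r₀ - 2 * s * inner ℝ e z) ∂σ = 0 := by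
      rcases hr₀.eq_or_lt with rfl | hpos
      · have : ∀ z : Esp d, c * Q 0 (inner ℝ e z) ^ (-(d : ℝ) / 2) *
            (2 * 0 - 2 * s * inner ℝ e z) =
              (c * (s ^ 2) ^ (-(d : ℝ) / 2) * (-(2 * s))) * inner ℝ e z := by
          intro z
          have : Q 0 (inner ℝ e z) = s ^ 2 := by simp [Q]
          rw [this]; ring
        refine (integral_congr_ae (ae_of_all _ this)).trans ?_
        rw [integral_const_mul, hσ.integral_inner_eq_zero, mul_zero]
      · have : ∀ z : Esp d, c * Q r₀ (inner ℝ e z) ^ (-(d : ℝ) / 2) *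
            (2 * r₀ - 2 * s * inner ℝ e z) =
              (2 * c) * (Q r₀ (inner ℝ e z) ^ (-(d : ℝ) / 2) * (r₀ - s * inner ℝ e z)) := by
          intro z; ring
        simp only [this, integral_const_mul]
        rw [hσ.integral_flux_eq_zero hd he hpos hr₀s, mul_zero]
    rw [← key]
    have hd1 : ∀ r ∈ Metric.ball r₀ ((s - |r₀|) / 2), ∀ z ∈ Metric.sphere (0 : Esp d) 1,
        0 < Q r (inner ℝ e z) := fun r hr z hz =>
      sq_add_sq_sub_pos (hball r (Metric.ball_subset_closedBall hr))
        (inner_mem_Icc_of_mem_sphere he hz)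
    refine hasDerivAt_integral_of_continuousOn (isCompact_sphere (0 : Esp d) 1) hσ.ae_mem_sphere
      (F' := fun r z => c * Q r (inner ℝ e z) ^ (-(d : ℝ) / 2) * (2 * r - 2 * s * inner ℝ e z))
      hε (fun r hr z hz => ?_) ?_ (fun r hr z hz => ?_)
    · have h1 : ContinuousAt (fun z => Q r (inner ℝ e z)) z := by fun_prop
      exact (ContinuousAt.comp (f := fun z => Q r (inner ℝ e z))
        (hasDerivAt_gval_sqrt (d := d) (hd1 r hr z hz)).continuousAt h1).continuousWithinAt
    · have hpow : ContinuousOn (fun x : ℝ × Esp d => Q x.1 (inner ℝ e x.2) ^ (-(d : ℝ) / 2))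
          (Metric.closedBall r₀ ((s - |r₀|) / 2) ×ˢ Metric.sphere (0 : Esp d) 1) := by
        refine ContinuousOn.rpow_const (by fun_prop) fun x hx => Or.inl ?_
        exact (sq_add_sq_sub_pos (hball _ hx.1) (inner_mem_Icc_of_mem_sphere he hx.2)).ne'
      simp only [Function.uncurry_def]
      fun_prop
    · have h1 : HasDerivAt (Q · (inner ℝ e z)) (2 * r - 2 * s * inner ℝ e z) r := by
        have := ((hasDerivAt_pow 2 r).const_add (s ^ 2)).sub
          (((hasDerivAt_id r).const_mul (2 * s)).mul_const (inner ℝ e z))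
        exact this.congr_deriv (by simp)
      exact (hasDerivAt_gval_sqrt (d := d) (hd1 r hr z hz)).comp r h1
  have hconst := constant_of_has_deriv_right_zero
    (f := fun r => ∫ z, gval d √(Q r (inner ℝ e z)) ∂σ) (a := 0) (b := r)
    (fun x hx => (hder x hx.1 (hx.2.trans_lt hrs)).continuousAt.continuousWithinAt)
    (fun x hx => (hder x hx.1 (hx.2.trans hrs)).hasDerivWithinAt)
    r ⟨hr, le_rfl⟩
  have h0 : ∀ z : Esp d, √(Q 0 (inner ℝ e z)) = s := fun z => by
    simp [Q, Real.sqrt_sq (hr.trans hrs.le)]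
  simpa only [h0, integral_const, probReal_univ, one_smul] using hconst

end IsRotInvariant

theorem integrable_of_monotone_of_tendsto {α : Type*} [MeasurableSpace α] {μ : Measure α}
    {f : ℕ → α → ℝ} {F : α → ℝ} {C : ℝ} (hf : ∀ n, Integrable (f n) μ)
    (h_mono : ∀ᵐ x ∂μ, Monotone fun n => f n x)
    (h_tendsto : ∀ᵐ x ∂μ, Tendsto (fun n => f n x) atTop (𝓝 (F x)))
    (hC : ∀ n, ∫ x, f n x ∂μ ≤ C) : Integrable F μ := by
  have hFm : AEStronglyMeasurable F μ :=
    aestronglyMeasurable_of_tendsto_ae atTop (fun n => (hf n).aestronglyMeasurable) h_tendsto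
  suffices h : Integrable (fun x => F x - f 0 x) μ by
    refine (h.add (hf 0)).congr (ae_of_all _ fun x => ?_)
    simp
  refine ⟨hFm.sub (hf 0).aestronglyMeasurable, ?_⟩
  have hF0 : ∀ᵐ x ∂μ, f 0 x ≤ F x := by
    filter_upwards [h_mono, h_tendsto] with x h1 h2
    exact h1.ge_of_tendsto h2 0
  rw [hasFiniteIntegral_iff_ofReal (hF0.mono fun x hx => sub_nonneg.2 hx)]
  have hlim := lintegral_tendsto_of_tendsto_of_monotone (μ := μ)
    (f := fun n x => ENNReal.ofReal (f n x - f 0 x)) (F := fun x => ENNReal.ofReal (F x - f 0 x))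
    (fun n => ((hf n).sub (hf 0)).aestronglyMeasurable.aemeasurable.ennreal_ofReal)
    (h_mono.mono fun x hx m n hmn => ENNReal.ofReal_le_ofReal (sub_le_sub_right (hx hmn) _))
    (h_tendsto.mono fun x hx => ENNReal.tendsto_ofReal (hx.sub_const _))
  refine (le_of_tendsto' hlim fun n => ?_).trans_lt (ENNReal.ofReal_lt_top (r := C - ∫ x, f 0 x ∂μ))
  rw [← ofReal_integral_eq_lintegral_ofReal (f := fun x => f n x - f 0 x) ((hf n).sub (hf 0))
    (h_mono.mono fun x hx => sub_nonneg.2 (hx (Nat.zero_le n)))]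
  refine ENNReal.ofReal_le_ofReal ?_
  rw [integral_sub (hf n) (hf 0)]
  exact sub_le_sub_right (hC n) _

theorem gval_le_gval {d : ℕ} (hd : 2 ≤ d) {a b : ℝ} (ha : 0 < a) (hab : a ≤ b) :
    gval d b ≤ gval d a := by
  unfold gval
  split_ifs with h
  · exact neg_le_neg (Real.log_le_log ha hab)
  · refine Real.rpow_le_rpow_of_nonpos ha hab ?_
    have : (2 : ℝ) ≤ d := by exact_mod_cast hd
    linarith

theorem continuousAt_gval (d : ℕ) {a : ℝ} (ha : 0 < a) : ContinuousAt (gval d) a := by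
  unfold gval
  split_ifs with h
  · exact (Real.continuousAt_log ha.ne').neg
  · exact Real.continuousAt_rpow_const _ _ (Or.inl ha.ne')

theorem measurable_gval (d : ℕ) : Measurable (gval d) := by
  unfold gval
  split_ifs with h
  · exact Real.measurable_log.neg
  · fun_prop

theorem norm_sub_smul_eq_sqrt {d : ℕ} {e z : Esp d} (he : ‖e‖ = 1) (hz : ‖z‖ = 1) (s r : ℝ) :
    ‖s • e - r • z‖ = √(s ^ 2 + r ^ 2 - 2 * s * r * inner ℝ e z) := by
  rw [← Real.sqrt_sq (norm_nonneg (s • e - r • z)), norm_sub_sq_real, norm_smul, norm_smul, he, hz,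
    inner_smul_left, inner_smul_right, mul_one, mul_one, Real.norm_eq_abs, Real.norm_eq_abs, sq_abs,
    sq_abs]
  congr 1
  simp
  ring

namespace IsRotInvariant

variable {d : ℕ} {σ : Measure (Esp d)}

theorem integrable_gval_sqrt [IsFiniteMeasure σ] (hσ : IsRotInvariant σ) {e : Esp d}
    (he : ‖e‖ = 1) {s r : ℝ} (hr : 0 ≤ r) (hrs : r < s) :
    Integrable (fun z => gval d √(s ^ 2 + r ^ 2 - 2 * s * r * inner ℝ e z)) σ := by
  refine integrable_of_continuousOn_of_ae_mem (isCompact_sphere (0 : Esp d) 1) hσ.ae_mem_sphere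
    fun z hz => ?_
  have h1 : ContinuousAt (fun z : Esp d => √(s ^ 2 + r ^ 2 - 2 * s * r * inner ℝ e z)) z := by
    fun_prop
  have h2 := sq_add_sq_sub_pos (by rwa [abs_of_nonneg hr]) (inner_mem_Icc_of_mem_sphere he hz)
  exact (ContinuousAt.comp (g := gval d)
    (f := fun z : Esp d => √(s ^ 2 + r ^ 2 - 2 * s * r * inner ℝ e z))
    (continuousAt_gval d (Real.sqrt_pos.2 h2)) h1).continuousWithinAt

theorem ae_inner_lt_one (hσ : IsRotInvariant σ) {e : Esp d} (he : ‖e‖ = 1) :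
    ∀ᵐ z ∂σ, inner ℝ e z < 1 := by
  have h : ∀ᵐ z ∂σ, z ≠ e := by
    rw [ae_iff]
    simpa using hσ.singleton e
  filter_upwards [h, hσ.ae_mem_sphere] with z hz hz1
  refine lt_of_le_of_ne (inner_mem_Icc_of_mem_sphere he hz1).2 fun h => hz ?_
  exact ((inner_eq_one_iff_of_norm_eq_one he (by simpa using hz1)).1 h).symm

theorem integral_gval_sqrt_self [IsProbabilityMeasure σ] (hσ : IsRotInvariant σ) (hd : 2 ≤ d)
    {e : Esp d} (he : ‖e‖ = 1) {s : ℝ} (hs : 0 < s) :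
    Integrable (fun z => gval d √(s ^ 2 + s ^ 2 - 2 * s * s * inner ℝ e z)) σ ∧
      ∫ z, gval d √(s ^ 2 + s ^ 2 - 2 * s * s * inner ℝ e z) ∂σ = gval d s := by
  let a : ℕ → ℝ := fun n => 1 + 1 / ((n : ℝ) + 1)
  have ha1 : ∀ n, 1 < a n := fun n => by
    have : (0 : ℝ) < 1 / ((n : ℝ) + 1) := by positivity
    simp only [a]; linarith
  have ha0 : ∀ n, 0 < a n := fun n => one_pos.trans (ha1 n)
  have hanti : Antitone a := by
    intro m n hmn
    have : (m : ℝ) ≤ n := by exact_mod_cast hmn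
    simp only [a]
    gcongr
  have halim : Tendsto a atTop (𝓝 1) := by
    simpa [a] using (tendsto_one_div_add_atTop_nhds_zero_nat (𝕜 := ℝ)).const_add 1
  let f : ℕ → Esp d → ℝ := fun n z =>
    gval d √((s * a n) ^ 2 + (s / a n) ^ 2 - 2 * (s * a n) * (s / a n) * inner ℝ e z)
  have hlt : ∀ n, s / a n < s * a n := fun n =>
    (div_lt_self hs (ha1 n)).trans (lt_mul_of_one_lt_right hs (ha1 n))
  have hnn : ∀ n, 0 ≤ s / a n := fun n => (div_pos hs (ha0 n)).le
  have hfi : ∀ n, Integrable (f n) σ := fun n => hσ.integrable_gval_sqrt he (hnn n) (hlt n)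
  have hfint : ∀ n, ∫ z, f n z ∂σ = gval d (s * a n) := fun n =>
    hσ.integral_gval_sqrt hd he (hnn n) (hlt n)
  have hmul : ∀ n, (s * a n) * (s / a n) = s * s := fun n => by
    have := (ha0 n).ne'
    field_simp
  have hmono : ∀ᵐ z ∂σ, Monotone fun n => f n z := by
    filter_upwards [hσ.ae_mem_sphere] with z hz m n hmn
    refine gval_le_gval hd (Real.sqrt_pos.2 ?_) (Real.sqrt_le_sqrt ?_)
    · exact sq_add_sq_sub_pos (by rw [abs_of_nonneg (hnn n)]; exact hlt n)
        (inner_mem_Icc_of_mem_sphere he hz)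
    · have h3 : s * a n ≤ s * a m := mul_le_mul_of_nonneg_left (hanti hmn) hs.le
      have h4 : s / a m ≤ s / a n := div_le_div_of_nonneg_left hs.le (ha0 n) (hanti hmn)
      have h5 : s * a n - s / a n ≤ s * a m - s / a m := by linarith
      have h6 : 0 ≤ s * a n - s / a n := sub_nonneg.2 (hlt n).le
      have e : ∀ k, (s * a k) ^ 2 + (s / a k) ^ 2 - 2 * (s * a k) * (s / a k) * inner ℝ e z =
          (s * a k - s / a k) * (s * a k - s / a k) + 2 * (s * s) - 2 * (s * s) * inner ℝ e z :=
        fun k => by linear_combination (2 - 2 * inner ℝ e z) * hmul k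
      rw [e, e]
      linarith [mul_self_le_mul_self h6 h5]
  have htend : ∀ᵐ z ∂σ, Tendsto (fun n => f n z) atTop
      (𝓝 (gval d √(s ^ 2 + s ^ 2 - 2 * s * s * inner ℝ e z))) := by
    filter_upwards [hσ.ae_inner_lt_one he] with z hz
    have hpos : 0 < √(s ^ 2 + s ^ 2 - 2 * s * s * inner ℝ e z) := by
      refine Real.sqrt_pos.2 ?_
      nlinarith [mul_pos hs hs]
    refine (continuousAt_gval d hpos).tendsto.comp ?_
    have h1 : Tendsto (fun n => s * a n) atTop (𝓝 s) := by simpa using halim.const_mul s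
    have h2 : Tendsto (fun n => s / a n) atTop (𝓝 s) := by
      have := (tendsto_const_nhds (x := s)).div halim one_ne_zero
      rwa [div_one] at this
    refine (Real.continuous_sqrt.tendsto _).comp ?_
    exact ((h1.pow 2).add (h2.pow 2)).sub (((h1.const_mul 2).mul h2).mul_const _)
  have hint := integrable_of_monotone_of_tendsto (C := gval d s) hfi hmono htend fun n => by
    rw [hfint]
    exact gval_le_gval hd hs (le_mul_of_one_le_right hs.le (ha1 n).le)
  refine ⟨hint, tendsto_nhds_unique
    (integral_tendsto_of_tendsto_of_monotone hfi hint hmono htend) ?_⟩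
  simp only [hfint]
  refine (continuousAt_gval d hs).tendsto.comp ?_
  simpa using halim.const_mul s

theorem integral_gval_norm_sub [IsProbabilityMeasure σ] (hσ : IsRotInvariant σ) (hd : 2 ≤ d)
    (y : Esp d) {r : ℝ} (hr : 0 < r) :
    Integrable (fun z => gval d ‖y - r • z‖) σ ∧
      ∫ z, gval d ‖y - r • z‖ ∂σ = gval d (max ‖y‖ r) := by
  rcases eq_or_ne y 0 with rfl | hy
  · have h : (fun z : Esp d => gval d ‖0 - r • z‖) =ᵐ[σ] fun _ => gval d r := by
      filter_upwards [hσ.ae_norm] with z hz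
      rw [zero_sub, norm_neg, norm_smul, hz, Real.norm_of_nonneg hr.le, mul_one]
    refine ⟨(integrable_const _).congr h.symm, ?_⟩
    rw [integral_congr_ae h]
    simp [max_eq_right hr.le]
  · have hs : 0 < ‖y‖ := norm_pos_iff.2 hy
    set s := ‖y‖ with hsdef
    let e : Esp d := s⁻¹ • y
    have he : ‖e‖ = 1 := by
      rw [norm_smul, norm_inv, Real.norm_of_nonneg hs.le, inv_mul_cancel₀ hs.ne']
    have hye : y = s • e := (smul_inv_smul₀ hs.ne' y).symm
    have h : (fun z : Esp d => gval d ‖y - r • z‖) =ᵐ[σ]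
        fun z => gval d √(s ^ 2 + r ^ 2 - 2 * s * r * inner ℝ e z) := by
      filter_upwards [hσ.ae_norm] with z hz
      rw [hye, norm_sub_smul_eq_sqrt he hz]
    have h' : (fun z : Esp d => gval d ‖y - r • z‖) =ᵐ[σ]
        fun z => gval d √(r ^ 2 + s ^ 2 - 2 * r * s * inner ℝ e z) := by
      filter_upwards [h] with z hz
      rw [hz]
      congr 2
      ring
    rcases lt_trichotomy r s with hlt | heq | hlt
    · rw [integral_congr_ae h, max_eq_left hlt.le]
      exact ⟨(hσ.integrable_gval_sqrt he hr.le hlt).congr h.symm,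
        hσ.integral_gval_sqrt hd he hr.le hlt⟩
    · rw [integral_congr_ae h, max_eq_left heq.le, integrable_congr h, heq]
      exact hσ.integral_gval_sqrt_self hd he hs
    · rw [integral_congr_ae h', max_eq_right hlt.le]
      exact ⟨(hσ.integrable_gval_sqrt he hs.le hlt).congr h'.symm,
        hσ.integral_gval_sqrt hd he hs.le hlt⟩

end IsRotInvariant

theorem integral_gR_sphereUnif {d : ℕ} (hd : 2 ≤ d) (x y : Esp d) {η : ℝ} (hη : 0 < η) :
    Integrable (fun z => gR d (z - y)) (sphereUnif d x η) ∧
      ∫ z, gR d (z - y) ∂(sphereUnif d x η) = gval d (max ‖y - x‖ η) := by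
  obtain ⟨σ, hσp, hσ, h⟩ := exists_isRotInvariant_sphereUnif hd x hη
  have hm : Measurable (fun z : Esp d => x + η • z) := by fun_prop
  have hg : Measurable (fun z : Esp d => gR d (z - y)) :=
    (measurable_gval d).comp (by fun_prop : Measurable fun z : Esp d => ‖z - y‖)
  have hc : ∀ z : Esp d, gR d (x + η • z - y) = gval d ‖(y - x) - η • z‖ := by
    intro z
    change gval d ‖x + η • z - y‖ = _
    rw [← norm_neg]
    congr 2
    abel
  rw [h, integrable_map_measure hg.aestronglyMeasurable hm.aemeasurable,
    integral_map hm.aemeasurable hg.aestronglyMeasurable]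
  simp only [Function.comp_def, hc]
  exact hσ.integral_gval_norm_sub hd (y - x) hη

theorem measurable_gR (d : ℕ) : Measurable (gR d) :=
  (measurable_gval d).comp measurable_norm

theorem gval_nonneg_of_ne_two {d : ℕ} (hd : d ≠ 2) {a : ℝ} (ha : 0 ≤ a) : 0 ≤ gval d a := by
  rw [gval, if_neg hd]
  exact Real.rpow_nonneg ha _

theorem abs_gval_le_add_two {d : ℕ} {a : ℝ} (ha : 0 ≤ a) (ha2 : a ≤ 2) :
    |gval d a| ≤ gval d a + 2 := by
  have h : -1 ≤ gval d a := by
    by_cases hd : d = 2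
    · rw [gval, if_pos hd]
      rcases ha.eq_or_lt with rfl | ha
      · simp
      · linarith [Real.log_le_sub_one_of_pos ha]
    · linarith [gval_nonneg_of_ne_two hd ha]
  exact abs_le.2 ⟨by linarith, by linarith⟩

theorem abs_gval_le_of_one_le {d : ℕ} {a : ℝ} (ha : 1 ≤ a) (hd : d = 2) :
    |gval d a| = -gval d a := by
  rw [gval, if_pos hd, abs_neg, neg_neg, abs_of_nonneg (Real.log_nonneg ha)]

theorem integral_abs_gR_sphereUnif_le {d : ℕ} (hd : 2 ≤ d) (x y : Esp d) {η : ℝ} (hη : 0 < η)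
    (hη' : η ≤ 1 / 2) :
    ∫ z, |gR d (z - y)| ∂(sphereUnif d x η) ≤ |gval d (max ‖y - x‖ η)| + 2 := by
  have := isProbabilityMeasure_sphereUnif hd x hη
  obtain ⟨hi, hint⟩ := integral_gR_sphereUnif hd x y hη
  by_cases hfar : d = 2 ∧ 3 / 2 ≤ ‖y - x‖
  · have h : (fun z => |gR d (z - y)|) =ᵐ[sphereUnif d x η] fun z => -gR d (z - y) := by
      filter_upwards [ae_norm_sub_eq_sphereUnif d x η] with z hz
      refine abs_gval_le_of_one_le ?_ hfar.1
      have h1 := norm_sub_le_norm_sub_add_norm_sub y z x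
      rw [norm_sub_rev y z] at h1
      linarith [hfar.2]
    rw [integral_congr_ae h, integral_neg, hint]
    linarith [neg_le_abs (gval d (max ‖y - x‖ η))]
  · have h : (fun z => |gR d (z - y)|) ≤ᵐ[sphereUnif d x η] fun z => gR d (z - y) + 2 := by
      filter_upwards [ae_norm_sub_eq_sphereUnif d x η] with z hz
      by_cases hd2 : d = 2
      · refine abs_gval_le_add_two (norm_nonneg _) ?_
        have h1 := norm_sub_le_norm_sub_add_norm_sub z x y
        rw [norm_sub_rev x y] at h1
        have h2 : ‖y - x‖ < 3 / 2 := not_le.1 fun h => hfar ⟨hd2, h⟩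
        linarith
      · have h0 : 0 ≤ gR d (z - y) := gval_nonneg_of_ne_two hd2 (norm_nonneg _)
        rw [abs_of_nonneg h0]
        linarith
    refine (integral_mono_ae hi.abs (hi.add (integrable_const 2)) h).trans ?_
    rw [integral_add' hi (integrable_const 2), hint]
    simp [le_abs_self]

theorem integral_gR_prod_sphereUnif {d : ℕ} (hd : 2 ≤ d) (x : Esp d) {η : ℝ} (hη : 0 < η)
    (hη' : η ≤ 1 / 2) (ν : Measure (Esp d)) [IsFiniteMeasure ν] :
    ∫ p : Esp d × Esp d, gR d (p.1 - p.2) ∂((sphereUnif d x η).prod ν) =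
      ∫ y, gval d (max ‖y - x‖ η) ∂ν := by
  have := isProbabilityMeasure_sphereUnif hd x hη
  have hint : ∀ y, ∫ z, gR d (z - y) ∂(sphereUnif d x η) = gval d (max ‖y - x‖ η) := fun y =>
    (integral_gR_sphereUnif hd x y hη).2
  have hm : AEStronglyMeasurable (fun p : Esp d × Esp d => gR d (p.1 - p.2))
      ((sphereUnif d x η).prod ν) :=
    ((measurable_gR d).comp (measurable_fst.sub measurable_snd)).aestronglyMeasurable
  by_cases h : Integrable (fun y => gval d (max ‖y - x‖ η)) ν
  · have hp : Integrable (fun p : Esp d × Esp d => gR d (p.1 - p.2))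
        ((sphereUnif d x η).prod ν) := by
      refine (integrable_prod_iff' hm).2
        ⟨ae_of_all _ fun y => (integral_gR_sphereUnif hd x y hη).1, ?_⟩
      refine (h.abs.add (integrable_const 2)).mono' hm.norm.prod_swap.integral_prod_right'
        (ae_of_all _ fun y => ?_)
      simp only [Real.norm_eq_abs]
      rw [abs_of_nonneg (integral_nonneg fun z => abs_nonneg _)]
      exact integral_abs_gR_sphereUnif_le hd x y hη hη'
    rw [integral_prod_symm _ hp]
    simp only [hint]
  · rw [integral_undef h, integral_undef]
    intro hp
    refine h (hp.integral_prod_right.congr (ae_of_all _ fun y => hint y))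

theorem continuous_gval_max (d : ℕ) (x : Esp d) {η : ℝ} (hη : 0 < η) :
    Continuous fun y => gval d (max ‖y - x‖ η) := by
  refine continuous_iff_continuousAt.2 fun y => ?_
  have h : ContinuousAt (fun y : Esp d => max ‖y - x‖ η) y := by fun_prop
  exact ContinuousAt.comp (g := gval d) (f := fun y : Esp d => max ‖y - x‖ η)
    (continuousAt_gval d (lt_max_of_lt_right hη)) h

theorem integral_gR_prod_sphereUnif_self {d : ℕ} (hd : 2 ≤ d) (x : Esp d) {η : ℝ} (hη : 0 < η)
    (hη' : η ≤ 1 / 2) :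
    ∫ p : Esp d × Esp d, gR d (p.1 - p.2) ∂((sphereUnif d x η).prod (sphereUnif d x η)) =
      gval d η := by
  have := isProbabilityMeasure_sphereUnif hd x hη
  rw [integral_gR_prod_sphereUnif hd x hη hη']
  have h : (fun y => gval d (max ‖y - x‖ η)) =ᵐ[sphereUnif d x η] fun _ => gval d η := by
    filter_upwards [ae_norm_sub_eq_sphereUnif d x η] with z hz
    rw [hz, max_self]
  rw [integral_congr_ae h]
  simp

theorem integral_gR_prod_sphereUnif_le {d : ℕ} (hd : 2 ≤ d) {x x' : Esp d} (hx : x ≠ x')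
    {η η' : ℝ} (hη : 0 < η) (hη2 : η ≤ 1 / 2) (hη' : 0 < η') :
    ∫ p : Esp d × Esp d, gR d (p.1 - p.2) ∂((sphereUnif d x η).prod (sphereUnif d x' η')) ≤
      gR d (x - x') := by
  have := isProbabilityMeasure_sphereUnif hd x' hη'
  rw [integral_gR_prod_sphereUnif hd x hη hη2]
  obtain ⟨hi, hint⟩ := integral_gR_sphereUnif hd x' x hη'
  have hφ : Integrable (fun y => gval d (max ‖y - x‖ η)) (sphereUnif d x' η') := by
    refine integrable_of_continuousOn_of_ae_mem (isCompact_sphere x' η') ?_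
      (continuous_gval_max d x hη).continuousOn
    filter_upwards [ae_norm_sub_eq_sphereUnif d x' η'] with z hz
    rwa [mem_sphere_iff_norm]
  have hne : ∀ᵐ y ∂(sphereUnif d x' η'), y ≠ x := by
    rw [ae_iff]
    simpa using sphereUnif_singleton hd x' η' x
  have h : (fun y => gval d (max ‖y - x‖ η)) ≤ᵐ[sphereUnif d x' η'] fun y => gR d (y - x) := by
    filter_upwards [hne] with y hy
    exact gval_le_gval hd (norm_pos_iff.2 (sub_ne_zero.2 hy)) (le_max_left _ _)
  refine (integral_mono_ae hφ hi h).trans ?_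
  rw [hint]
  exact gval_le_gval hd (norm_pos_iff.2 (sub_ne_zero.2 hx)) (le_max_left _ _)

theorem integral_gR_prod_sphereUnif_of_add_le {d : ℕ} (hd : 2 ≤ d) {x x' : Esp d}
    {η η' : ℝ} (hη : 0 < η) (hη2 : η ≤ 1 / 2) (hη' : 0 < η') (hx : η + η' ≤ ‖x - x'‖) :
    ∫ p : Esp d × Esp d, gR d (p.1 - p.2) ∂((sphereUnif d x η).prod (sphereUnif d x' η')) =
      gR d (x - x') := by
  have := isProbabilityMeasure_sphereUnif hd x' hη'
  rw [integral_gR_prod_sphereUnif hd x hη hη2]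
  have h : (fun y => gval d (max ‖y - x‖ η)) =ᵐ[sphereUnif d x' η'] fun y => gR d (y - x) := by
    filter_upwards [ae_norm_sub_eq_sphereUnif d x' η'] with y hy
    have h1 := norm_sub_le_norm_sub_add_norm_sub x y x'
    rw [norm_sub_rev x y, hy] at h1
    rw [max_eq_left (by linarith)]
    rfl
  rw [integral_congr_ae h, (integral_gR_sphereUnif hd x' x hη').2, max_eq_left (by linarith)]
  rfl

theorem gval_sub_gval_le {d : ℕ} (hd : 2 ≤ d) {t η : ℝ} (ht : 0 < t) (htη : t ≤ η) :
    gval d t - gval d η ≤ η * (t ^ (d - 1))⁻¹ := by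
  have hη : 0 < η := ht.trans_le htη
  by_cases h : d = 2
  · subst h
    have h1 := Real.log_le_sub_one_of_pos (div_pos hη ht)
    rw [Real.log_div hη.ne' ht.ne'] at h1
    simp only [gval, if_true, Nat.add_one_sub_one, pow_one, ← div_eq_mul_inv]
    linarith
  · have h1 : gval d t = t * (t ^ (d - 1))⁻¹ := by
      obtain ⟨n, rfl⟩ : ∃ n, d = n + 2 := ⟨d - 2, by omega⟩
      rw [gval, if_neg h, show (2 - ((n + 2 : ℕ) : ℝ)) = -(n : ℝ) by push_cast; ring,
        Real.rpow_neg ht.le, Real.rpow_natCast, show n + 2 - 1 = n + 1 by omega, pow_succ]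
      field_simp
    have h2 := gval_nonneg_of_ne_two h hη.le
    have h3 : t * (t ^ (d - 1))⁻¹ ≤ η * (t ^ (d - 1))⁻¹ :=
      mul_le_mul_of_nonneg_right htη (by positivity)
    linarith

theorem integral_indicator_inv_norm_pow {d : ℕ} (hd : 2 ≤ d) (x : Esp d) {η : ℝ} (hη : 0 < η) :
    Integrable (fun y : Esp d => (Set.Iio η).indicator (fun t => η * (t ^ (d - 1))⁻¹) ‖y - x‖) ∧
      ∫ y : Esp d, (Set.Iio η).indicator (fun t => η * (t ^ (d - 1))⁻¹) ‖y - x‖ =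
        d * volume.real (Metric.ball (0 : Esp d) 1) * η ^ 2 := by
  have : Nontrivial (Esp d) := by
    have : Nonempty (Fin d) := ⟨⟨0, by omega⟩⟩
    infer_instance
  set K : ℝ → ℝ := (Set.Iio η).indicator (fun t => η * (t ^ (d - 1))⁻¹) with hK
  have hfr : Module.finrank ℝ (Esp d) = d := finrank_euclideanSpace_fin
  have h : Set.EqOn (fun t : ℝ => t ^ (d - 1) • K t) ((Set.Iio η).indicator fun _ => η)
      (Set.Ioi 0) := by
    intro t ht
    have ht : (0 : ℝ) < t := ht
    by_cases htη : t ∈ Set.Iio η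
    · simp only [hK, Set.indicator_of_mem htη, smul_eq_mul]
      field_simp
    · simp only [hK, Set.indicator_of_notMem htη, smul_zero]
  have hint : IntegrableOn ((Set.Iio η).indicator fun _ => η) (Set.Ioi (0 : ℝ)) := by
    rw [IntegrableOn, integrable_indicator_iff measurableSet_Iio, IntegrableOn,
      Measure.restrict_restrict measurableSet_Iio, Set.inter_comm, Set.Ioi_inter_Iio]
    exact integrableOn_const (by simp)
  constructor
  · refine Integrable.comp_sub_right (f := fun y : Esp d => K ‖y‖) ?_ x
    rw [integrable_fun_norm_addHaar, hfr]
    exact (integrableOn_congr_fun h measurableSet_Ioi).2 hint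
  · rw [integral_sub_right_eq_self (fun y : Esp d => K ‖y‖) x, integral_fun_norm_addHaar, hfr,
      setIntegral_congr_fun measurableSet_Ioi h, setIntegral_indicator measurableSet_Iio,
      Set.Ioi_inter_Iio, setIntegral_const]
    simp [hη.le]
    ring

theorem hpot_sub_integral_gval_max_mem {d : ℕ} (hd : 2 ≤ d) {M : ℝ} (hM : 0 ≤ M)
    {μ : Measure (Esp d)} (hμ : μ ≤ ENNReal.ofReal M • volume) (x : Esp d) {η : ℝ} (hη : 0 < η) :
    hpot d μ x - ∫ y, gval d (max ‖y - x‖ η) ∂μ ∈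
      Set.Icc 0 (d * volume.real (Metric.ball (0 : Esp d) 1) * M * η ^ 2) := by
  have : Nontrivial (Esp d) := by
    have : Nonempty (Fin d) := ⟨⟨0, by omega⟩⟩
    infer_instance
  obtain ⟨hKi, hKint⟩ := integral_indicator_inv_norm_pow hd x hη
  set K : Esp d → ℝ :=
    fun y => (Set.Iio η).indicator (fun t => η * (t ^ (d - 1))⁻¹) ‖y - x‖ with hK
  have hKM : Integrable K (ENNReal.ofReal M • volume) := hKi.smul_measure ENNReal.ofReal_ne_top
  have hKμ : Integrable K μ := hKM.mono_measure hμ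
  have hK0 : ∀ y, 0 ≤ K y := fun y => by
    rw [hK]
    by_cases h : ‖y - x‖ ∈ Set.Iio η
    · simp only [Set.indicator_of_mem h]
      positivity
    · simp only [Set.indicator_of_notMem h, le_refl]
  have hne : ∀ᵐ y ∂μ, y ≠ x := by
    have h : ∀ᵐ y ∂(volume : Measure (Esp d)), y ≠ x := by
      rw [ae_iff]
      simp
    exact (Measure.absolutelyContinuous_of_le_smul hμ).ae_le h
  have hD : ∀ᵐ y ∂μ, 0 ≤ gR d (x - y) - gval d (max ‖y - x‖ η) ∧
      gR d (x - y) - gval d (max ‖y - x‖ η) ≤ K y := by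
    filter_upwards [hne] with y hy
    have hpos : 0 < ‖y - x‖ := norm_pos_iff.2 (sub_ne_zero.2 hy)
    have hg : gR d (x - y) = gval d ‖y - x‖ := by rw [norm_sub_rev]; rfl
    rw [hg]
    refine ⟨sub_nonneg.2 (gval_le_gval hd hpos (le_max_left _ _)), ?_⟩
    rcases lt_or_ge ‖y - x‖ η with h | h
    · rw [max_eq_right h.le, hK]
      simp only [Set.indicator_of_mem (Set.mem_Iio.2 h)]
      exact gval_sub_gval_le hd hpos h.le
    · rw [max_eq_left h, sub_self]
      exact hK0 y
  have hφm : Measurable fun y => gval d (max ‖y - x‖ η) := (continuous_gval_max d x hη).measurable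
  have hgm : Measurable fun y => gR d (x - y) := (measurable_gR d).comp (by fun_prop)
  have hDi : Integrable (fun y => gR d (x - y) - gval d (max ‖y - x‖ η)) μ := by
    refine hKμ.mono' (hgm.sub hφm).aestronglyMeasurable ?_
    filter_upwards [hD] with y hy
    rw [Real.norm_of_nonneg hy.1]
    exact hy.2
  by_cases hφ : Integrable (fun y => gval d (max ‖y - x‖ η)) μ
  · have hg : Integrable (fun y => gR d (x - y)) μ :=
      (hDi.add hφ).congr (ae_of_all _ fun y => by simp)
    rw [hpot, ← integral_sub hg hφ]
    refine ⟨integral_nonneg_of_ae (hD.mono fun y hy => hy.1), ?_⟩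
    refine (integral_mono_ae hDi hKμ (hD.mono fun y hy => hy.2)).trans ?_
    refine (integral_mono_measure hμ (ae_of_all _ hK0) hKM).trans ?_
    rw [integral_smul_measure, hKint, ENNReal.toReal_ofReal hM, smul_eq_mul]
    exact le_of_eq (by ring)
  · have hg : ¬ Integrable (fun y => gR d (x - y)) μ := fun hg =>
      hφ ((hg.sub hDi).congr (ae_of_all _ fun y => by simp))
    rw [hpot, integral_undef hφ, integral_undef hg, sub_zero]
    exact ⟨le_rfl, by positivity⟩

theorem EReal.coe_finset_sum {ι : Type*} (s : Finset ι) (f : ι → ℝ) :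
    ((∑ i ∈ s, f i : ℝ) : EReal) = ∑ i ∈ s, (f i : EReal) := by
  classical
  induction s using Finset.induction_on with
  | empty => simp
  | insert a s ha ih => rw [Finset.sum_insert ha, Finset.sum_insert ha, EReal.coe_add, ih]

/-- The interaction energy of two uniformly charged spheres. -/
def sphereInteraction (d : ℕ) (x : Esp d) (η : ℝ) (x' : Esp d) (η' : ℝ) : ℝ :=
  ∫ p : Esp d × Esp d, gR d (p.1 - p.2) ∂((sphereUnif d x η).prod (sphereUnif d x' η'))

theorem sphereInteraction_le_gE {d : ℕ} (hd : 2 ≤ d) (x x' : Esp d) {η η' : ℝ} (hη : 0 < η)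
    (hη2 : η ≤ 1 / 2) (hη' : 0 < η') :
    (sphereInteraction d x η x' η' : EReal) ≤ gE d (x - x') := by
  by_cases hx : x = x'
  · simp [gE, hx]
  · rw [gE, if_neg (sub_ne_zero.2 hx), EReal.coe_le_coe_iff]
    exact integral_gR_prod_sphereUnif_le hd hx hη hη2 hη'

theorem gE_eq_sphereInteraction {d : ℕ} (hd : 2 ≤ d) {x x' : Esp d} {η η' : ℝ} (hη : 0 < η)
    (hη2 : η ≤ 1 / 2) (hη' : 0 < η') (h : Disjoint (Metric.ball x η) (Metric.ball x' η')) :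
    gE d (x - x') = (sphereInteraction d x η x' η' : EReal) := by
  have hle : η + η' ≤ ‖x - x'‖ := by
    rw [← dist_eq_norm]
    exact (disjoint_ball_ball_iff hη hη').1 h
  have hx : x - x' ≠ 0 := norm_pos_iff.1 ((add_pos hη hη').trans_le hle)
  rw [gE, if_neg hx, sphereInteraction, integral_gR_prod_sphereUnif_of_add_le hd hη hη2 hη' hle]

theorem smeared_eq {d : ℕ} (hd : 2 ≤ d) (N : ℕ) (μ : Measure (Esp d)) [IsFiniteMeasure μ]
    (X : Fin N → Esp d) {η : Fin N → ℝ} (hη : ∀ i, 0 < η i ∧ η i ≤ 1 / 2) :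
    smeared d N μ X η =
      (∑ i, ∑ j, if i ≠ j then sphereInteraction d (X i) (η i) (X j) (η j) else 0)
        + ∑ i, gval d (η i)
        - 2 * N * ∑ i, ∫ y, gval d (max ‖y - X i‖ (η i)) ∂μ + (N : ℝ) ^ 2 * Dg d μ := by
  have h1 : ∀ i, ∑ j, sphereInteraction d (X i) (η i) (X j) (η j) =
      (∑ j, if i ≠ j then sphereInteraction d (X i) (η i) (X j) (η j) else 0)
        + gval d (η i) := by
    intro i
    have h2 : gval d (η i) =
        ∑ j, if i = j then sphereInteraction d (X i) (η i) (X j) (η j) else 0 := by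
      rw [Finset.sum_ite_eq, if_pos (Finset.mem_univ i), sphereInteraction,
        integral_gR_prod_sphereUnif_self hd (X i) (hη i).1 (hη i).2]
    rw [h2, ← Finset.sum_add_distrib]
    refine Finset.sum_congr rfl fun j _ => ?_
    by_cases h : i = j <;> simp [h]
  rw [smeared, ← Finset.sum_add_distrib]
  simp only [← h1, integral_gR_prod_sphereUnif hd (X _) (hη _).1 (hη _).2 μ]
  rfl

/-- comparison between the next-order energy `F_N^μ` and its smeared version:
`F_N^μ ≥ (smeared energy) - Σᵢ g(ηᵢ) - C_d N ‖μ‖_∞ Σᵢ ηᵢ²` always, and the reverse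
inequality (with `+` error term) holds when the balls `B(xᵢ, ηᵢ)` are pairwise disjoint. -/
theorem statement_7 (d : ℕ) (hd : 2 ≤ d) :
    ∃ C : ℝ, 0 < C ∧
      ∀ (M : ℝ) (μ : Measure (Esp d)) (ρ : Esp d → ℝ≥0∞),
        IsProbabilityMeasure μ → μ = volume.withDensity ρ →
        (∀ x, ρ x ≤ ENNReal.ofReal M) →
        ∀ (N : ℕ) (X : Fin N → Esp d) (η : Fin N → ℝ),
          (∀ i, 0 < η i ∧ η i ≤ 1 / 2) →
          (((smeared d N μ X η - ∑ i, gval d (η i) - C * N * M * ∑ i, (η i) ^ 2 : ℝ) : EReal)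
              ≤ FNe d N μ X) ∧
          (Pairwise (fun i j =>
              Disjoint (Metric.ball (X i) (η i)) (Metric.ball (X j) (η j))) →
            FNe d N μ X ≤
              (((smeared d N μ X η - ∑ i, gval d (η i) + C * N * M * ∑ i, (η i) ^ 2 : ℝ)
                : EReal))) := by
  set C₀ : ℝ := d * volume.real (Metric.ball (0 : Esp d) 1) with hC₀
  have hC₀pos : 0 < C₀ := by
    have h1 : (0 : ℝ) < d := by exact_mod_cast (by omega : 0 < d)
    have h2 : 0 < volume.real (Metric.ball (0 : Esp d) 1) :=
      ENNReal.toReal_pos (Metric.measure_ball_pos volume _ one_pos).ne' measure_ball_lt_top.ne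
    positivity
  refine ⟨2 * C₀, by positivity, fun M μ ρ hμp hμρ hρ N X η hη => ?_⟩
  have hμ : μ ≤ ENNReal.ofReal M • volume := by
    rw [hμρ, ← withDensity_const]
    exact withDensity_mono (ae_of_all _ hρ)
  have hM : 0 ≤ M := by
    by_contra hM
    rw [ENNReal.ofReal_of_nonpos (not_le.1 hM).le, zero_smul] at hμ
    exact IsProbabilityMeasure.ne_zero μ (le_antisymm hμ (Measure.zero_le μ))
  have hpot_mem := fun i => hpot_sub_integral_gval_max_mem hd hM hμ (X i) (hη i).1
  have hlow : ∑ i, ∫ y, gval d (max ‖y - X i‖ (η i)) ∂μ ≤ ∑ i, hpot d μ (X i) :=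
    Finset.sum_le_sum fun i _ => sub_nonneg.1 (hpot_mem i).1
  have hupp : ∑ i, hpot d μ (X i) ≤
      ∑ i, ∫ y, gval d (max ‖y - X i‖ (η i)) ∂μ + C₀ * M * ∑ i, η i ^ 2 := by
    rw [Finset.mul_sum, ← Finset.sum_add_distrib]
    exact Finset.sum_le_sum fun i _ => by linarith [(hpot_mem i).2]
  have hN : (0 : ℝ) ≤ N := N.cast_nonneg
  have hη0 : 0 ≤ ∑ i, η i ^ 2 := Finset.sum_nonneg fun i _ => sq_nonneg _
  rw [smeared_eq hd N μ X hη, FNe]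
  set S : ℝ := ∑ i, ∑ j, if i ≠ j then sphereInteraction d (X i) (η i) (X j) (η j) else 0 with hS
  have hSE : (S : EReal) = ∑ i, ∑ j,
      if i ≠ j then (sphereInteraction d (X i) (η i) (X j) (η j) : EReal) else 0 := by
    simp only [hS, EReal.coe_finset_sum]
    refine Finset.sum_congr rfl fun i _ => Finset.sum_congr rfl fun j _ => ?_
    split_ifs <;> rfl
  constructor
  · have h : (S : EReal) ≤ ∑ i, ∑ j, if i ≠ j then gE d (X i - X j) else 0 := by
      rw [hSE]
      refine Finset.sum_le_sum fun i _ => Finset.sum_le_sum fun j _ => ?_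
      split_ifs
      · exact sphereInteraction_le_gE hd _ _ (hη i).1 (hη i).2 (hη j).1
      · exact le_rfl
    refine le_trans ?_ (add_le_add_left h _)
    rw [← EReal.coe_add, EReal.coe_le_coe_iff]
    linarith [mul_le_mul_of_nonneg_left hupp hN]
  · intro hdisj
    have h : ∑ i, ∑ j, (if i ≠ j then gE d (X i - X j) else 0) = (S : EReal) := by
      rw [hSE]
      refine Finset.sum_congr rfl fun i _ => Finset.sum_congr rfl fun j _ => ?_
      split_ifs with hij
      · exact gE_eq_sphereInteraction hd (hη i).1 (hη i).2 (hη j).1 (hdisj hij)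
      · rfl
    rw [h, ← EReal.coe_add, EReal.coe_le_coe_iff]
    have h1 := mul_le_mul_of_nonneg_left hlow hN
    have h2 : 0 ≤ C₀ * N * M * ∑ i, η i ^ 2 := by positivity
    linarith
end
end

section
/- Let d = 2 and g(x) = -log|x| on ℝ². Let β > 0 and let V : ℝ² → ℝ be continuous, such that the equilibrium measure μ_V exists and has an L^∞ density, and such that ∫ exp(-βN(V(x)/2 - log|x|)) dx < ∞ for N large enough. Then there is a constant C (depending only on β and μ_V) such that for N large enough, |log Z_{N,β} + (β/2) N² I_V(μ_V) - (β/4) N log N| ≤ C N, where Z_{N,β} = ∫_{(ℝ²)^N} exp(-(β/2) H_N) dx₁...dx_N. -/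
open MeasureTheory Filter Topology
open scoped ENNReal

noncomputable section

/-- The plane `ℝ²`. -/
abbrev Plane := EuclideanSpace ℝ (Fin 2)

/-- The real-valued two-dimensional logarithmic kernel `g(x) = -log|x|`. -/
def gR2 (x : Plane) : ℝ := - Real.log ‖x‖

open scoped Classical in
/-- The extended-real-valued logarithmic kernel, equal to `+∞` at the origin. -/
def gE2 (x : Plane) : EReal := if x = 0 then ⊤ else ((gR2 x : ℝ) : EReal)

/-- The energy functional `I_V(μ) = ∬ g(x-y) dμ(x)dμ(y) + ∫ V dμ`, written as
`∬ [g(x-y) + V(x)/2 + V(y)/2] dμ(x)dμ(y)` with extended-real values; used to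
characterize the equilibrium measure. -/
def IVE2 (V : Plane → ℝ) (μ : Measure Plane) : EReal :=
  eIntE (μ.prod μ) (fun p => gE2 (p.1 - p.2) + ((V p.1 / 2 + V p.2 / 2 : ℝ) : EReal))

/-- The (real) value `I_V(μ) = ∬ g(x-y) dμ(x)dμ(y) + ∫ V dμ` (Bochner integrals). -/
def IVr2 (V : Plane → ℝ) (μ : Measure Plane) : ℝ :=
  (∫ p : Plane × Plane, gR2 (p.1 - p.2) ∂(μ.prod μ)) + ∫ x, V x ∂μ

/-- The `N`-point Hamiltonian `H_N = Σ_{i≠j} g(x_i-x_j) + N Σ_i V(x_i)`. -/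
def HN2 (N : ℕ) (V : Plane → ℝ) (X : Fin N → Plane) : ℝ :=
  (∑ i, ∑ j, if i ≠ j then gR2 (X i - X j) else 0) + N * ∑ i, V (X i)

/-- The partition function `Z_{N,β} = ∫ exp(-(β/2) H_N) dX_N`. -/
def ZN2 (N : ℕ) (β : ℝ) (V : Plane → ℝ) : ℝ≥0∞ :=
  ∫⁻ X : Fin N → Plane, ENNReal.ofReal (Real.exp (-(β / 2) * HN2 N V X))

/-- The exponential integral `E₁(s) = ∫_s^∞ e^{-v}/v dv`. -/
def expInt (s : ℝ) : ℝ := ∫ v in Set.Ioi s, Real.exp (-v) / v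

/-- The Gaussian superposition `∫_0^T (1 - e^{-ta})/t dt`. -/
def einInt (T a : ℝ) : ℝ := ∫ t in (0 : ℝ)..T, (1 - Real.exp (-(t * a))) / t

lemma integrableOn_exp_neg_div {s : ℝ} (hs : 0 < s) :
    IntegrableOn (fun v : ℝ => Real.exp (-v) / v) (Set.Ioi s) := by
  refine Integrable.mono' ((integrableOn_exp_neg_Ioi s).const_mul s⁻¹)
    (show Measurable _ by fun_prop).aestronglyMeasurable ?_
  refine (ae_restrict_mem measurableSet_Ioi).mono fun v hv => ?_
  have hv' : s < v := hv
  have h0 : 0 < v := hs.trans hv'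
  rw [Real.norm_of_nonneg (by positivity), div_eq_inv_mul]
  gcongr

lemma expInt_nonneg {s : ℝ} (hs : 0 ≤ s) : 0 ≤ expInt s := by
  refine setIntegral_nonneg measurableSet_Ioi fun v hv => ?_
  have : 0 < v := hs.trans_lt hv
  positivity

lemma one_sub_exp_div_nonneg {t a : ℝ} (ht : 0 ≤ t) (ha : 0 ≤ a) :
    0 ≤ (1 - Real.exp (-(t * a))) / t := by
  refine div_nonneg ?_ ht
  rw [sub_nonneg, Real.exp_le_one_iff]
  simp; positivity

lemma one_sub_exp_div_le {t a : ℝ} (ht : 0 ≤ t) (ha : 0 ≤ a) :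
    (1 - Real.exp (-(t * a))) / t ≤ a := by
  rcases ht.eq_or_lt with rfl | h
  · simpa using ha
  · rw [div_le_iff₀ h]
    have := Real.add_one_le_exp (-(t * a))
    linarith

lemma integrableOn_one_sub_exp_div {T a : ℝ} (ha : 0 ≤ a) :
    IntegrableOn (fun t => (1 - Real.exp (-(t * a))) / t) (Set.Ioc 0 T) := by
  refine Measure.integrableOn_of_bounded (M := a) (by simp)
    (show Measurable _ by fun_prop).aestronglyMeasurable ?_
  refine (ae_restrict_mem measurableSet_Ioc).mono fun t ht => ?_
  rw [Real.norm_of_nonneg (one_sub_exp_div_nonneg ht.1.le ha)]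
  exact one_sub_exp_div_le ht.1.le ha

lemma einInt_nonneg {T a : ℝ} (hT : 0 ≤ T) (ha : 0 ≤ a) : 0 ≤ einInt T a :=
  intervalIntegral.integral_nonneg hT fun _ ht => one_sub_exp_div_nonneg ht.1 ha

lemma ofReal_einInt {T a : ℝ} (hT : 0 ≤ T) (ha : 0 ≤ a) :
    ENNReal.ofReal (einInt T a) =
      ∫⁻ t in Set.Ioc 0 T, ENNReal.ofReal ((1 - Real.exp (-(t * a))) / t) := by
  rw [einInt, intervalIntegral.integral_of_le hT,
    ofReal_integral_eq_lintegral_ofReal (integrableOn_one_sub_exp_div ha)]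
  exact (ae_restrict_mem measurableSet_Ioc).mono fun t ht => one_sub_exp_div_nonneg ht.1.le ha

lemma einInt_eq_einInt_one {T a : ℝ} (ha : a ≠ 0) : einInt T a = einInt (T * a) 1 := by
  unfold einInt
  rw [← zero_mul a, ← intervalIntegral.mul_integral_comp_mul_right (c := a),
    ← intervalIntegral.integral_const_mul]
  simp only [zero_mul]
  congr 1
  ext t
  field_simp

lemma einInt_one_sub_log {s r : ℝ} (hs : 0 < s) (hr : 0 < r) :
    einInt s 1 - Real.log s - expInt s = einInt r 1 - Real.log r - expInt r := by
  have hi : ∀ {u : ℝ}, 0 < u →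
      IntervalIntegrable (fun t => (1 - Real.exp (-(t * 1))) / t) volume 0 u := fun {u} hu =>
    (intervalIntegrable_iff_integrableOn_Ioc_of_le hu.le).2
      (integrableOn_one_sub_exp_div zero_le_one)
  have h1 : einInt s 1 - einInt r 1 = ∫ t in r..s, (1 - Real.exp (-(t * 1))) / t :=
    intervalIntegral.integral_interval_sub_left (hi hs) (hi hr)
  have hE : IntervalIntegrable (fun v : ℝ => Real.exp (-v) / v) volume r s := by
    refine ContinuousOn.intervalIntegrable fun v hv => ?_
    have : v ≠ 0 := fun h => by
      subst h
      exact absurd hv (Set.notMem_uIcc_of_lt hr hs)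
    exact ContinuousAt.continuousWithinAt (by fun_prop (disch := assumption))
  have h2 := intervalIntegral.integral_interval_add_Ioi' hE (integrableOn_exp_neg_div hs)
  have h3 : ∫ t in r..s, (1 - Real.exp (-(t * 1))) / t
      = (∫ t in r..s, t⁻¹) - ∫ v in r..s, Real.exp (-v) / v := by
    rw [← intervalIntegral.integral_sub _ hE]
    · congr 1; ext t; rw [mul_one]; ring
    · exact intervalIntegrable_inv_iff.2 (Or.inr (Set.notMem_uIcc_of_lt hr hs))
  rw [integral_inv_of_pos hr hs, Real.log_div hs.ne' hr.ne'] at h3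
  unfold expInt
  linarith

/-- The constant `γ = einInt s 1 - log s - expInt s`, independent of `s > 0`. -/
def einConst : ℝ := einInt 1 1 - Real.log 1 - expInt 1

lemma gR2_eq {T : ℝ} (hT : 0 < T) {x : Plane} (hx : x ≠ 0) :
    gR2 x = (Real.log T + einConst) / 2 - einInt T (‖x‖ ^ 2) / 2 + expInt (T * ‖x‖ ^ 2) / 2 := by
  have hx' : 0 < ‖x‖ := norm_pos_iff.2 hx
  have h := einInt_one_sub_log (s := T * ‖x‖ ^ 2) (r := 1) (by positivity) one_pos
  rw [einInt_eq_einInt_one (by positivity), gR2, einConst]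
  rw [Real.log_mul hT.ne' (by positivity), Real.log_pow] at h
  push_cast at h
  linarith

lemma einInt_zero (T : ℝ) : einInt T 0 = 0 := by simp [einInt]

lemma gR2_le (x : Plane) : gR2 x ≤ |einConst| / 2 + expInt (‖x‖ ^ 2) / 2 := by
  have h1 := expInt_nonneg (s := ‖x‖ ^ 2) (by positivity)
  by_cases hx : x = 0
  · subst hx
    rw [show gR2 (0 : Plane) = 0 by simp [gR2]]
    exact add_nonneg (div_nonneg (abs_nonneg _) zero_le_two) (div_nonneg h1 zero_le_two)
  · have h := gR2_eq one_pos hx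
    have h2 := einInt_nonneg zero_le_one (a := ‖x‖ ^ 2) (by positivity)
    have h3 := le_abs_self einConst
    simp only [Real.log_one, one_mul, zero_add] at h
    linarith

lemma measurable_expInt : Measurable expInt := by
  have : StronglyMeasurable (Function.uncurry fun (s v : ℝ) =>
      Set.indicator (Set.Ioi s) (fun v => Real.exp (-v) / v) v) := by
    apply Measurable.stronglyMeasurable
    have : (Function.uncurry fun (s v : ℝ) =>
        Set.indicator (Set.Ioi s) (fun v => Real.exp (-v) / v) v)
        = Set.indicator {p : ℝ × ℝ | p.1 < p.2} (fun p => Real.exp (-p.2) / p.2) := by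
      ext ⟨s, v⟩; simp [Set.indicator, Function.uncurry]
    rw [this]
    exact Measurable.indicator (by fun_prop) (measurableSet_lt measurable_fst measurable_snd)
  have h := (this.integral_prod_right (ν := (volume : Measure ℝ))).measurable
  convert h using 2 with s
  rw [expInt, ← integral_indicator measurableSet_Ioi]

lemma ofReal_expInt_le (s : ℝ) :
    ENNReal.ofReal (expInt s) ≤ ∫⁻ v in Set.Ioi s, ENNReal.ofReal (Real.exp (-v) / v) := by
  rw [expInt]
  by_cases hf : IntegrableOn (fun v : ℝ => Real.exp (-v) / v) (Set.Ioi s)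
  · rw [integral_eq_lintegral_pos_part_sub_lintegral_neg_part hf]
    refine (ENNReal.ofReal_le_ofReal (sub_le_self _ ENNReal.toReal_nonneg)).trans ?_
    exact ENNReal.ofReal_toReal_le
  · rw [integral_undef hf]; simp

lemma lintegral_expInt_norm_le {T : ℝ} (hT : 0 < T) :
    ∫⁻ x : Plane, ENNReal.ofReal (expInt (T * ‖x‖ ^ 2)) ≤ ENNReal.ofReal (Real.pi / T) := by
  have hmeas : Measurable (Function.uncurry fun (x : Plane) (v : ℝ) =>
      Set.indicator (Set.Ioi (T * ‖x‖ ^ 2))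
        (fun v => ENNReal.ofReal (Real.exp (-v) / v)) v) := by
    have : (Function.uncurry fun (x : Plane) (v : ℝ) =>
        Set.indicator (Set.Ioi (T * ‖x‖ ^ 2)) (fun v => ENNReal.ofReal (Real.exp (-v) / v)) v)
        = Set.indicator {p : Plane × ℝ | T * ‖p.1‖ ^ 2 < p.2}
          (fun p => ENNReal.ofReal (Real.exp (-p.2) / p.2)) := by
      ext ⟨s, v⟩; simp [Set.indicator, Function.uncurry]
    rw [this]
    exact Measurable.indicator (by fun_prop) (measurableSet_lt (by fun_prop) measurable_snd)
  calc ∫⁻ x : Plane, ENNReal.ofReal (expInt (T * ‖x‖ ^ 2))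
      ≤ ∫⁻ x : Plane, ∫⁻ v : ℝ, Set.indicator (Set.Ioi (T * ‖x‖ ^ 2))
        (fun v => ENNReal.ofReal (Real.exp (-v) / v)) v := by
        refine lintegral_mono fun x => ?_
        rw [lintegral_indicator measurableSet_Ioi]
        exact ofReal_expInt_le _
    _ = ∫⁻ v : ℝ, ∫⁻ x : Plane, Set.indicator (Set.Ioi (T * ‖x‖ ^ 2))
        (fun v => ENNReal.ofReal (Real.exp (-v) / v)) v :=
        lintegral_lintegral_swap hmeas.aemeasurable
    _ ≤ ∫⁻ v in Set.Ioi (0 : ℝ), ENNReal.ofReal (Real.pi / T * Real.exp (-v)) := by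
        rw [← lintegral_indicator measurableSet_Ioi]
        refine lintegral_mono fun v => ?_
        by_cases hv : 0 < v
        · have : (fun x : Plane => Set.indicator (Set.Ioi (T * ‖x‖ ^ 2))
              (fun v => ENNReal.ofReal (Real.exp (-v) / v)) v)
              = Set.indicator (Metric.ball (0 : Plane) (√(v / T)))
                (fun _ => ENNReal.ofReal (Real.exp (-v) / v)) := by
            ext x
            have : T * ‖x‖ ^ 2 < v ↔ ‖x‖ < √(v / T) := by
              rw [Real.lt_sqrt (norm_nonneg x), lt_div_iff₀ hT, mul_comm]
            simp [Set.indicator, this]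
          simp only [this]
          rw [lintegral_indicator_const Metric.isOpen_ball.measurableSet,
            EuclideanSpace.volume_ball_fin_two, Set.indicator_of_mem (by exact hv)]
          rw [← ENNReal.ofReal_pow (Real.sqrt_nonneg _), Real.sq_sqrt (by positivity),
            ← ENNReal.ofReal_mul (by positivity), ← ENNReal.ofReal_mul (by positivity)]
          refine ENNReal.ofReal_le_ofReal (le_of_eq ?_)
          field_simp
        · have : ∀ x : Plane, Set.indicator (Set.Ioi (T * ‖x‖ ^ 2))
              (fun v => ENNReal.ofReal (Real.exp (-v) / v)) v = 0 := fun x => by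
            refine Set.indicator_of_notMem ?_ _
            have : 0 ≤ T * ‖x‖ ^ 2 := by positivity
            simp only [Set.mem_Ioi]; linarith
          simp [this]
    _ = ENNReal.ofReal (Real.pi / T) := by
        rw [← ofReal_integral_eq_lintegral_ofReal]
        · rw [integral_const_mul, integral_exp_neg_Ioi_zero, mul_one]
        · exact (integrableOn_exp_neg_Ioi 0).const_mul _
        · exact ae_of_all _ fun v => by positivity

lemma lintegral_gaussian_mul_gaussian (b : ℝ) (x y : Plane) :
    ∫⁻ z : Plane, ENNReal.ofReal (Real.exp (-(2 * b * ‖x - z‖ ^ 2))) *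
        ENNReal.ofReal (Real.exp (-(2 * b * ‖y - z‖ ^ 2)))
      = ENNReal.ofReal (Real.exp (-(b * ‖x - y‖ ^ 2))) *
        ∫⁻ z : Plane, ENNReal.ofReal (Real.exp (-(4 * b) * ‖z‖ ^ 2)) := by
  rw [← lintegral_sub_right_eq_self (μ := (volume : Measure Plane))
    (fun z => ENNReal.ofReal (Real.exp (-(4 * b) * ‖z‖ ^ 2))) ((2 : ℝ)⁻¹ • (x + y)),
    ← lintegral_const_mul' _ _ ENNReal.ofReal_ne_top]
  refine lintegral_congr fun z => ?_
  rw [← ENNReal.ofReal_mul (Real.exp_nonneg _), ← ENNReal.ofReal_mul (Real.exp_nonneg _),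
    ← Real.exp_add, ← Real.exp_add]
  congr 2
  have h := parallelogram_law_with_norm ℝ (x - z) (y - z)
  rw [show x - z + (y - z) = -((2 : ℝ) • (z - (2 : ℝ)⁻¹ • (x + y))) by module,
    show x - z - (y - z) = x - y by abel, norm_neg, norm_smul] at h
  rw [Real.norm_ofNat] at h
  linear_combination b * h

lemma lintegral_gaussian_pos (b : ℝ) :
    ∫⁻ z : Plane, ENNReal.ofReal (Real.exp (-b * ‖z‖ ^ 2)) ≠ 0 := by
  intro h
  rw [lintegral_eq_zero_iff (by fun_prop)] at h
  obtain ⟨z, hz⟩ := h.exists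
  exact absurd (ENNReal.ofReal_eq_zero.1 hz) (not_le.2 (Real.exp_pos _))

lemma lintegral_gaussian_ne_top {b : ℝ} (hb : 0 < b) :
    ∫⁻ z : Plane, ENNReal.ofReal (Real.exp (-b * ‖z‖ ^ 2)) ≠ ⊤ := by
  have h : Integrable (fun z : Plane => Real.exp (-b * ‖z‖ ^ 2)) := by
    refine Integrable.of_integral_ne_zero ?_
    rw [GaussianFourier.integral_rexp_neg_mul_sq_norm hb]
    positivity
  rw [← ofReal_integral_eq_lintegral_ofReal h (ae_of_all _ fun _ => Real.exp_nonneg _)]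
  exact ENNReal.ofReal_ne_top

lemma lintegral_gaussian_kernel (b : ℝ) (σ τ : Measure Plane)
    [IsFiniteMeasure σ] [IsFiniteMeasure τ] :
    (∫⁻ x, ∫⁻ y, ENNReal.ofReal (Real.exp (-(b * ‖x - y‖ ^ 2))) ∂τ ∂σ) *
        ∫⁻ z : Plane, ENNReal.ofReal (Real.exp (-(4 * b) * ‖z‖ ^ 2))
      = ∫⁻ z : Plane, (∫⁻ x, ENNReal.ofReal (Real.exp (-(2 * b * ‖x - z‖ ^ 2))) ∂σ) *
          ∫⁻ y, ENNReal.ofReal (Real.exp (-(2 * b * ‖y - z‖ ^ 2))) ∂τ := by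
  have m1 : Measurable fun x : Plane =>
      ∫⁻ y, ENNReal.ofReal (Real.exp (-(b * ‖x - y‖ ^ 2))) ∂τ :=
    Measurable.lintegral_prod_right' (f := fun p : Plane × Plane =>
      ENNReal.ofReal (Real.exp (-(b * ‖p.1 - p.2‖ ^ 2)))) (by fun_prop)
  rw [← lintegral_mul_const _ m1]
  have h0 : ∀ x : Plane, (∫⁻ y, ENNReal.ofReal (Real.exp (-(b * ‖x - y‖ ^ 2))) ∂τ) *
        (∫⁻ z : Plane, ENNReal.ofReal (Real.exp (-(4 * b) * ‖z‖ ^ 2)))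
      = ∫⁻ y, (∫⁻ z : Plane, ENNReal.ofReal (Real.exp (-(2 * b * ‖x - z‖ ^ 2))) *
        ENNReal.ofReal (Real.exp (-(2 * b * ‖y - z‖ ^ 2)))) ∂τ := fun x => by
    rw [← lintegral_mul_const _ (by fun_prop)]
    exact lintegral_congr fun y => (lintegral_gaussian_mul_gaussian b x y).symm
  simp_rw [h0]
  have h1 : ∀ z : Plane, (∫⁻ x, ENNReal.ofReal (Real.exp (-(2 * b * ‖x - z‖ ^ 2))) ∂σ) *
          ∫⁻ y, ENNReal.ofReal (Real.exp (-(2 * b * ‖y - z‖ ^ 2))) ∂τ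
      = ∫⁻ x, ∫⁻ y, ENNReal.ofReal (Real.exp (-(2 * b * ‖x - z‖ ^ 2))) *
          ENNReal.ofReal (Real.exp (-(2 * b * ‖y - z‖ ^ 2))) ∂τ ∂σ := fun z => by
    rw [← lintegral_mul_const _ (by fun_prop)]
    refine lintegral_congr fun x => ?_
    rw [lintegral_const_mul _ (by fun_prop)]
  simp_rw [h1]
  have m2 : Measurable (Function.uncurry fun z x : Plane =>
      ∫⁻ y, ENNReal.ofReal (Real.exp (-(2 * b * ‖x - z‖ ^ 2))) *
        ENNReal.ofReal (Real.exp (-(2 * b * ‖y - z‖ ^ 2))) ∂τ) :=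
    Measurable.lintegral_prod_right' (f := fun p : (Plane × Plane) × Plane =>
      ENNReal.ofReal (Real.exp (-(2 * b * ‖p.1.2 - p.1.1‖ ^ 2))) *
        ENNReal.ofReal (Real.exp (-(2 * b * ‖p.2 - p.1.1‖ ^ 2)))) (by fun_prop)
  refine Eq.trans (lintegral_congr fun x => ?_) (lintegral_lintegral_swap m2.aemeasurable).symm
  rw [lintegral_lintegral_swap]
  exact (show Measurable _ by unfold Function.uncurry; fun_prop).aemeasurable

lemma ENNReal.two_mul_mul_le_sq_add_sq (a b : ℝ≥0∞) : 2 * (a * b) ≤ a * a + b * b := by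
  rcases le_total a b with h | h
  · obtain ⟨c, rfl⟩ := exists_add_of_le h
    calc 2 * (a * (a + c)) = a * a + (a * a + 2 * (a * c)) := by ring
      _ ≤ a * a + (a * a + 2 * (a * c) + c * c) := add_le_add le_rfl le_self_add
      _ = _ := by ring
  · obtain ⟨c, rfl⟩ := exists_add_of_le h
    calc 2 * ((b + c) * b) = (b * b + 2 * (b * c)) + b * b := by ring
      _ ≤ (b * b + 2 * (b * c) + c * c) + b * b := add_le_add le_self_add le_rfl
      _ = _ := by ring

lemma gaussian_kernel_posDef {b : ℝ} (hb : 0 < b) (σ τ : Measure Plane)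
    [IsFiniteMeasure σ] [IsFiniteMeasure τ] :
    2 * (∫⁻ x, ∫⁻ y, ENNReal.ofReal (Real.exp (-(b * ‖x - y‖ ^ 2))) ∂τ ∂σ)
      ≤ (∫⁻ x, ∫⁻ y, ENNReal.ofReal (Real.exp (-(b * ‖x - y‖ ^ 2))) ∂σ ∂σ)
        + ∫⁻ x, ∫⁻ y, ENNReal.ofReal (Real.exp (-(b * ‖x - y‖ ^ 2))) ∂τ ∂τ := by
  have h0 := lintegral_gaussian_pos (4 * b)
  have hT := lintegral_gaussian_ne_top (b := 4 * b) (by positivity)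
  rw [← ENNReal.mul_le_mul_iff_left h0 hT, mul_assoc, add_mul, lintegral_gaussian_kernel,
    lintegral_gaussian_kernel, lintegral_gaussian_kernel]
  have m : ∀ (ρ : Measure Plane) [IsFiniteMeasure ρ], Measurable fun z : Plane =>
      ∫⁻ x, ENNReal.ofReal (Real.exp (-(2 * b * ‖x - z‖ ^ 2))) ∂ρ := fun ρ _ =>
    Measurable.lintegral_prod_right' (f := fun p : Plane × Plane =>
      ENNReal.ofReal (Real.exp (-(2 * b * ‖p.2 - p.1‖ ^ 2)))) (by fun_prop)
  have mm : ∀ (ρ κ : Measure Plane) [IsFiniteMeasure ρ] [IsFiniteMeasure κ],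
      Measurable fun z : Plane => (∫⁻ x, ENNReal.ofReal (Real.exp (-(2 * b * ‖x - z‖ ^ 2))) ∂ρ) *
        ∫⁻ x, ENNReal.ofReal (Real.exp (-(2 * b * ‖x - z‖ ^ 2))) ∂κ :=
    fun ρ κ _ _ => (m ρ).mul (m κ)
  rw [← lintegral_add_left (mm σ σ), ← lintegral_const_mul _ (mm σ τ)]
  exact lintegral_mono fun z => ENNReal.two_mul_mul_le_sq_add_sq _ _

lemma one_sub_gaussian_kernel_condNeg {t : ℝ} (ht : 0 < t) (σ τ : Measure Plane)
    [IsFiniteMeasure σ] [IsFiniteMeasure τ] (hm : σ Set.univ = τ Set.univ) :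
    (∫⁻ x, ∫⁻ y, ENNReal.ofReal ((1 - Real.exp (-(t * ‖x - y‖ ^ 2))) / t) ∂σ ∂σ)
        + (∫⁻ x, ∫⁻ y, ENNReal.ofReal ((1 - Real.exp (-(t * ‖x - y‖ ^ 2))) / t) ∂τ ∂τ)
      ≤ 2 * ∫⁻ x, ∫⁻ y, ENNReal.ofReal ((1 - Real.exp (-(t * ‖x - y‖ ^ 2))) / t) ∂τ ∂σ := by
  have key : ∀ (ρ κ : Measure Plane) [IsFiniteMeasure ρ] [IsFiniteMeasure κ],
      (∫⁻ x, ∫⁻ y, ENNReal.ofReal ((1 - Real.exp (-(t * ‖x - y‖ ^ 2))) / t) ∂κ ∂ρ)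
        + ENNReal.ofReal t⁻¹ * (∫⁻ x, ∫⁻ y, ENNReal.ofReal (Real.exp (-(t * ‖x - y‖ ^ 2))) ∂κ ∂ρ)
      = ENNReal.ofReal t⁻¹ * (κ Set.univ * ρ Set.univ) := fun ρ κ _ _ => by
    have m1 : Measurable fun x : Plane =>
        ∫⁻ y, ENNReal.ofReal (Real.exp (-(t * ‖x - y‖ ^ 2))) ∂κ :=
      Measurable.lintegral_prod_right' (f := fun p : Plane × Plane =>
        ENNReal.ofReal (Real.exp (-(t * ‖p.1 - p.2‖ ^ 2)))) (by fun_prop)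
    rw [← lintegral_const_mul _ m1, ← lintegral_add_right _ (m1.const_mul _)]
    have : ∀ x : Plane, (∫⁻ y, ENNReal.ofReal ((1 - Real.exp (-(t * ‖x - y‖ ^ 2))) / t) ∂κ)
        + ENNReal.ofReal t⁻¹ * (∫⁻ y, ENNReal.ofReal (Real.exp (-(t * ‖x - y‖ ^ 2))) ∂κ)
        = ENNReal.ofReal t⁻¹ * κ Set.univ := fun x => by
      rw [← lintegral_const_mul _ (by fun_prop), ← lintegral_add_right _ (by fun_prop),
        ← lintegral_const]
      refine lintegral_congr fun y => ?_
      rw [← ENNReal.ofReal_mul (by positivity), ← ENNReal.ofReal_add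
        (one_sub_exp_div_nonneg ht.le (by positivity)) (by positivity)]
      congr 1
      ring
    simp_rw [this]
    rw [lintegral_const, mul_assoc]
  have hP := gaussian_kernel_posDef ht σ τ
  have k1 := key σ σ
  have k2 := key τ τ
  have k3 := key σ τ
  rw [hm] at k1 k3
  set c := ENNReal.ofReal t⁻¹ with hc
  have hcT : c ≠ ⊤ := ENNReal.ofReal_ne_top
  have fin : c * (τ Set.univ * τ Set.univ) ≠ ⊤ :=
    ENNReal.mul_ne_top hcT (ENNReal.mul_ne_top (measure_ne_top _ _) (measure_ne_top _ _))
  generalize (∫⁻ x, ∫⁻ y, ENNReal.ofReal (Real.exp (-(t * ‖x - y‖ ^ 2))) ∂σ ∂σ) = e1 at *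
  generalize (∫⁻ x, ∫⁻ y, ENNReal.ofReal (Real.exp (-(t * ‖x - y‖ ^ 2))) ∂τ ∂τ) = e2 at *
  generalize (∫⁻ x, ∫⁻ y, ENNReal.ofReal (Real.exp (-(t * ‖x - y‖ ^ 2))) ∂τ ∂σ) = e3 at *
  have f1 : c * e1 ≠ ⊤ := ne_top_of_le_ne_top fin (k1 ▸ le_add_self)
  have f2 : c * e2 ≠ ⊤ := ne_top_of_le_ne_top fin (k2 ▸ le_add_self)
  refine ENNReal.le_of_add_le_add_right (a := c * e1 + c * e2) (ENNReal.add_ne_top.2 ⟨f1, f2⟩) ?_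
  calc _ = c * (τ Set.univ * τ Set.univ) + c * (τ Set.univ * τ Set.univ) := by
        nth_rewrite 1 [← k1]; rw [← k2]; ring
    _ = 2 * (∫⁻ x, ∫⁻ y, ENNReal.ofReal ((1 - Real.exp (-(t * ‖x - y‖ ^ 2))) / t) ∂τ ∂σ)
        + c * (2 * e3) := by rw [← k3]; ring
    _ ≤ _ := by rw [← mul_add]; gcongr

lemma einInt_kernel_condNeg {T : ℝ} (hT : 0 ≤ T) (σ τ : Measure Plane)
    [IsFiniteMeasure σ] [IsFiniteMeasure τ] (hm : σ Set.univ = τ Set.univ) :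
    (∫⁻ x, ∫⁻ y, ENNReal.ofReal (einInt T (‖x - y‖ ^ 2)) ∂σ ∂σ)
        + (∫⁻ x, ∫⁻ y, ENNReal.ofReal (einInt T (‖x - y‖ ^ 2)) ∂τ ∂τ)
      ≤ 2 * ∫⁻ x, ∫⁻ y, ENNReal.ofReal (einInt T (‖x - y‖ ^ 2)) ∂τ ∂σ := by
  have meas : ∀ κ : Measure Plane, ∀ [IsFiniteMeasure κ], Measurable
      (fun p : Plane × ℝ =>
        ∫⁻ y, ENNReal.ofReal ((1 - Real.exp (-(p.2 * ‖p.1 - y‖ ^ 2))) / p.2) ∂κ) := fun κ _ =>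
    Measurable.lintegral_prod_right' (f := fun p : (Plane × ℝ) × Plane =>
      ENNReal.ofReal ((1 - Real.exp (-(p.1.2 * ‖p.1.1 - p.2‖ ^ 2))) / p.1.2)) (by fun_prop)
  have swap : ∀ (ρ κ : Measure Plane) [IsFiniteMeasure ρ] [IsFiniteMeasure κ],
      (∫⁻ x, ∫⁻ y, ENNReal.ofReal (einInt T (‖x - y‖ ^ 2)) ∂κ ∂ρ) =
      ∫⁻ t in Set.Ioc 0 T,
        ∫⁻ x, ∫⁻ y, ENNReal.ofReal ((1 - Real.exp (-(t * ‖x - y‖ ^ 2))) / t) ∂κ ∂ρ := by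
    intro ρ κ _ _
    rw [lintegral_lintegral_swap
      (f := fun (t : ℝ) x => ∫⁻ y, ENNReal.ofReal ((1 - Real.exp (-(t * ‖x - y‖ ^ 2))) / t) ∂κ)
      ((meas κ).comp measurable_swap).aemeasurable]
    refine lintegral_congr fun x => ?_
    rw [lintegral_lintegral_swap
      (show Measurable _ by unfold Function.uncurry; fun_prop).aemeasurable]
    exact lintegral_congr fun y => ofReal_einInt hT (by positivity)
  have meas2 : ∀ (ρ κ : Measure Plane) [IsFiniteMeasure ρ] [IsFiniteMeasure κ],
      Measurable fun t : ℝ =>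
        ∫⁻ x, ∫⁻ y, ENNReal.ofReal ((1 - Real.exp (-(t * ‖x - y‖ ^ 2))) / t) ∂κ ∂ρ :=
    fun ρ κ _ _ => Measurable.lintegral_prod_right'
      (f := fun p : ℝ × Plane =>
        ∫⁻ y, ENNReal.ofReal ((1 - Real.exp (-(p.1 * ‖p.2 - y‖ ^ 2))) / p.1) ∂κ)
      ((meas κ).comp measurable_swap)
  rw [swap σ σ, swap τ τ, swap σ τ, ← lintegral_add_left (meas2 σ σ),
    ← lintegral_const_mul _ (meas2 σ τ)]
  exact lintegral_mono_ae ((ae_restrict_mem measurableSet_Ioc).mono fun t ht =>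
    one_sub_gaussian_kernel_condNeg ht.1 σ τ hm)

lemma sum_einInt_le {T : ℝ} (hT : 0 ≤ T) (μ : Measure Plane) [IsProbabilityMeasure μ]
    (h1 : ∀ x, Integrable (fun y => einInt T (‖x - y‖ ^ 2)) μ)
    (h2 : Integrable (fun p : Plane × Plane => einInt T (‖p.1 - p.2‖ ^ 2)) (μ.prod μ))
    {N : ℕ} (X : Fin N → Plane) :
    (∑ i, ∑ j, einInt T (‖X i - X j‖ ^ 2))
        + (N : ℝ) ^ 2 * ∫ p : Plane × Plane, einInt T (‖p.1 - p.2‖ ^ 2) ∂(μ.prod μ)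
      ≤ 2 * N * ∑ i, ∫ y, einInt T (‖X i - y‖ ^ 2) ∂μ := by
  have nn : ∀ x y : Plane, 0 ≤ einInt T (‖x - y‖ ^ 2) := fun x y => einInt_nonneg hT (by positivity)
  have e1 : ∀ x : Plane, ∫⁻ y, ENNReal.ofReal (einInt T (‖x - y‖ ^ 2)) ∂μ
      = ENNReal.ofReal (∫ y, einInt T (‖x - y‖ ^ 2) ∂μ) := fun x =>
    (ofReal_integral_eq_lintegral_ofReal (h1 x) (ae_of_all _ fun y => nn x y)).symm
  have e2 : ∫⁻ x, ∫⁻ y, ENNReal.ofReal (einInt T (‖x - y‖ ^ 2)) ∂μ ∂μ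
      = ENNReal.ofReal (∫ p : Plane × Plane, einInt T (‖p.1 - p.2‖ ^ 2) ∂(μ.prod μ)) := by
    rw [ofReal_integral_eq_lintegral_ofReal h2 (ae_of_all _ fun p => nn p.1 p.2),
      lintegral_prod _ h2.1.aemeasurable.ennreal_ofReal]
  have : IsFiniteMeasure ((N : ℝ≥0∞) • μ) := Measure.smul_finite _ (ENNReal.natCast_ne_top N)
  simp_rw [e1] at e2
  have key := einInt_kernel_condNeg hT (∑ i, Measure.dirac (X i)) ((N : ℝ≥0∞) • μ) (by simp)
  have i1 : ∀ x : Plane, 0 ≤ ∫ y, einInt T (‖x - y‖ ^ 2) ∂μ := fun x => integral_nonneg (nn x)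
  have i2 : 0 ≤ ∫ p : Plane × Plane, einInt T (‖p.1 - p.2‖ ^ 2) ∂(μ.prod μ) :=
    integral_nonneg fun p => nn p.1 p.2
  simp only [lintegral_finsetSum_measure, lintegral_dirac, lintegral_smul_measure, e1,
    smul_eq_mul] at key
  rw [lintegral_const_mul' _ _ (ENNReal.natCast_ne_top N), e2] at key
  rw [← ENNReal.ofReal_le_ofReal_iff
    (mul_nonneg (by positivity) (Finset.sum_nonneg fun i _ => i1 _)),
    ENNReal.ofReal_add (Finset.sum_nonneg fun i _ => Finset.sum_nonneg fun j _ => nn _ _)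
      (by positivity), ENNReal.ofReal_mul (by positivity), ENNReal.ofReal_mul (by positivity),
    ENNReal.ofReal_sum_of_nonneg fun i _ => Finset.sum_nonneg fun j _ => nn _ _,
    ENNReal.ofReal_sum_of_nonneg fun i _ => i1 _]
  simp_rw [ENNReal.ofReal_sum_of_nonneg fun j _ => nn (X _) (X j)]
  rw [ENNReal.ofReal_pow (by positivity), ENNReal.ofReal_mul (by positivity),
    ENNReal.ofReal_natCast]
  simp only [ENNReal.ofReal_ofNat]
  convert key using 1
  · ring
  · rw [← Finset.mul_sum]; ring

/-- The regularized logarithm `log (1 + |x|)`. -/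
def logOneAdd (x : Plane) : ℝ := Real.log (1 + ‖x‖)

/-- The nonnegative kernel `log (1 + |x|) + log (1 + |y|) - log |x - y|`. -/
def logKer (x y : Plane) : ℝ := logOneAdd x + logOneAdd y + gR2 (x - y)

lemma logOneAdd_nonneg (x : Plane) : 0 ≤ logOneAdd x :=
  Real.log_nonneg (by linarith [norm_nonneg x])

@[fun_prop]
lemma continuous_logOneAdd : Continuous logOneAdd := by
  unfold logOneAdd
  exact Continuous.log (by fun_prop) fun x => by positivity

@[fun_prop]
lemma measurable_gR2 : Measurable gR2 := by
  unfold gR2; fun_prop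

lemma measurable_logKer : Measurable fun p : Plane × Plane => logKer p.1 p.2 := by
  have := continuous_logOneAdd.measurable
  unfold logKer; fun_prop

lemma logKer_comm (x y : Plane) : logKer x y = logKer y x := by
  unfold logKer gR2; rw [norm_sub_rev]; ring

lemma logOneAdd_add_le (x y : Plane) : logOneAdd y ≤ logOneAdd x + logOneAdd (x - y) := by
  unfold logOneAdd
  rw [← Real.log_mul (by positivity) (by positivity)]
  refine Real.log_le_log (by positivity) ?_
  have : ‖y‖ ≤ ‖x‖ + ‖x - y‖ := by
    calc ‖y‖ = ‖x - (x - y)‖ := by congr 1; abel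
      _ ≤ _ := norm_sub_le _ _
  nlinarith [norm_nonneg x, norm_nonneg (x - y)]

lemma logKer_nonneg (x y : Plane) : 0 ≤ logKer x y := by
  have hx := logOneAdd_nonneg x
  have hy := logOneAdd_nonneg y
  rcases eq_or_ne x y with rfl | h
  · simp [logKer, gR2]; linarith
  · have h0 : 0 < ‖x - y‖ := norm_pos_iff.2 (sub_ne_zero.2 h)
    have : Real.log ‖x - y‖ ≤ logOneAdd x + logOneAdd y := by
      unfold logOneAdd
      rw [← Real.log_mul (by positivity) (by positivity)]
      refine Real.log_le_log h0 ?_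
      nlinarith [norm_sub_le x y, norm_nonneg x, norm_nonneg y]
    unfold logKer gR2; linarith

lemma logKer_le (x y : Plane) :
    logKer x y ≤ 2 * logOneAdd x + (Real.log 2 + |einConst| / 2)
      + expInt (‖x - y‖ ^ 2) / 2 := by
  have h1 := logOneAdd_add_le x y
  have h2 : logOneAdd (x - y) + gR2 (x - y)
      ≤ Real.log 2 + |einConst| / 2 + expInt (‖x - y‖ ^ 2) / 2 := by
    have he : 0 ≤ expInt (‖x - y‖ ^ 2) := expInt_nonneg (by positivity)
    rcases le_total 1 ‖x - y‖ with h | h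
    · have : logOneAdd (x - y) ≤ Real.log 2 + Real.log ‖x - y‖ := by
        unfold logOneAdd
        rw [← Real.log_mul (by norm_num) (by positivity)]
        exact Real.log_le_log (by positivity) (by linarith)
      have := abs_nonneg einConst
      unfold gR2; linarith
    · have : logOneAdd (x - y) ≤ Real.log 2 :=
        Real.log_le_log (by positivity) (by linarith)
      linarith [gR2_le (x - y)]
  unfold logKer; linarith

lemma lintegral_expInt_sub_le {T : ℝ} (hT : 0 < T) {M : ℝ} {μ : Measure Plane}
    (hμ : μ ≤ ENNReal.ofReal M • (volume : Measure Plane)) (x : Plane) :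
    ∫⁻ y, ENNReal.ofReal (expInt (T * ‖x - y‖ ^ 2)) ∂μ
      ≤ ENNReal.ofReal M * ENNReal.ofReal (Real.pi / T) := by
  calc _ ≤ ∫⁻ y, ENNReal.ofReal (expInt (T * ‖x - y‖ ^ 2)) ∂(ENNReal.ofReal M • volume) :=
        lintegral_mono' hμ le_rfl
    _ = ENNReal.ofReal M * ∫⁻ y, ENNReal.ofReal (expInt (T * ‖x - y‖ ^ 2)) := by
        rw [lintegral_smul_measure, smul_eq_mul]
    _ ≤ _ := by
        gcongr
        rw [lintegral_sub_left_eq_self (μ := (volume : Measure Plane))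
          (fun z => ENNReal.ofReal (expInt (T * ‖z‖ ^ 2))) x]
        exact lintegral_expInt_norm_le hT

lemma integrable_expInt_sub {T : ℝ} (hT : 0 < T) {M : ℝ} {μ : Measure Plane}
    (hμ : μ ≤ ENNReal.ofReal M • (volume : Measure Plane)) (x : Plane) :
    Integrable (fun y => expInt (T * ‖x - y‖ ^ 2)) μ := by
  have hm := measurable_expInt
  refine ⟨(show Measurable _ by fun_prop).aestronglyMeasurable, ?_⟩
  rw [hasFiniteIntegral_iff_ofReal (ae_of_all _ fun y => expInt_nonneg (by positivity))]
  exact (lintegral_expInt_sub_le hT hμ x).trans_lt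
    (ENNReal.mul_lt_top ENNReal.ofReal_lt_top ENNReal.ofReal_lt_top)

lemma integrable_expInt_prod {T : ℝ} (hT : 0 < T) {M : ℝ} {ν μ : Measure Plane}
    [IsFiniteMeasure ν] [IsFiniteMeasure μ]
    (hμ : μ ≤ ENNReal.ofReal M • (volume : Measure Plane)) :
    Integrable (fun p : Plane × Plane => expInt (T * ‖p.1 - p.2‖ ^ 2)) (ν.prod μ) := by
  have hm := measurable_expInt
  have hm' : Measurable fun p : Plane × Plane => expInt (T * ‖p.1 - p.2‖ ^ 2) := by fun_prop
  refine ⟨hm'.aestronglyMeasurable, ?_⟩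
  rw [hasFiniteIntegral_iff_ofReal (ae_of_all _ fun y => expInt_nonneg (by positivity)),
    lintegral_prod _ hm'.aemeasurable.ennreal_ofReal]
  refine (lintegral_mono fun x => lintegral_expInt_sub_le hT hμ x).trans_lt ?_
  rw [lintegral_const]
  exact ENNReal.mul_lt_top (ENNReal.mul_lt_top ENNReal.ofReal_lt_top ENNReal.ofReal_lt_top)
    (measure_lt_top _ _)

lemma integrable_logKer_right {M : ℝ} {μ : Measure Plane} [IsFiniteMeasure μ]
    (hμ : μ ≤ ENNReal.ofReal M • (volume : Measure Plane)) (x : Plane) :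
    Integrable (fun y => logKer x y) μ := by
  have h := integrable_expInt_sub one_pos hμ x
  simp only [one_mul] at h
  refine Integrable.mono' ((integrable_const (2 * logOneAdd x + (Real.log 2 + |einConst| / 2))).add
    (h.div_const 2)) (measurable_logKer.comp (measurable_prodMk_left)).aestronglyMeasurable ?_
  refine ae_of_all _ fun y => ?_
  rw [Real.norm_of_nonneg (logKer_nonneg x y)]
  exact logKer_le x y

lemma integrable_logKer_prod {M : ℝ} {ν μ : Measure Plane} [IsFiniteMeasure ν]
    [IsFiniteMeasure μ] (hμ : μ ≤ ENNReal.ofReal M • (volume : Measure Plane))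
    (hν : Integrable logOneAdd ν) :
    Integrable (fun p : Plane × Plane => logKer p.1 p.2) (ν.prod μ) := by
  have h := integrable_expInt_prod one_pos hμ (ν := ν)
  simp only [one_mul] at h
  have h2 : Integrable (fun p : Plane × Plane => logOneAdd p.1) (ν.prod μ) := hν.comp_fst μ
  refine Integrable.mono' (((h2.const_mul 2).add (integrable_const
    (Real.log 2 + |einConst| / 2))).add (h.div_const 2)) measurable_logKer.aestronglyMeasurable ?_
  refine ae_of_all _ fun y => ?_
  rw [Real.norm_of_nonneg (logKer_nonneg _ _)]
  exact logKer_le _ _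

/-- The pair energy `g(x - y) + V(x)/2 + V(y)/2`. -/
def pairEnergy (V : Plane → ℝ) (p : Plane × Plane) : ℝ :=
  gR2 (p.1 - p.2) + (V p.1 / 2 + V p.2 / 2)

lemma pairEnergy_eq (V : Plane → ℝ) (p : Plane × Plane) :
    pairEnergy V p = logKer p.1 p.2 + (V p.1 / 2 - logOneAdd p.1)
      + (V p.2 / 2 - logOneAdd p.2) := by
  unfold pairEnergy logKer; ring

lemma pairEnergy_swap (V : Plane → ℝ) (p : Plane × Plane) :
    pairEnergy V p.swap = pairEnergy V p := by
  rw [pairEnergy_eq, pairEnergy_eq, Prod.fst_swap, Prod.snd_swap, logKer_comm]; ring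

lemma measurable_pairEnergy {V : Plane → ℝ} (hV : Continuous V) :
    Measurable (pairEnergy V) := by
  have := hV.measurable
  unfold pairEnergy; fun_prop

lemma IVE2_eq_sub (V : Plane → ℝ) (μ : Measure Plane) :
    IVE2 V μ
      = ((∫⁻ p, (if p.1 = p.2 then ⊤ else ENNReal.ofReal (pairEnergy V p)) ∂(μ.prod μ) : ℝ≥0∞)
          : EReal)
        - ((∫⁻ p, (if p.1 = p.2 then 0 else ENNReal.ofReal (-pairEnergy V p)) ∂(μ.prod μ) : ℝ≥0∞)
          : EReal) := by
  unfold IVE2 eIntE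
  have h1 : ∀ p : Plane × Plane, p.1 = p.2 →
      gE2 (p.1 - p.2) + ((V p.1 / 2 + V p.2 / 2 : ℝ) : EReal) = ⊤ := fun p h => by
    rw [gE2, if_pos (sub_eq_zero.2 h), EReal.top_add_coe]
  have h2 : ∀ p : Plane × Plane, p.1 ≠ p.2 →
      gE2 (p.1 - p.2) + ((V p.1 / 2 + V p.2 / 2 : ℝ) : EReal) = (pairEnergy V p : ℝ) :=
    fun p h => by
      rw [gE2, if_neg (sub_ne_zero.2 h), pairEnergy, EReal.coe_add (gR2 _)]
  congr 3
  · funext p; dsimp only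
    by_cases h : p.1 = p.2
    · rw [if_pos (h1 p h), if_pos h]
    · rw [if_neg (by rw [h2 p h]; exact EReal.coe_ne_top _), if_neg h, h2 p h, EReal.toReal_coe]
  · funext p; dsimp only
    by_cases h : p.1 = p.2
    · rw [if_neg (by rw [h1 p h]; simp), if_pos h, h1 p h]; simp
    · rw [if_neg (by rw [h2 p h]; exact EReal.coe_ne_bot _), if_neg h, h2 p h, ← EReal.coe_neg,
        EReal.toReal_coe]

lemma ae_prod_ne (μ : Measure Plane) [SFinite μ] [NullSingletonClass μ] :
    ∀ᵐ p ∂(μ.prod μ), p.1 ≠ p.2 := by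
  rw [Measure.ae_prod_iff_ae_ae]
  · exact ae_of_all _ fun x => by
      simp only [ae_iff, not_not, ne_eq]
      simp
  · exact (measurableSet_eq_fun measurable_fst measurable_snd).compl

lemma IVE2_eq_sub_of_nullSingletonClass (V : Plane → ℝ) (μ : Measure Plane) [SFinite μ]
    [NullSingletonClass μ] :
    IVE2 V μ = ((∫⁻ p, ENNReal.ofReal (pairEnergy V p) ∂(μ.prod μ) : ℝ≥0∞) : EReal)
        - ((∫⁻ p, ENNReal.ofReal (-pairEnergy V p) ∂(μ.prod μ) : ℝ≥0∞) : EReal) := by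
  rw [IVE2_eq_sub]
  rw [lintegral_congr_ae ((ae_prod_ne μ).mono fun p hp => if_neg hp),
    lintegral_congr_ae ((ae_prod_ne μ).mono fun p hp => if_neg hp)]

lemma IVE2_eq_integral {V : Plane → ℝ} {μ : Measure Plane} [SFinite μ] [NullSingletonClass μ]
    (h : Integrable (pairEnergy V) (μ.prod μ)) :
    IVE2 V μ = ((∫ p, pairEnergy V p ∂(μ.prod μ) : ℝ) : EReal) := by
  rw [IVE2_eq_sub_of_nullSingletonClass, integral_eq_lintegral_pos_part_sub_lintegral_neg_part h,
    EReal.coe_sub, EReal.coe_ennreal_toReal, EReal.coe_ennreal_toReal]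
  · exact (h.neg.lintegral_lt_top).ne
  · exact h.lintegral_lt_top.ne

lemma integrable_pairEnergy_of_IVE2_lt_top {V : Plane → ℝ} (hV : Continuous V) {K : ℝ}
    (hK : ∀ p, -K ≤ pairEnergy V p) {μ : Measure Plane} [IsFiniteMeasure μ] [NullSingletonClass μ]
    (h : IVE2 V μ < ⊤) : Integrable (pairEnergy V) (μ.prod μ) := by
  rw [IVE2_eq_sub_of_nullSingletonClass] at h
  have h2 : ∫⁻ p, ENNReal.ofReal (-pairEnergy V p) ∂(μ.prod μ) < ⊤ := by
    refine (lintegral_mono (g := fun _ => ENNReal.ofReal K) fun p =>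
      ENNReal.ofReal_le_ofReal (by linarith [hK p])).trans_lt ?_
    rw [lintegral_const]
    exact ENNReal.mul_lt_top ENNReal.ofReal_lt_top (measure_lt_top _ _)
  have h1 : ∫⁻ p, ENNReal.ofReal (pairEnergy V p) ∂(μ.prod μ) < ⊤ := by
    by_contra hc
    rw [not_lt_top_iff.1 hc] at h
    lift (∫⁻ p, ENNReal.ofReal (-pairEnergy V p) ∂(μ.prod μ)) to NNReal using h2.ne with b
    exact absurd h (by simp [EReal.coe_ennreal_top])
  have i1 : Integrable (fun p => max (pairEnergy V p) 0) (μ.prod μ) := by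
    refine ⟨((measurable_pairEnergy hV).max measurable_const).aestronglyMeasurable, ?_⟩
    rw [hasFiniteIntegral_iff_ofReal (ae_of_all _ fun p => le_max_right (pairEnergy V p) 0)]
    simpa [ENNReal.ofReal_max] using h1
  refine Integrable.mono' (i1.add (integrable_const |K|))
    (measurable_pairEnergy hV).aestronglyMeasurable (ae_of_all _ fun p => ?_)
  have := hK p
  rw [Real.norm_eq_abs, abs_le]
  simp only [Pi.add_apply]
  constructor
  · linarith [le_abs_self K, le_max_right (pairEnergy V p) 0]
  · linarith [abs_nonneg K, le_max_left (pairEnergy V p) 0]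

lemma IVE2_eq_bot {V : Plane → ℝ} {ν : Measure Plane}
    {x : ℕ → Plane} {y : Plane} (hne : ∀ k, x k ≠ y) (c : ℕ → ℝ) (hc : ∀ k, 0 < c k)
    (hx : ∀ k, ENNReal.ofReal (c k) ≤ ν {x k} * ν {y}) [SFinite ν]
    (hE : ∀ k : ℕ, pairEnergy V (x k, y) ≤ -(k / c k)) : IVE2 V ν = ⊥ := by
  rw [IVE2_eq_sub]
  have : ∫⁻ p, (if p.1 = p.2 then 0 else ENNReal.ofReal (-pairEnergy V p)) ∂(ν.prod ν) = ⊤ := by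
    refine ENNReal.eq_top_of_forall_nnreal_le fun r => ?_
    obtain ⟨k, hk⟩ := exists_nat_ge (r : ℝ)
    have h1 : (ν.prod ν) {(x k, y)} = ν {x k} * ν {y} := by
      rw [← Set.singleton_prod_singleton, Measure.prod_prod]
    calc (r : ℝ≥0∞) ≤ ENNReal.ofReal (k / c k) * ENNReal.ofReal (c k) := by
          rw [← ENNReal.ofReal_mul (div_nonneg (by positivity) (hc k).le),
            div_mul_cancel₀ _ (hc k).ne', ← ENNReal.ofReal_coe_nnreal]
          exact ENNReal.ofReal_le_ofReal hk
      _ ≤ ENNReal.ofReal (-pairEnergy V (x k, y)) * (ν {x k} * ν {y}) := by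
          gcongr
          · linarith [hE k]
          · exact hx k
      _ = ∫⁻ p in {(x k, y)}, (if p.1 = p.2 then 0 else ENNReal.ofReal (-pairEnergy V p))
            ∂(ν.prod ν) := by
          rw [lintegral_singleton, h1, if_neg (hne k)]
      _ ≤ _ := setLIntegral_le_lintegral _ _
  rw [this, EReal.coe_ennreal_top, EReal.sub_top]

lemma exists_potential_lower_bound {V : Plane → ℝ} (hV : Continuous V)
    {μ : Measure Plane} [IsProbabilityMeasure μ] [NullSingletonClass μ]
    (hmin : ∀ ν : Measure Plane, IsProbabilityMeasure ν → IVE2 V μ ≤ IVE2 V ν)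
    (huniq : ∀ ν : Measure Plane, IsProbabilityMeasure ν → IVE2 V ν = IVE2 V μ → ν = μ) :
    ∃ C : ℝ, ∀ x, -C ≤ V x / 2 - logOneAdd x := by
  by_contra! hcon
  have hWc : Continuous fun x => V x / 2 - logOneAdd x := by fun_prop
  obtain ⟨B, hB⟩ := (isCompact_closedBall (0 : Plane) 1).exists_bound_of_continuousOn
    hWc.continuousOn
  have hB0 := hB 0 (by simp)
  have hBnn : 0 ≤ B := (norm_nonneg _).trans hB0
  choose x hx using fun k : ℕ => hcon (k * 2 ^ (k + 3) + 1 + B)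
  have hx1 : ∀ k, 1 < ‖x k‖ := fun k => by
    by_contra! h
    have h1 := hB (x k) (by simpa using h)
    rw [Real.norm_eq_abs, abs_le] at h1
    have : (0 : ℝ) ≤ k * 2 ^ (k + 3) := by positivity
    linarith [hx k, h1.1]
  set ν : Measure Plane := (2 : ℝ≥0∞)⁻¹ • Measure.dirac 0 +
    Measure.sum fun k : ℕ => ((2 : ℝ≥0∞)⁻¹) ^ (k + 2) • Measure.dirac (x k) with hν
  have h0 : (2 : ℝ≥0∞)⁻¹ ≤ ν {0} := by
    rw [hν, Measure.add_apply, Measure.smul_apply, Measure.dirac_apply_of_mem (by simp)]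
    simp
  have hk : ∀ k, ((2 : ℝ≥0∞)⁻¹) ^ (k + 2) ≤ ν {x k} := fun k => by
    rw [hν, Measure.add_apply, Measure.sum_apply _ (measurableSet_singleton _)]
    refine le_trans ?_ (le_add_self.trans' (ENNReal.le_tsum k))
    rw [Measure.smul_apply, Measure.dirac_apply_of_mem (by simp)]
    simp
  have hprob : IsProbabilityMeasure ν := ⟨by
    rw [hν, Measure.add_apply, Measure.sum_apply _ MeasurableSet.univ]
    simp only [Measure.smul_apply, measure_univ, smul_eq_mul, mul_one, pow_add]
    rw [ENNReal.tsum_mul_right, ENNReal.tsum_geometric, ENNReal.one_sub_inv_two, inv_inv, pow_two,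
      ← mul_assoc, ENNReal.mul_inv_cancel (by simp) (by simp), one_mul,
      ENNReal.inv_two_add_inv_two]⟩
  have hbot : IVE2 V ν = ⊥ := by
    refine IVE2_eq_bot (x := x) (y := 0) (fun k h => ?_) (fun k => (2⁻¹) ^ (k + 3))
      (fun k => by positivity) (fun k => ?_) fun k => ?_
    · have := hx1 k
      rw [h, norm_zero] at this
      linarith
    · calc _ = ((2 : ℝ≥0∞)⁻¹) ^ (k + 2) * 2⁻¹ := by
            rw [ENNReal.ofReal_pow (by positivity), ENNReal.ofReal_inv_of_pos (by norm_num),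
              ← pow_succ]
            simp
        _ ≤ _ := mul_le_mul' (hk k) h0
    · rw [pairEnergy_eq]
      have h2 : logKer (x k) 0 ≤ 1 := by
        have h3 : logOneAdd (x k) ≤ Real.log 2 + Real.log ‖x k‖ := by
          unfold logOneAdd
          have := hx1 k
          rw [← Real.log_mul (by norm_num) (by positivity)]
          exact Real.log_le_log (by positivity) (by linarith)
        have h4 : Real.log 2 ≤ 1 := by linarith [Real.log_two_lt_d9]
        have h5 : logOneAdd 0 = 0 := by simp [logOneAdd]
        unfold logKer gR2
        rw [h5, sub_zero]; linarith
      have h6 := (abs_le.1 ((Real.norm_eq_abs _).symm.trans_le hB0)).2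
      have h7 := hx k
      have h8 : (k : ℝ) / (2⁻¹) ^ (k + 3) = k * 2 ^ (k + 3) := by
        rw [inv_pow, div_inv_eq_mul]
      dsimp only
      rw [h8]
      linarith
  have heq : IVE2 V ν = IVE2 V μ := by
    rw [hbot]
    exact (le_bot_iff.1 (hbot ▸ hmin ν hprob)).symm
  have := huniq ν hprob heq
  rw [this, measure_singleton] at h0
  simp at h0

lemma exists_uniform_measure {V : Plane → ℝ} (hV : Continuous V) {A : Set Plane}
    (hA0 : volume A ≠ 0)
    {R : ℝ} (hAR : A ⊆ Metric.closedBall 0 R) :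
    ∃ (ν : Measure Plane) (M : ℝ), IsProbabilityMeasure ν ∧
      ν ≤ ENNReal.ofReal M • (volume : Measure Plane) ∧ ν ≪ volume.restrict A ∧
      Integrable logOneAdd ν ∧ Integrable (fun x => V x / 2 - logOneAdd x) ν := by
  have hAT : volume A ≠ ⊤ := ((measure_mono hAR).trans_lt measure_closedBall_lt_top).ne
  have hc : (volume A)⁻¹ ≠ ⊤ := ENNReal.inv_ne_top.2 hA0
  have key : ∀ f : Plane → ℝ, Continuous f → Integrable f ((volume A)⁻¹ • volume.restrict A) :=
    fun f hf => Integrable.smul_measure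
      ((hf.continuousOn.integrableOn_compact (isCompact_closedBall 0 R)).mono_set hAR) hc
  refine ⟨(volume A)⁻¹ • volume.restrict A, ((volume A)⁻¹).toReal, ⟨?_⟩, ?_, ?_, ?_, ?_⟩
  · rw [Measure.smul_apply, Measure.restrict_apply_univ, smul_eq_mul,
      ENNReal.inv_mul_cancel hA0 hAT]
  · rw [ENNReal.ofReal_toReal hc]
    exact Measure.le_iff.2 fun s _ => by
      simp only [Measure.smul_apply, smul_eq_mul]
      gcongr
      exact Measure.restrict_le_self
  · exact Measure.smul_absolutelyContinuous
  · exact key _ (by fun_prop)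
  · exact key _ (by fun_prop)

lemma integrable_pairEnergy_prod {V : Plane → ℝ} {M : ℝ} {ν μ : Measure Plane}
    [IsFiniteMeasure ν] [IsFiniteMeasure μ] (hμ : μ ≤ ENNReal.ofReal M • (volume : Measure Plane))
    (hν : Integrable logOneAdd ν) (hWν : Integrable (fun x => V x / 2 - logOneAdd x) ν)
    (hWμ : Integrable (fun x => V x / 2 - logOneAdd x) μ) :
    Integrable (pairEnergy V) (ν.prod μ) := by
  have := ((integrable_logKer_prod hμ hν).add (hWν.comp_fst μ)).add (hWμ.comp_snd ν)
  exact this.congr (ae_of_all _ fun p => (pairEnergy_eq V p).symm)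

lemma nullSingletonClass_of_le {M : ℝ} {μ : Measure Plane}
    (hμ : μ ≤ ENNReal.ofReal M • (volume : Measure Plane)) : NullSingletonClass μ :=
  ⟨fun x => le_antisymm ((hμ {x}).trans (by simp)) (zero_le)⟩

lemma absolutelyContinuous_of_le {M : ℝ} {μ : Measure Plane}
    (hμ : μ ≤ ENNReal.ofReal M • (volume : Measure Plane)) : μ ≪ volume :=
  (Measure.absolutelyContinuous_of_le hμ).trans Measure.smul_absolutelyContinuous

lemma integrable_pairEnergy_self {V : Plane → ℝ} (hV : Continuous V)
    {μ : Measure Plane} [IsProbabilityMeasure μ] [NullSingletonClass μ]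
    (hmin : ∀ ν : Measure Plane, IsProbabilityMeasure ν → IVE2 V μ ≤ IVE2 V ν)
    {C : ℝ} (hC : ∀ x, -C ≤ V x / 2 - logOneAdd x) :
    Integrable (pairEnergy V) (μ.prod μ) := by
  obtain ⟨ν, M, hν, hνM, -, h1, h2⟩ := exists_uniform_measure hV
    (A := Metric.closedBall 0 1) (Metric.measure_closedBall_pos volume _ one_pos).ne' le_rfl
  have := nullSingletonClass_of_le hνM
  refine integrable_pairEnergy_of_IVE2_lt_top hV (K := 2 * C) (fun p => ?_) ?_
  · rw [pairEnergy_eq]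
    linarith [logKer_nonneg p.1 p.2, hC p.1, hC p.2]
  · refine (hmin ν hν).trans_lt ?_
    rw [IVE2_eq_integral (integrable_pairEnergy_prod hνM h1 h2 h2)]
    exact EReal.coe_lt_top _

lemma integrable_potential {V : Plane → ℝ} (hV : Continuous V)
    {μ : Measure Plane} [IsProbabilityMeasure μ]
    {C : ℝ} (hC : ∀ x, -C ≤ V x / 2 - logOneAdd x)
    (h : Integrable (pairEnergy V) (μ.prod μ)) :
    Integrable (fun x => V x / 2 - logOneAdd x) μ := by
  obtain ⟨y, hy⟩ := h.prod_left_ae.exists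
  have hW : Continuous fun x => V x / 2 - logOneAdd x := by fun_prop
  refine Integrable.mono' (hy.norm.add (integrable_const (2 * |C| + |V y / 2 - logOneAdd y|)))
    hW.aestronglyMeasurable (ae_of_all _ fun x => ?_)
  have h1 := pairEnergy_eq V (x, y)
  have h2 := logKer_nonneg x y
  have h3 := hC x
  dsimp only [Pi.add_apply] at *
  have h4 := le_abs_self (pairEnergy V (x, y))
  have h5 := neg_abs_le (V y / 2 - logOneAdd y)
  have h6 := le_abs_self C
  have h9 := abs_nonneg C
  have h7 := abs_nonneg (pairEnergy V (x, y))
  have h8 := abs_nonneg (V y / 2 - logOneAdd y)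
  rw [Real.norm_eq_abs, Real.norm_eq_abs, abs_le]
  constructor <;> linarith

lemma le_of_forall_quadratic {a b c : ℝ}
    (h : ∀ t ∈ Set.Ioo (0 : ℝ) 1, a ≤ (1 - t) ^ 2 * a + 2 * (t * (1 - t)) * b + t ^ 2 * c) :
    a ≤ b := by
  by_contra! hlt
  set e := |a - 2 * b + c| with he
  have he0 : 0 ≤ e := abs_nonneg _
  have hd : 0 < a - b := sub_pos.2 hlt
  set t := min (1 / 2) ((a - b) / (1 + e)) with ht
  have ht0 : 0 < t := lt_min (by norm_num) (by positivity)
  have ht1 : t < 1 := (min_le_left _ _).trans_lt (by norm_num)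
  have h1 := h t ⟨ht0, ht1⟩
  have h2 : t * (1 + e) ≤ a - b := (le_div_iff₀ (by positivity)).1 (min_le_right _ _)
  have h3 : a - 2 * b + c ≤ e := le_abs_self _
  have h4 : 0 ≤ t * (2 * (b - a) + t * (a - 2 * b + c)) := by linarith
  have h5 := nonneg_of_mul_nonneg_right h4 ht0
  nlinarith

lemma pairEnergy_minimizer_le {V : Plane → ℝ} {μ ν : Measure Plane}
    [IsProbabilityMeasure μ] [IsProbabilityMeasure ν] [NullSingletonClass μ]
    [NullSingletonClass ν]
    (hmin : ∀ ν : Measure Plane, IsProbabilityMeasure ν → IVE2 V μ ≤ IVE2 V ν)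
    (hμμ : Integrable (pairEnergy V) (μ.prod μ)) (hνμ : Integrable (pairEnergy V) (ν.prod μ))
    (hνν : Integrable (pairEnergy V) (ν.prod ν)) :
    ∫ p, pairEnergy V p ∂(μ.prod μ) ≤ ∫ p, pairEnergy V p ∂(ν.prod μ) := by
  have hs : pairEnergy V ∘ Prod.swap = pairEnergy V := funext fun p => pairEnergy_swap V p
  have hμν : Integrable (pairEnergy V) (μ.prod ν) := by
    rw [← hs]; exact hνμ.swap
  have hsym : ∫ p, pairEnergy V p ∂(μ.prod ν) = ∫ p, pairEnergy V p ∂(ν.prod μ) := by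
    rw [← integral_prod_swap]
    exact integral_congr_ae (ae_of_all _ fun p => pairEnergy_swap V p)
  refine le_of_forall_quadratic (c := ∫ p, pairEnergy V p ∂(ν.prod ν)) fun t ht => ?_
  have hs0 : 0 ≤ 1 - t := by linarith [ht.2]
  have ht0 : 0 ≤ t := ht.1.le
  set κ : Measure Plane := ENNReal.ofReal (1 - t) • μ + ENNReal.ofReal t • ν with hκ
  have hκp : IsProbabilityMeasure κ := ⟨by
    simp only [hκ, Measure.add_apply, Measure.smul_apply, measure_univ, smul_eq_mul, mul_one]
    rw [← ENNReal.ofReal_add hs0 ht0]; simp⟩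
  have hκn : NullSingletonClass κ := ⟨fun x => by simp [hκ]⟩
  have i1 := ((hμμ.smul_measure (c := ENNReal.ofReal (1 - t)) ENNReal.ofReal_ne_top).smul_measure
    (c := ENNReal.ofReal (1 - t)) ENNReal.ofReal_ne_top)
  have i2 := ((hμν.smul_measure (c := ENNReal.ofReal t) ENNReal.ofReal_ne_top).smul_measure
    (c := ENNReal.ofReal (1 - t)) ENNReal.ofReal_ne_top)
  have i3 := ((hνμ.smul_measure (c := ENNReal.ofReal (1 - t)) ENNReal.ofReal_ne_top).smul_measure
    (c := ENNReal.ofReal t) ENNReal.ofReal_ne_top)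
  have i4 := ((hνν.smul_measure (c := ENNReal.ofReal t) ENNReal.ofReal_ne_top).smul_measure
    (c := ENNReal.ofReal t) ENNReal.ofReal_ne_top)
  have hprod : κ.prod κ =
      (ENNReal.ofReal (1 - t) • ENNReal.ofReal (1 - t) • μ.prod μ
        + ENNReal.ofReal (1 - t) • ENNReal.ofReal t • μ.prod ν)
      + (ENNReal.ofReal t • ENNReal.ofReal (1 - t) • ν.prod μ
        + ENNReal.ofReal t • ENNReal.ofReal t • ν.prod ν) := by
    rw [hκ, Measure.add_prod, Measure.prod_add, Measure.prod_add]
    simp only [Measure.prod_smul_left, Measure.prod_smul_right]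
    rw [smul_comm (ENNReal.ofReal t) (ENNReal.ofReal (1 - t)) (μ.prod ν),
      smul_comm (ENNReal.ofReal (1 - t)) (ENNReal.ofReal t) (ν.prod μ)]
  have hker : Integrable (pairEnergy V) (κ.prod κ) := by
    rw [hprod]
    exact (i1.add_measure i2).add_measure (i3.add_measure i4)
  have h := hmin κ hκp
  rw [IVE2_eq_integral hμμ, IVE2_eq_integral hker, EReal.coe_le_coe_iff, hprod,
    integral_add_measure (i1.add_measure i2) (i3.add_measure i4), integral_add_measure i1 i2,
    integral_add_measure i3 i4] at h
  simp only [integral_smul_measure, ENNReal.toReal_ofReal hs0, ENNReal.toReal_ofReal ht0,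
    smul_eq_mul, hsym] at h
  linarith

lemma le_integral_pairEnergy_ae {V : Plane → ℝ} (hV : Continuous V)
    {μ : Measure Plane} [IsProbabilityMeasure μ] {M : ℝ}
    (hμ : μ ≤ ENNReal.ofReal M • (volume : Measure Plane))
    (hmin : ∀ ν : Measure Plane, IsProbabilityMeasure ν → IVE2 V μ ≤ IVE2 V ν)
    (hμμ : Integrable (pairEnergy V) (μ.prod μ))
    (hW : Integrable (fun x => V x / 2 - logOneAdd x) μ) :
    ∀ᵐ x : Plane, ∫ p, pairEnergy V p ∂(μ.prod μ) ≤ ∫ y, pairEnergy V (x, y) ∂μ := by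
  have hnull := nullSingletonClass_of_le hμ
  set I := ∫ p, pairEnergy V p ∂(μ.prod μ) with hI
  set F : Plane → ℝ := fun x => ∫ y, pairEnergy V (x, y) ∂μ with hF
  have hFm : Measurable F :=
    ((measurable_pairEnergy hV).stronglyMeasurable.integral_prod_right').measurable
  have key : ∀ n : ℕ, volume ({x | F x < I} ∩ Metric.closedBall 0 (n : ℝ)) = 0 := fun n => by
    by_contra hA
    obtain ⟨ν, M', hν, hνM, hac, h1, h2⟩ := exists_uniform_measure hV hA Set.inter_subset_right
    have := nullSingletonClass_of_le hνM
    have i1 := integrable_pairEnergy_prod hμ h1 h2 hW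
    have hle := pairEnergy_minimizer_le hmin hμμ i1 (integrable_pairEnergy_prod hνM h1 h2 h2)
    rw [integral_prod _ i1] at hle
    have hlt : ∀ᵐ x ∂ν, F x < I := hac.ae_le <|
      (ae_restrict_mem ((measurableSet_lt hFm measurable_const).inter
        Metric.isClosed_closedBall.measurableSet)).mono fun x hx => hx.1
    have hz : ∫ x, (I - F x) ∂ν = 0 := by
      refine le_antisymm ?_ (integral_nonneg_of_ae (hlt.mono fun x hx => sub_nonneg.2 hx.le))
      rw [integral_sub (integrable_const _) i1.integral_prod_left]
      simpa using hle
    rw [integral_eq_zero_iff_of_nonneg_ae (hlt.mono fun x hx => sub_nonneg.2 hx.le)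
      ((integrable_const _).sub i1.integral_prod_left)] at hz
    obtain ⟨x, hx, hx'⟩ := (hlt.and hz).exists
    simp only [Pi.zero_apply] at hx'
    linarith
  rw [ae_iff]
  have : {x | ¬ I ≤ F x} = ⋃ n : ℕ, ({x | F x < I} ∩ Metric.closedBall 0 (n : ℝ)) := by
    rw [← Set.inter_iUnion, Metric.iUnion_closedBall_nat, Set.inter_univ]
    ext x; simp
  rw [this]
  exact measure_iUnion_null key

lemma integral_pairEnergy_ae_eq {V : Plane → ℝ}
    {μ : Measure Plane} [IsProbabilityMeasure μ] {M : ℝ}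
    (hμ : μ ≤ ENNReal.ofReal M • (volume : Measure Plane))
    (hμμ : Integrable (pairEnergy V) (μ.prod μ))
    (h : ∀ᵐ x : Plane, ∫ p, pairEnergy V p ∂(μ.prod μ) ≤ ∫ y, pairEnergy V (x, y) ∂μ) :
    ∀ᵐ x ∂μ, ∫ y, pairEnergy V (x, y) ∂μ = ∫ p, pairEnergy V p ∂(μ.prod μ) := by
  have h' : ∀ᵐ x ∂μ, ∫ p, pairEnergy V p ∂(μ.prod μ) ≤ ∫ y, pairEnergy V (x, y) ∂μ :=
    (absolutelyContinuous_of_le hμ).ae_le h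
  have hz : ∫ x, ((∫ y, pairEnergy V (x, y) ∂μ) - ∫ p, pairEnergy V p ∂(μ.prod μ)) ∂μ = 0 := by
    rw [integral_sub hμμ.integral_prod_left (integrable_const _), ← integral_prod _ hμμ]
    simp
  rw [integral_eq_zero_iff_of_nonneg_ae (h'.mono fun x hx => sub_nonneg.2 hx)
    (hμμ.integral_prod_left.sub (integrable_const _))] at hz
  exact hz.mono fun x hx => sub_eq_zero.1 hx

lemma logOneAdd_sub_le_logKer {x y : Plane} (h : ‖y‖ < ‖x‖) :
    logOneAdd y - Real.log 2 ≤ logKer x y := by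
  have h0 : 0 < ‖x - y‖ := norm_pos_iff.2 fun h' => by
    rw [sub_eq_zero.1 h'] at h; exact lt_irrefl _ h
  have : Real.log ‖x - y‖ ≤ Real.log 2 + logOneAdd x := by
    unfold logOneAdd
    rw [← Real.log_mul (by norm_num) (by positivity)]
    exact Real.log_le_log h0 (by linarith [norm_sub_le x y, norm_nonneg x])
  unfold logKer gR2; linarith

lemma integrable_logOneAdd_of_bound {μ : Measure Plane} [IsProbabilityMeasure μ] {K : ℝ}
    (hker : ∀ x, Integrable (fun y => logKer x y) μ)
    (hK : ∀ᵐ x ∂μ, ∫ y, logKer x y ∂μ ≤ K) : Integrable logOneAdd μ := by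
  have hon : ∀ n : ℕ, IntegrableOn logOneAdd (Metric.closedBall 0 (n : ℝ)) μ := fun n =>
    continuous_logOneAdd.continuousOn.integrableOn_compact (isCompact_closedBall _ _)
  by_cases hR : ∃ R : ℕ, μ (Metric.closedBall 0 (R : ℝ))ᶜ = 0
  · obtain ⟨R, hR⟩ := hR
    have h := hon R
    rwa [IntegrableOn, Measure.restrict_eq_self_of_ae_mem
      (measure_eq_zero_iff_ae_notMem.1 hR |>.mono fun x hx =>
      not_not.1 hx)] at h
  push Not at hR
  refine (aecover_closedBall (μ := μ) (x := (0 : Plane))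
    (tendsto_natCast_atTop_atTop (R := ℝ))).integrable_of_integral_norm_bounded
    (K + Real.log 2) hon (Eventually.of_forall fun n => ?_)
  obtain ⟨x, hx, hxK⟩ : ∃ x : Plane, (n : ℝ) < ‖x‖ ∧ ∫ y, logKer x y ∂μ ≤ K := by
    by_contra! hcon
    refine hR n (measure_mono_null (fun x hx => ?_) (ae_iff.1 hK))
    have : (n : ℝ) < ‖x‖ := by simpa using hx
    exact not_le.2 (hcon x this)
  calc ∫ y in Metric.closedBall 0 (n : ℝ), ‖logOneAdd y‖ ∂μ
      ≤ ∫ y in Metric.closedBall 0 (n : ℝ), (logKer x y + Real.log 2) ∂μ := by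
        refine setIntegral_mono_on (hon n).norm
          ((hker x).add (integrable_const _)).integrableOn
          Metric.isClosed_closedBall.measurableSet fun y hy => ?_
        rw [Real.norm_of_nonneg (logOneAdd_nonneg y)]
        have : ‖y‖ ≤ n := by simpa using hy
        linarith [logOneAdd_sub_le_logKer (this.trans_lt hx)]
    _ ≤ ∫ y, (logKer x y + Real.log 2) ∂μ :=
        setIntegral_le_integral ((hker x).add (integrable_const _))
          (ae_of_all _ fun y => add_nonneg (logKer_nonneg x y) (Real.log_nonneg (by norm_num)))
    _ ≤ _ := by
        rw [integral_add (hker x) (integrable_const _)]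
        simpa using hxK

lemma gR2_eq_logKer (x y : Plane) : gR2 (x - y) = logKer x y - logOneAdd x - logOneAdd y := by
  unfold logKer; ring

/-- The regularity and the Euler-Lagrange inequality satisfied by the equilibrium measure. -/
structure IsRegularEquilibrium (V : Plane → ℝ) (μ : Measure Plane) (M : ℝ) : Prop where
  density_le : μ ≤ ENNReal.ofReal M • (volume : Measure Plane)
  integrable_logOneAdd : Integrable logOneAdd μ
  integrable_potential : Integrable V μ
  integrable_kernel : ∀ x, Integrable (fun y => gR2 (x - y)) μ
  integrable_kernel_prod : Integrable (fun p : Plane × Plane => gR2 (p.1 - p.2)) (μ.prod μ)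
  eulerLagrange : ∀ᵐ x : Plane,
    IVr2 V μ ≤ (∫ y, gR2 (x - y) ∂μ) + V x / 2 + (∫ y, V y ∂μ) / 2

lemma isRegularEquilibrium_of_minimizer {V : Plane → ℝ} (hV : Continuous V)
    {μ : Measure Plane} [IsProbabilityMeasure μ] {M : ℝ}
    (hμ : μ ≤ ENNReal.ofReal M • (volume : Measure Plane))
    (hmin : ∀ ν : Measure Plane, IsProbabilityMeasure ν → IVE2 V μ ≤ IVE2 V ν)
    (huniq : ∀ ν : Measure Plane, IsProbabilityMeasure ν → IVE2 V ν = IVE2 V μ → ν = μ) :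
    IsRegularEquilibrium V μ M := by
  have := nullSingletonClass_of_le hμ
  obtain ⟨C, hC⟩ := exists_potential_lower_bound hV hmin huniq
  have hμμ := integrable_pairEnergy_self hV hmin hC
  have hW := integrable_potential hV hC hμμ
  have hEL := le_integral_pairEnergy_ae hV hμ hmin hμμ hW
  have hker := integrable_logKer_right hμ
  have hsplit : ∀ x, ∫ y, pairEnergy V (x, y) ∂μ = (∫ y, logKer x y ∂μ)
      + (V x / 2 - logOneAdd x) + ∫ y, (V y / 2 - logOneAdd y) ∂μ := fun x => by
    simp only [pairEnergy_eq]
    have a1 : Integrable (fun y => logKer x y + (V x / 2 - logOneAdd x)) μ :=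
      (hker x).add (integrable_const _)
    rw [integral_add a1 hW,
      integral_add (hker x) (integrable_const _)]
    simp
  have hlog : Integrable logOneAdd μ := by
    refine integrable_logOneAdd_of_bound hker
      (K := (∫ p, pairEnergy V p ∂(μ.prod μ)) + C - ∫ y, (V y / 2 - logOneAdd y) ∂μ) ?_
    filter_upwards [integral_pairEnergy_ae_eq hμ hμμ hEL] with x hx
    rw [hsplit] at hx
    linarith [hC x]
  have hVi : Integrable V μ := by
    refine ((hW.add hlog).const_mul 2).congr (ae_of_all _ fun x => ?_)
    simp only [Pi.add_apply]; ring
  have hker : ∀ x, Integrable (fun y => gR2 (x - y)) μ := fun x => by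
    simp only [gR2_eq_logKer]
    exact ((hker x).sub (integrable_const _)).sub hlog
  have hkerp : Integrable (fun p : Plane × Plane => gR2 (p.1 - p.2)) (μ.prod μ) := by
    simp only [gR2_eq_logKer]
    exact ((integrable_logKer_prod hμ hlog).sub (hlog.comp_fst μ)).sub (hlog.comp_snd μ)
  refine ⟨hμ, hlog, hVi, hker, hkerp, hEL.mono fun x hx => ?_⟩
  have hI : ∫ p, pairEnergy V p ∂(μ.prod μ) = IVr2 V μ := by
    have a1 : Integrable (fun p : Plane × Plane => V p.1 / 2) (μ.prod μ) :=
      (hVi.comp_fst μ).div_const 2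
    have a2 : Integrable (fun p : Plane × Plane => V p.2 / 2) (μ.prod μ) :=
      (hVi.comp_snd μ).div_const 2
    unfold pairEnergy IVr2
    have a3 : Integrable (fun p : Plane × Plane => V p.1 / 2 + V p.2 / 2) (μ.prod μ) := a1.add a2
    rw [integral_add hkerp a3, integral_add a1 a2, integral_div, integral_div,
      integral_fun_fst (f := V), integral_fun_snd (f := V)]
    simp
  have hF : ∫ y, pairEnergy V (x, y) ∂μ
      = (∫ y, gR2 (x - y) ∂μ) + V x / 2 + (∫ y, V y ∂μ) / 2 := by
    unfold pairEnergy
    have a1 : Integrable (fun y => V x / 2 + V y / 2) μ :=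
      (integrable_const _).add (hVi.div_const 2)
    dsimp only
    rw [integral_add (hker x) a1,
      integral_add (integrable_const _) (hVi.div_const 2), integral_div 2 V]
    simp; ring
  rw [← hI, ← hF]; exact hx

lemma einInt_eq_of_ne {T : ℝ} (hT : 0 < T) {x : Plane} (hx : x ≠ 0) :
    einInt T (‖x‖ ^ 2) = Real.log T + einConst - 2 * gR2 x + expInt (T * ‖x‖ ^ 2) := by
  have := gR2_eq hT hx
  linarith

lemma integral_expInt_sub_le {T : ℝ} (hT : 0 < T) {M : ℝ} (hM : 0 ≤ M) {μ : Measure Plane}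
    (hμ : μ ≤ ENNReal.ofReal M • (volume : Measure Plane)) (x : Plane) :
    ∫ y, expInt (T * ‖x - y‖ ^ 2) ∂μ ≤ M * (Real.pi / T) := by
  have h := lintegral_expInt_sub_le hT hμ x
  rw [← ofReal_integral_eq_lintegral_ofReal (integrable_expInt_sub hT hμ x)
    (ae_of_all _ fun y => expInt_nonneg (by positivity)), ← ENNReal.ofReal_mul hM] at h
  exact (ENNReal.ofReal_le_ofReal_iff (by positivity)).1 h

/-- The effective confinement potential of the equilibrium measure. -/
def effPotential (V : Plane → ℝ) (μ : Measure Plane) (x : Plane) : ℝ :=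
  (∫ y, gR2 (x - y) ∂μ) + V x / 2 + (∫ y, V y ∂μ) / 2 - IVr2 V μ

lemma measurable_effPotential {V : Plane → ℝ} (hV : Continuous V) (μ : Measure Plane)
    [SFinite μ] : Measurable (effPotential V μ) := by
  have h1 : Measurable fun x => ∫ y, gR2 (x - y) ∂μ :=
    (StronglyMeasurable.integral_prod_right' (f := fun p : Plane × Plane => gR2 (p.1 - p.2))
      (Measurable.stronglyMeasurable (by fun_prop))).measurable
  have := hV.measurable
  unfold effPotential
  fun_prop

lemma HN2_lower_bound {V : Plane → ℝ} {μ : Measure Plane} [IsProbabilityMeasure μ] {M : ℝ}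
    (hM : 0 ≤ M) (h : IsRegularEquilibrium V μ M) {N : ℕ} (hN : 0 < N) {X : Fin N → Plane}
    (hX : Function.Injective X) :
    (N : ℝ) ^ 2 * IVr2 V μ + 2 * N * (∑ i, effPotential V μ (X i)) - N * (Real.log N / 2)
      - N * (M * Real.pi + einConst / 2) ≤ HN2 N V X := by
  have hnull := nullSingletonClass_of_le h.density_le
  have hT : (0 : ℝ) < N := by exact_mod_cast hN
  set c := Real.log N + einConst with hc
  have hae : ∀ x, (fun y => einInt N (‖x - y‖ ^ 2)) =ᵐ[μ]
      fun y => c - 2 * gR2 (x - y) + expInt (N * ‖x - y‖ ^ 2) := fun x =>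
    (Measure.ae_ne μ x).mono fun y hy => einInt_eq_of_ne hT (sub_ne_zero.2 hy.symm)
  have haep : (fun p : Plane × Plane => einInt N (‖p.1 - p.2‖ ^ 2)) =ᵐ[μ.prod μ]
      fun p => c - 2 * gR2 (p.1 - p.2) + expInt (N * ‖p.1 - p.2‖ ^ 2) :=
    (ae_prod_ne μ).mono fun p hp => einInt_eq_of_ne hT (sub_ne_zero.2 hp)
  have i0 : ∀ x, Integrable (fun y => c - 2 * gR2 (x - y)) μ := fun x =>
    (integrable_const c).sub ((h.integrable_kernel x).const_mul 2)
  have i0p : Integrable (fun p : Plane × Plane => c - 2 * gR2 (p.1 - p.2)) (μ.prod μ) :=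
    (integrable_const c).sub (h.integrable_kernel_prod.const_mul 2)
  have i1 := fun x => integrable_expInt_sub hT h.density_le x
  have i1p := integrable_expInt_prod hT h.density_le (ν := μ)
  have key := sum_einInt_le hT.le μ (fun x => ((i0 x).add (i1 x)).congr (hae x).symm)
    ((i0p.add i1p).congr haep.symm) X
  have e1 : ∀ x, ∫ y, einInt N (‖x - y‖ ^ 2) ∂μ
      ≤ c - 2 * (∫ y, gR2 (x - y) ∂μ) + M * (Real.pi / N) := fun x => by
    rw [integral_congr_ae (hae x), integral_add (i0 x) (i1 x),
      integral_sub (integrable_const c) ((h.integrable_kernel x).const_mul 2),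
      integral_const_mul]
    simpa using integral_expInt_sub_le hT hM h.density_le x
  have e2 : c - 2 * (∫ p : Plane × Plane, gR2 (p.1 - p.2) ∂(μ.prod μ))
      ≤ ∫ p : Plane × Plane, einInt N (‖p.1 - p.2‖ ^ 2) ∂(μ.prod μ) := by
    rw [integral_congr_ae haep, integral_add i0p i1p,
      integral_sub (integrable_const c) (h.integrable_kernel_prod.const_mul 2),
      integral_const_mul]
    simpa using integral_nonneg fun p : Plane × Plane => expInt_nonneg (by positivity)
  have e3 : ∀ i j, (c - einInt N (‖X i - X j‖ ^ 2)) / 2 - (if i = j then c / 2 else 0)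
      ≤ if i ≠ j then gR2 (X i - X j) else 0 := fun i j => by
    by_cases hij : i = j
    · simp [hij, einInt_zero]
    · rw [if_neg hij, if_pos hij, einInt_eq_of_ne hT (sub_ne_zero.2 (hX.ne hij))]
      have : 0 ≤ expInt (N * ‖X i - X j‖ ^ 2) := expInt_nonneg (by positivity)
      linarith
  have e4 := Finset.sum_le_sum fun i (_ : i ∈ Finset.univ) =>
    Finset.sum_le_sum fun j (_ : j ∈ Finset.univ) => e3 i j
  have e5 := Finset.sum_le_sum fun i (_ : i ∈ Finset.univ) => e1 (X i)
  simp only [Finset.sum_sub_distrib, ← Finset.sum_div, Finset.sum_const, Finset.card_univ,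
    Fintype.card_fin, nsmul_eq_mul, Finset.sum_ite_eq, Finset.mem_univ, if_true,
    Finset.sum_add_distrib, ← Finset.mul_sum] at e4 e5
  unfold HN2 effPotential
  simp only [Finset.sum_sub_distrib, ← Finset.sum_div, Finset.sum_const, Finset.card_univ,
    Fintype.card_fin, nsmul_eq_mul, Finset.sum_add_distrib]
  have e6 := mul_le_mul_of_nonneg_left e5 hT.le
  have e7 := mul_le_mul_of_nonneg_left e2 (sq_nonneg (N : ℝ))
  have e8 : (N : ℝ) * (N * (M * (Real.pi / N))) = N * (M * Real.pi) := by
    field_simp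
  have e9 : IVr2 V μ = (∫ p : Plane × Plane, gR2 (p.1 - p.2) ∂(μ.prod μ)) + ∫ x, V x ∂μ := rfl
  rw [e9]
  have hc' : Real.log N = c - einConst := by rw [hc]; ring
  rw [hc']
  linarith

lemma ae_injective_pi (N : ℕ) : ∀ᵐ X : Fin N → Plane, Function.Injective X := by
  have : ∀ i j : Fin N, i ≠ j → ∀ᵐ X : Fin N → Plane, X i ≠ X j := fun i j hij => by
    have h := Measure.addHaar_submodule (volume : Measure (Fin N → Plane))
      (LinearMap.ker (LinearMap.proj (R := ℝ) (φ := fun _ : Fin N => Plane) i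
        - LinearMap.proj j)) (fun htop => by
          rw [LinearMap.ker_eq_top] at htop
          obtain ⟨v, hv⟩ := exists_ne (0 : Plane)
          have := LinearMap.congr_fun htop (Pi.single i v)
          simp [hij.symm] at this
          exact hv this)
    rw [measure_eq_zero_iff_ae_notMem] at h
    refine h.mono fun X hX hXX => hX ?_
    simp [hXX]
  have h2 : ∀ᵐ X : Fin N → Plane, ∀ i j, i ≠ j → X i ≠ X j := by
    rw [ae_all_iff]; intro i
    rw [ae_all_iff]; intro j
    by_cases hij : i = j
    · exact ae_of_all _ fun X h => absurd hij h
    · exact (this i j hij).mono fun X hX _ => hX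
  exact h2.mono fun X hX i j hij => by_contra fun hne => hX i j hne hij

lemma lintegral_prod_ofReal_pi {f : Plane → ℝ} (hf : Integrable f) (hf0 : ∀ x, 0 ≤ f x) (N : ℕ) :
    ∫⁻ X : Fin N → Plane, ENNReal.ofReal (∏ i, f (X i)) = ENNReal.ofReal ((∫ x, f x) ^ N) := by
  have h : Integrable (fun X : Fin N → Plane => ∏ i, f (X i)) :=
    Integrable.fintype_prod (f := fun _ => f) fun _ => hf
  rw [← ofReal_integral_eq_lintegral_ofReal h
    (ae_of_all _ fun X => Finset.prod_nonneg fun i _ => hf0 _),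
    integral_fintype_prod_volume_eq_pow]
  simp

lemma integrable_exp_effPotential {V : Plane → ℝ} (hV : Continuous V) {μ : Measure Plane}
    [IsProbabilityMeasure μ] {M : ℝ} (h : IsRegularEquilibrium V μ M) {b : ℝ} (hb : 0 ≤ b)
    (hfin : (∫⁻ x : Plane, ENNReal.ofReal (Real.exp (-b * (V x / 2 - Real.log ‖x‖)))) ≠ ⊤) :
    Integrable (fun x => Real.exp (-b * effPotential V μ x)) := by
  have hm := measurable_effPotential hV μ
  refine ⟨(show Measurable _ by fun_prop).aestronglyMeasurable, ?_⟩
  rw [hasFiniteIntegral_iff_ofReal (ae_of_all _ fun y => Real.exp_nonneg _)]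
  set K := (∫ y, logOneAdd y ∂μ) - (∫ y, V y ∂μ) / 2 + IVr2 V μ with hK
  have h1 : ∀ x, V x / 2 - logOneAdd x - K ≤ effPotential V μ x := fun x => by
    have : -logOneAdd x - (∫ y, logOneAdd y ∂μ) ≤ ∫ y, gR2 (x - y) ∂μ := by
      calc _ = ∫ y, (-logOneAdd x - logOneAdd y) ∂μ := by
            rw [integral_sub (integrable_const _) h.integrable_logOneAdd]; simp
        _ ≤ _ := integral_mono ((integrable_const _).sub h.integrable_logOneAdd)
            (h.integrable_kernel x) fun y => by
              dsimp only
              rw [gR2_eq_logKer]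
              linarith [logKer_nonneg x y]
    unfold effPotential
    rw [hK]; linarith
  obtain ⟨B, hB⟩ := (isCompact_closedBall (0 : Plane) 1).exists_bound_of_continuousOn
    (f := fun x => V x / 2 - logOneAdd x) (by fun_prop)
  calc ∫⁻ x, ENNReal.ofReal (Real.exp (-b * effPotential V μ x))
      ≤ ∫⁻ x, (ENNReal.ofReal (Real.exp (b * (K + Real.log 2)))
          * ENNReal.ofReal (Real.exp (-b * (V x / 2 - Real.log ‖x‖)))
          + (Metric.closedBall 0 1).indicator
            (fun _ => ENNReal.ofReal (Real.exp (b * (B + K)))) x) := by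
        refine lintegral_mono fun x => ?_
        have hx := mul_le_mul_of_nonneg_left (h1 x) hb
        rcases le_total ‖x‖ 1 with hx1 | hx1
        · have hmem : x ∈ Metric.closedBall (0 : Plane) 1 := by simpa using hx1
          rw [Set.indicator_of_mem hmem]
          refine le_add_left (ENNReal.ofReal_le_ofReal (Real.exp_le_exp.2 ?_))
          have h2 := hB x hmem
          rw [Real.norm_eq_abs, abs_le] at h2
          nlinarith [mul_le_mul_of_nonneg_left h2.1 hb]
        · refine le_add_right ?_
          rw [← ENNReal.ofReal_mul (Real.exp_nonneg _), ← Real.exp_add]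
          refine ENNReal.ofReal_le_ofReal (Real.exp_le_exp.2 ?_)
          have h3 : logOneAdd x ≤ Real.log 2 + Real.log ‖x‖ := by
            unfold logOneAdd
            rw [← Real.log_mul (by norm_num) (by positivity)]
            exact Real.log_le_log (by positivity) (by linarith)
          nlinarith [mul_le_mul_of_nonneg_left h3 hb]
    _ < ⊤ := by
        rw [lintegral_add_right _ (measurable_const.indicator
          Metric.isClosed_closedBall.measurableSet),
          lintegral_const_mul' _ _ ENNReal.ofReal_ne_top,
          lintegral_indicator Metric.isClosed_closedBall.measurableSet, setLIntegral_const]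
        exact ENNReal.add_lt_top.2 ⟨ENNReal.mul_lt_top ENNReal.ofReal_lt_top hfin.lt_top,
          ENNReal.mul_lt_top ENNReal.ofReal_lt_top measure_closedBall_lt_top⟩

lemma ZN2_upper_bound {V : Plane → ℝ} (hV : Continuous V) {μ : Measure Plane}
    [IsProbabilityMeasure μ] {M : ℝ} (hM : 0 ≤ M) (h : IsRegularEquilibrium V μ M)
    {β : ℝ} (hβ : 0 < β)
    (hfin : ∃ N₀ : ℕ, ∀ N ≥ N₀,
      (∫⁻ x : Plane, ENNReal.ofReal (Real.exp (-β * N * (V x / 2 - Real.log ‖x‖)))) ≠ ⊤) :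
    ∃ C : ℝ, ∀ᶠ N : ℕ in atTop, ZN2 N β V ≤ ENNReal.ofReal (Real.exp
      (-(β / 2 * (N : ℝ) ^ 2 * IVr2 V μ - β / 4 * N * Real.log N) + C * N)) := by
  obtain ⟨N₁, hN₁⟩ := hfin
  have hker : Integrable (fun x => Real.exp (-(β * N₁) * effPotential V μ x)) :=
    integrable_exp_effPotential hV h (by positivity) (by simpa using hN₁ N₁ le_rfl)
  set A := ∫ x, Real.exp (-(β * N₁) * effPotential V μ x) with hA
  have hA0 : 0 ≤ A := integral_nonneg fun x => Real.exp_nonneg _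
  refine ⟨β / 2 * (M * Real.pi + einConst / 2) + A, ?_⟩
  filter_upwards [eventually_ge_atTop N₁, eventually_gt_atTop 0] with N hN hN0
  have hζ : ∀ᵐ X : Fin N → Plane, ∀ i, 0 ≤ effPotential V μ (X i) := by
    rw [ae_all_iff]
    intro i
    have h1 : ∀ᵐ x : Plane, 0 ≤ effPotential V μ x :=
      h.eulerLagrange.mono fun x hx => by unfold effPotential; linarith
    exact (Measure.quasiMeasurePreserving_eval (fun _ : Fin N => (volume : Measure Plane)) i).ae h1
  set E := -(β / 2) * ((N : ℝ) ^ 2 * IVr2 V μ - N * (Real.log N / 2)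
      - N * (M * Real.pi + einConst / 2)) with hE
  calc ZN2 N β V ≤ ∫⁻ X : Fin N → Plane, ENNReal.ofReal (Real.exp E) *
        ENNReal.ofReal (∏ i, Real.exp (-(β * N₁) * effPotential V μ (X i))) := by
        refine lintegral_mono_ae ?_
        filter_upwards [ae_injective_pi N, hζ] with X hX hpos
        rw [← ENNReal.ofReal_mul (Real.exp_nonneg _), ← Real.exp_sum, ← Real.exp_add,
          ← Finset.mul_sum]
        refine ENNReal.ofReal_le_ofReal (Real.exp_le_exp.2 ?_)
        have h2 := HN2_lower_bound hM h hN0 hX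
        have h3 := mul_le_mul_of_nonneg_left h2 (half_pos hβ).le
        have h4 : 0 ≤ ∑ i, effPotential V μ (X i) := Finset.sum_nonneg fun i _ => hpos i
        have h5 : (N₁ : ℝ) ≤ N := by exact_mod_cast hN
        have h6 := mul_le_mul_of_nonneg_right h5 (mul_nonneg hβ.le h4)
        rw [hE]
        linarith
    _ = ENNReal.ofReal (Real.exp E) * ENNReal.ofReal (A ^ N) := by
        rw [lintegral_const_mul' _ _ ENNReal.ofReal_ne_top,
          lintegral_prod_ofReal_pi hker fun x => Real.exp_nonneg _]
    _ ≤ _ := by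
        rw [← ENNReal.ofReal_mul (Real.exp_nonneg _)]
        refine ENNReal.ofReal_le_ofReal ?_
        have h7 : A ^ N ≤ Real.exp (A * N) := by
          rw [mul_comm, Real.exp_nat_mul]
          exact pow_le_pow_left₀ hA0 (by linarith [Real.add_one_le_exp A]) N
        calc Real.exp E * A ^ N ≤ Real.exp E * Real.exp (A * N) := by gcongr
          _ = _ := by
            rw [← Real.exp_add]; congr 1; rw [hE]; ring

lemma exists_equal_mass_levels (ρ : Measure ℝ) [IsFiniteMeasure ρ] [NullSingletonClass ρ]
    (hρ : ρ (Set.Ioc (-1) 1)ᶜ = 0) (n : ℕ) {c : ℝ} (hc : 0 < c) (htot : ρ.real Set.univ = n * c) :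
    ∃ s : ℕ → ℝ, Monotone s ∧ (∀ j, s j ∈ Set.Icc (-1 : ℝ) 1) ∧
      ∀ i j, i ≤ j → j ≤ n → ρ.real (Set.Ioc (s i) (s j)) = ((j : ℝ) - i) * c := by
  set G : ℝ → ℝ := fun t => ∫ _ in (-1 : ℝ)..t, (1 : ℝ) ∂ρ with hG
  have hii : ∀ a b : ℝ, IntervalIntegrable (fun _ => (1 : ℝ)) ρ a b := fun a b =>
    ⟨integrable_const _, integrable_const _⟩
  have hGc : Continuous G := intervalIntegral.continuous_primitive hii (-1)
  have hGd : ∀ a b, a ≤ b → G b - G a = ρ.real (Set.Ioc a b) := fun a b hab => by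
    rw [hG, intervalIntegral.integral_interval_sub_left (hii _ _) (hii _ _),
      intervalIntegral.integral_of_le hab]
    simp
  have hG0 : G (-1) = 0 := by simp [hG]
  have hG1 : G 1 = n * c := by
    have h := hGd (-1) 1 (by norm_num)
    rw [hG0, sub_zero] at h
    rw [h, ← htot]
    exact (measureReal_congr (eventuallyEq_univ.2 (mem_ae_iff.2 hρ)))
  have hex : ∀ j : ℕ, ∃ t ∈ Set.Icc (-1 : ℝ) 1, G t = (min j n : ℕ) * c := fun j => by
    have := intermediate_value_Icc (show (-1 : ℝ) ≤ 1 by norm_num) hGc.continuousOn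
    refine this ⟨?_, ?_⟩
    · rw [hG0]; positivity
    · rw [hG1]; gcongr; exact min_le_right _ _
  choose t ht htG using hex
  have hmono : ∀ i j, i < j → j ≤ n → t i ≤ t j := fun i j hij hj => by
    by_contra! hlt
    have h := hGd _ _ hlt.le
    rw [htG, htG, min_eq_left hj, min_eq_left (hij.le.trans hj)] at h
    have h1 : (0 : ℝ) ≤ ρ.real (Set.Ioc (t j) (t i)) := measureReal_nonneg
    have h2 : (i : ℝ) * c < j * c := by gcongr
    linarith
  refine ⟨fun j => t (min j n), fun i j hij => ?_, fun j => ht _, fun i j hij hj => ?_⟩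
  · rcases (min_le_min_right n hij).eq_or_lt with h | h
    · exact (congrArg t h).le
    · exact hmono _ _ h (min_le_right _ _)
  · dsimp only
    rw [min_eq_left hj, min_eq_left (hij.trans hj)]
    have hle : t i ≤ t j := by
      rcases hij.eq_or_lt with h | h
      · rw [h]
      · exact hmono _ _ h hj
    rw [← hGd _ _ hle, htG, htG, min_eq_left hj, min_eq_left (hij.trans hj)]
    ring

/-- The increasing homeomorphism `s / (1 + |s|)` of the line onto `(-1, 1)`. -/
def squash (s : ℝ) : ℝ := s / (1 + |s|)

lemma squash_mem (s : ℝ) : squash s ∈ Set.Ioc (-1 : ℝ) 1 := by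
  have h : 0 < 1 + |s| := by positivity
  unfold squash
  constructor
  · rw [lt_div_iff₀ h]; linarith [neg_abs_le s]
  · rw [div_le_one h]; linarith [le_abs_self s]

lemma measurable_squash : Measurable squash := by unfold squash; fun_prop

lemma abs_sub_le_squash (s t : ℝ) :
    |s - t| ≤ |squash s - squash t| * ((1 + |s|) * (1 + |t|)) := by
  have hs : 0 < 1 + |s| := by positivity
  have ht : 0 < 1 + |t| := by positivity
  have h : (squash s - squash t) * ((1 + |s|) * (1 + |t|)) = (s - t) + (s * |t| - t * |s|) := by
    unfold squash; field_simp; ring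
  rw [← abs_of_pos (mul_pos hs ht), ← abs_mul, h]
  rcases le_total 0 s with h1 | h1 <;> rcases le_total 0 t with h2 | h2
  · rw [abs_of_nonneg h1, abs_of_nonneg h2]; apply le_of_eq; congr 1; ring
  · rw [abs_of_nonneg h1, abs_of_nonpos h2, abs_of_nonneg (by linarith : 0 ≤ s - t)]
    refine le_trans ?_ (le_abs_self _)
    nlinarith
  · rw [abs_of_nonpos h1, abs_of_nonneg h2, abs_of_nonpos (by linarith : s - t ≤ 0)]
    refine le_trans ?_ (neg_le_abs _)
    nlinarith
  · rw [abs_of_nonpos h1, abs_of_nonpos h2]; apply le_of_eq; congr 1; ring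

lemma squash_injective : Function.Injective squash := fun s t h => by
  have := abs_sub_le_squash s t
  rw [h, sub_self, abs_zero, zero_mul] at this
  exact sub_eq_zero.1 (abs_nonpos_iff.1 this)

/-- The `i`-th coordinate, squashed into `(-1, 1)`. -/
def squashCoord (i : Fin 2) (x : Plane) : ℝ := squash (x i)

lemma measurable_squashCoord (i : Fin 2) : Measurable (squashCoord i) :=
  measurable_squash.comp (by fun_prop)

lemma nullSingletonClass_map_squashCoord {μ : Measure Plane} (hμ : μ ≪ volume) (i : Fin 2) :
    NullSingletonClass (μ.map (squashCoord i)) := ⟨fun t => by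
  rw [Measure.map_apply (measurable_squashCoord i) (measurableSet_singleton t)]
  refine hμ ?_
  have hq : Measure.QuasiMeasurePreserving (fun x : Plane => x i) volume volume :=
    (Measure.quasiMeasurePreserving_eval (fun _ : Fin 2 => (volume : Measure ℝ)) i).comp
      (PiLp.volume_preserving_ofLp (Fin 2)).quasiMeasurePreserving
  have h0 : (volume : Measure ℝ) (squash ⁻¹' {t}) = 0 :=
    (Set.Subsingleton.preimage Set.subsingleton_singleton squash_injective).measure_zero _
  exact hq.preimage_null h0⟩

lemma norm_sub_le_squashCoord (x y : Plane) :
    ‖x - y‖ ≤ (|squashCoord 0 x - squashCoord 0 y| + |squashCoord 1 x - squashCoord 1 y|)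
      * ((1 + ‖x‖) * (1 + ‖y‖)) := by
  have h : ∀ i, |x i - y i| ≤ |squashCoord i x - squashCoord i y| * ((1 + ‖x‖) * (1 + ‖y‖)) :=
    fun i => (abs_sub_le_squash _ _).trans (by
      have h1 : |x i| ≤ ‖x‖ := PiLp.norm_apply_le x i
      have h2 : |y i| ≤ ‖y‖ := PiLp.norm_apply_le y i
      unfold squashCoord
      gcongr)
  have h3 : ‖x - y‖ ≤ |x 0 - y 0| + |x 1 - y 1| := by
    rw [EuclideanSpace.norm_eq, Fin.sum_univ_two]
    refine Real.sqrt_le_iff.2 ⟨by positivity, ?_⟩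
    simp only [PiLp.sub_apply, Real.norm_eq_abs]
    nlinarith [abs_nonneg (x 0 - y 0), abs_nonneg (x 1 - y 1)]
  linarith [h 0, h 1]

/-- The strip of points whose `i`-th squashed coordinate lies in `(a, b]`. -/
def squashStrip (i : Fin 2) (a b : ℝ) : Set Plane := squashCoord i ⁻¹' Set.Ioc a b

lemma measurableSet_squashStrip (i : Fin 2) (a b : ℝ) : MeasurableSet (squashStrip i a b) :=
  measurable_squashCoord i measurableSet_Ioc

lemma exists_equal_mass_strips {ν : Measure Plane} [IsFiniteMeasure ν] (hν : ν ≪ volume)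
    (i : Fin 2) (n : ℕ) {c : ℝ} (hc : 0 < c) (htot : ν.real Set.univ = n * c) :
    ∃ s : ℕ → ℝ, Monotone s ∧ (∀ j, s j ∈ Set.Icc (-1 : ℝ) 1) ∧
      ∀ j k, j ≤ k → k ≤ n → ν.real (squashStrip i (s j) (s k)) = ((k : ℝ) - j) * c := by
  have := nullSingletonClass_map_squashCoord hν i
  have hm := measurable_squashCoord i
  obtain ⟨s, h1, h2, h3⟩ := exists_equal_mass_levels (ν.map (squashCoord i)) (by
    rw [Measure.map_apply hm measurableSet_Ioc.compl]
    convert measure_empty (μ := ν)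
    ext x
    simpa [squashCoord] using squash_mem (x i)) n hc (by
    rw [map_measureReal_apply hm MeasurableSet.univ, Set.preimage_univ, htot])
  refine ⟨s, h1, h2, fun j k hjk hk => ?_⟩
  rw [← h3 j k hjk hk, map_measureReal_apply hm measurableSet_Ioc, squashStrip]

lemma disjoint_squashStrip (i : Fin 2) {s : ℕ → ℝ} (hs : Monotone s) {a b : ℕ} (hab : a ≠ b) :
    Disjoint (squashStrip i (s a) (s (a + 1))) (squashStrip i (s b) (s (b + 1))) :=
  Disjoint.preimage _ (hs.pairwise_disjoint_on_Ioc_succ hab)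

lemma abs_sub_le_of_mem_squashStrip {i : Fin 2} {a b : ℝ} {x y : Plane}
    (hx : x ∈ squashStrip i a b) (hy : y ∈ squashStrip i a b) :
    |squashCoord i x - squashCoord i y| ≤ b - a := by
  obtain ⟨h1, h2⟩ := hx
  obtain ⟨h3, h4⟩ := hy
  rw [abs_le]; constructor <;> linarith

lemma exists_cells {μ : Measure Plane} [IsProbabilityMeasure μ] (hμ : μ ≪ volume) {N : ℕ}
    (hN : 1 ≤ N) :
    ∃ (Q : Fin N → Set Plane) (d : Fin N → ℝ), (∀ i, MeasurableSet (Q i)) ∧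
      (∀ i j, i ≠ j → Disjoint (Q i) (Q j)) ∧ (∀ i, μ.real (Q i) = 1 / N) ∧
      (∀ i, ∀ x ∈ Q i, ∀ y ∈ Q i, ‖x - y‖ ≤ d i * ((1 + ‖x‖) * (1 + ‖y‖))) ∧
      ∑ i, d i ≤ 10 * √N := by
  set n := Nat.sqrt N with hn
  have hn1 : 1 ≤ n := by rw [hn, Nat.le_sqrt]; omega
  have hNpos : (0 : ℝ) < N := by exact_mod_cast hN
  have hc0 : (0 : ℝ) < 1 / N := by positivity
  obtain ⟨s, hs1, hs2, hs3⟩ := exists_equal_mass_strips hμ 0 N hc0 (by simp; field_simp)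
  set u : ℕ → ℕ := fun a => a * N / n with hu
  have hum : Monotone u := fun a b hab => Nat.div_le_div_right (Nat.mul_le_mul_right N hab)
  have hu0 : u 0 = 0 := by simp [hu]
  have hun : u n = N := by simp [hu]; exact Nat.mul_div_cancel_left _ hn1
  set c : ℕ → ℕ := fun a => u (a + 1) - u a with hc
  have hcle : ∀ a, c a ≤ n + 3 := fun a => by
    have h1 : N ≤ n * n + n + n := Nat.sqrt_le_add N
    have h2 : (a + 1) * N / n ≤ a * N / n + (n + 3) := by
      rw [← Nat.add_mul_div_right _ _ hn1]
      refine Nat.div_le_div_right ?_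
      nlinarith
    simp only [hc, hu]
    omega
  have hcc : ∀ a, ((u (a + 1) : ℝ) - u a) = c a := fun a => by
    simp only [hc]; rw [Nat.cast_sub (hum (Nat.le_succ a))]
  set S : ℕ → Set Plane := fun a => squashStrip 0 (s (u a)) (s (u (a + 1))) with hS
  have hSm : ∀ a, MeasurableSet (S a) := fun a => measurableSet_squashStrip _ _ _
  have hsplit : ∀ a : Fin n, ∃ t : ℕ → ℝ, Monotone t ∧ (∀ j, t j ∈ Set.Icc (-1 : ℝ) 1) ∧
      ∀ j k, j ≤ k → k ≤ c a → (μ.restrict (S a)).real (squashStrip 1 (t j) (t k))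
        = ((k : ℝ) - j) * (1 / N) := fun a => by
    refine exists_equal_mass_strips (Measure.absolutelyContinuous_of_le Measure.restrict_le_self
      |>.trans hμ) 1 (c a) hc0 ?_
    rw [measureReal_restrict_apply_univ, hS]
    dsimp only
    rw [hs3 _ _ (hum (Nat.le_succ a)) (hun ▸ hum a.2), hcc]
  choose t ht1 ht2 ht3 using hsplit
  set Q : (Σ a : Fin n, Fin (c a)) → Set Plane := fun p =>
    squashStrip 1 (t p.1 p.2) (t p.1 (p.2 + 1)) ∩ S p.1 with hQ
  set d : (Σ a : Fin n, Fin (c a)) → ℝ := fun p =>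
    (s (u (p.1 + 1)) - s (u p.1)) + (t p.1 (p.2 + 1) - t p.1 p.2) with hd
  have hsum : ∑ p, d p ≤ 10 * √N := by
    rw [Fintype.sum_sigma]
    have h1 : ∀ a : Fin n, ∑ b : Fin (c a), d ⟨a, b⟩
        ≤ (n + 3) * (s (u (a + 1)) - s (u a)) + 2 := fun a => by
      simp only [hd]
      rw [Finset.sum_add_distrib, Fin.sum_univ_eq_sum_range (fun b => t a (b + 1) - t a b),
        Finset.sum_range_sub]
      have h2 := (ht2 a (c a)).2
      have h3 := (ht2 a 0).1
      have h4 : 0 ≤ s (u (a + 1)) - s (u a) := sub_nonneg.2 (hs1 (hum (Nat.le_succ a)))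
      have h5 : (c a : ℝ) ≤ n + 3 := by exact_mod_cast hcle a
      simp only [Finset.sum_const, Finset.card_univ, Fintype.card_fin, nsmul_eq_mul]
      have := mul_le_mul_of_nonneg_right h5 h4
      linarith
    refine (Finset.sum_le_sum fun a _ => h1 a).trans ?_
    rw [Finset.sum_add_distrib, ← Finset.mul_sum,
      Fin.sum_univ_eq_sum_range (fun a => s (u (a + 1)) - s (u a)),
      Finset.sum_range_sub (fun a => s (u a))]
    have h2 := (hs2 (u n)).2
    have h3 := (hs2 (u 0)).1
    have h4 : (n : ℝ) ≤ √N := Real.nat_sqrt_le_real_sqrt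
    have h5 : (1 : ℝ) ≤ n := by exact_mod_cast hn1
    simp only [Finset.sum_const, Finset.card_univ, Fintype.card_fin, nsmul_eq_mul]
    have : ((n : ℝ) + 3) * (s (u n) - s (u 0)) ≤ (n + 3) * 2 := by gcongr; linarith
    linarith
  have hcard : Fintype.card (Σ a : Fin n, Fin (c a)) = N := by
    rw [Fintype.card_sigma]
    simp only [Fintype.card_fin]
    rw [Fin.sum_univ_eq_sum_range, Finset.sum_range_tsub hum, hun, hu0, Nat.sub_zero]
  set e := (Fintype.equivFinOfCardEq hcard).symm
  refine ⟨fun i => Q (e i), fun i => d (e i), fun i => (measurableSet_squashStrip _ _ _).inter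
    (hSm _), fun i j hij => ?_, fun i => ?_, fun i x hx y hy => ?_, ?_⟩
  · have hne : e i ≠ e j := fun h => hij (e.injective h)
    change Disjoint (Q (e i)) (Q (e j))
    generalize e i = p at hne ⊢
    generalize e j = q at hne ⊢
    obtain ⟨a, b⟩ := p
    obtain ⟨a', b'⟩ := q
    by_cases ha : a = a'
    · subst ha
      have hb : (b : ℕ) ≠ b' := fun h => hne (by rw [Fin.ext h])
      exact ((disjoint_squashStrip 1 (ht1 a) hb).inter_left _).inter_right _
    · have ha' : (a : ℕ) ≠ a' := fun h => ha (Fin.ext h)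
      exact ((disjoint_squashStrip 0 (hs1.comp hum) ha').inter_left' _).inter_right' _
  · have h := ht3 (e i).1 (e i).2 ((e i).2 + 1) (Nat.le_succ _) (e i).2.2
    rw [measureReal_restrict_apply (measurableSet_squashStrip _ _ _)] at h
    simp only [hQ, h]
    push_cast; ring
  · refine (norm_sub_le_squashCoord x y).trans ?_
    gcongr
    exact add_le_add (abs_sub_le_of_mem_squashStrip hx.2 hy.2)
      (abs_sub_le_of_mem_squashStrip hx.1 hy.1)
  · rw [Equiv.sum_comp e d]; exact hsum

lemma ofReal_exp_integral_le {α : Type*} [MeasurableSpace α] {P : Measure α}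
    [IsProbabilityMeasure P] {f : α → ℝ} (hf : Integrable f P) :
    ENNReal.ofReal (Real.exp (∫ x, f x ∂P)) ≤ ∫⁻ x, ENNReal.ofReal (Real.exp (f x)) ∂P := by
  by_cases h : ∫⁻ x, ENNReal.ofReal (Real.exp (f x)) ∂P = ⊤
  · rw [h]; exact le_top
  · have hi : Integrable (fun x => Real.exp (f x)) P :=
      ⟨Real.continuous_exp.comp_aestronglyMeasurable hf.1, by
        rw [hasFiniteIntegral_iff_ofReal (ae_of_all _ fun x => (Real.exp_pos _).le)]
        exact lt_top_iff_ne_top.2 h⟩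
    rw [← ofReal_integral_eq_lintegral_ofReal hi (ae_of_all _ fun x => (Real.exp_pos _).le)]
    exact ENNReal.ofReal_le_ofReal (convexOn_exp.map_integral_le Real.continuousOn_exp
      isClosed_univ (ae_of_all _ fun x => Set.mem_univ _) hf hi)

lemma smul_pi_le_pi {ι : Type*} [Fintype ι] {α : ι → Type*} [∀ i, MeasurableSpace (α i)]
    {ν τ : ∀ i, Measure (α i)} {a : ℝ≥0∞} (h : ∀ i, a • ν i ≤ τ i) :
    a ^ Fintype.card ι • Measure.pi ν ≤ Measure.pi τ := by
  have h1 : a ^ Fintype.card ι • OuterMeasure.pi (fun i => (ν i).toOuterMeasure)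
      ≤ OuterMeasure.pi (fun i => (τ i).toOuterMeasure) := by
    refine OuterMeasure.le_pi.2 fun s _ => ?_
    rw [smul_apply, smul_eq_mul]
    calc a ^ Fintype.card ι * OuterMeasure.pi (fun i => (ν i).toOuterMeasure) (Set.univ.pi s)
        ≤ a ^ Fintype.card ι * ∏ i, ν i (s i) := by
          gcongr; exact OuterMeasure.pi_pi_le _ _
      _ = ∏ i, (a * ν i (s i)) := by
          rw [Finset.prod_mul_distrib, Finset.prod_const, Finset.card_univ]
      _ ≤ ∏ i, τ i (s i) := Finset.prod_le_prod' fun i _ => h i (s i)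
  refine Measure.le_iff.2 fun s hs => ?_
  rw [Measure.smul_apply, Measure.pi, Measure.pi, toMeasure_apply _ _ hs, toMeasure_apply _ _ hs]
  exact h1 s

lemma measurePreserving_eval_pair {ι : Type*} [Fintype ι] {α : Type*} [MeasurableSpace α]
    (ν : ι → Measure α) [∀ i, IsProbabilityMeasure (ν i)] {i j : ι} (hij : i ≠ j) :
    MeasurePreserving (fun X : ι → α => (X i, X j)) (Measure.pi ν) ((ν i).prod (ν j)) := by
  refine ⟨by fun_prop, ?_⟩
  have h := ((ProbabilityTheory.iIndepFun_pi (μ := ν) (X := fun _ x => x)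
    fun _ => aemeasurable_id).indepFun hij).map_prod_eq_prod_map_map
      (measurable_pi_apply i).aemeasurable (measurable_pi_apply j).aemeasurable
  rw [h]
  congr 1
  · exact (measurePreserving_eval ν i).map_eq
  · exact (measurePreserving_eval ν j).map_eq

lemma integral_prod_of_sum_eq {N : ℕ} {μ : Measure Plane} [IsProbabilityMeasure μ]
    {ν : Fin N → Measure Plane} [∀ i, IsProbabilityMeasure (ν i)]
    (hsum : ∑ i, ν i = (N : ℝ≥0∞) • μ) {f : Plane × Plane → ℝ} (hf : Integrable f (μ.prod μ)) :
    (∀ i j, Integrable f ((ν i).prod (ν j))) ∧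
      ∑ i, ∑ j, ∫ p, f p ∂((ν i).prod (ν j)) = (N : ℝ) ^ 2 * ∫ p, f p ∂(μ.prod μ) := by
  have hprod : ∑ p : Fin N × Fin N, (ν p.1).prod (ν p.2) = ((N : ℝ≥0∞) * N) • μ.prod μ := by
    rw [← Measure.sum_fintype, ← Measure.prod_sum, Measure.sum_fintype, hsum,
      Measure.prod_smul_left, Measure.prod_smul_right, smul_smul]
  have hNN : ((N : ℝ≥0∞) * N) ≠ ⊤ := ENNReal.mul_ne_top (ENNReal.natCast_ne_top N)
    (ENNReal.natCast_ne_top N)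
  have hi : ∀ i j, Integrable f ((ν i).prod (ν j)) := fun i j => by
    refine (hf.smul_measure hNN).mono_measure ?_
    rw [← hprod, ← Measure.sum_fintype]
    exact Measure.le_sum (fun p : Fin N × Fin N => (ν p.1).prod (ν p.2)) (i, j)
  refine ⟨hi, ?_⟩
  rw [← Fintype.sum_prod_type' (f := fun i j => ∫ p, f p ∂((ν i).prod (ν j))),
    ← integral_finsetSum_measure fun p _ => hi p.1 p.2, hprod, integral_smul_measure]
  simp [sq]

lemma integral_of_sum_eq {N : ℕ} {μ : Measure Plane}
    {ν : Fin N → Measure Plane}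
    (hsum : ∑ i, ν i = (N : ℝ≥0∞) • μ) {f : Plane → ℝ} (hf : Integrable f μ) :
    (∀ i, Integrable f (ν i)) ∧ ∑ i, ∫ x, f x ∂(ν i) = N * ∫ x, f x ∂μ := by
  have hi : ∀ i, Integrable f (ν i) := fun i => by
    refine (hf.smul_measure (ENNReal.natCast_ne_top N)).mono_measure ?_
    rw [← hsum, ← Measure.sum_fintype]
    exact Measure.le_sum ν i
  refine ⟨hi, ?_⟩
  rw [← integral_finsetSum_measure fun i _ => hi i, hsum, integral_smul_measure]
  simp

lemma integral_HN2_pi {N : ℕ} {V : Plane → ℝ} {μ : Measure Plane} [IsProbabilityMeasure μ]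
    {M : ℝ} (h : IsRegularEquilibrium V μ M)
    {ν : Fin N → Measure Plane} [∀ i, IsProbabilityMeasure (ν i)]
    (hsum : ∑ i, ν i = (N : ℝ≥0∞) • μ) :
    Integrable (HN2 N V) (Measure.pi ν) ∧ ∫ X, HN2 N V X ∂(Measure.pi ν)
      = (N : ℝ) ^ 2 * IVr2 V μ - ∑ i, ∫ p, gR2 (p.1 - p.2) ∂((ν i).prod (ν i)) := by
  obtain ⟨hg, hgs⟩ := integral_prod_of_sum_eq hsum h.integrable_kernel_prod
  obtain ⟨hv, hvs⟩ := integral_of_sum_eq hsum h.integrable_potential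
  have hpair : ∀ i j, Integrable (fun X : Fin N → Plane => if i ≠ j then gR2 (X i - X j) else 0)
      (Measure.pi ν) ∧ ∫ X, (if i ≠ j then gR2 (X i - X j) else 0) ∂(Measure.pi ν)
        = (∫ p, gR2 (p.1 - p.2) ∂((ν i).prod (ν j)))
          - if i = j then ∫ p, gR2 (p.1 - p.2) ∂((ν i).prod (ν j)) else 0 := fun i j => by
    by_cases hij : i = j
    · simp [hij]
    · simp only [ne_eq, hij, not_false_eq_true, if_true, if_false, sub_zero]
      have hmp := measurePreserving_eval_pair ν hij
      refine ⟨hmp.integrable_comp_of_integrable (hg i j), ?_⟩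
      rw [← hmp.map_eq, integral_map hmp.measurable.aemeasurable]
      rw [hmp.map_eq]; exact (hg i j).1
  have hVi : ∀ i, Integrable (fun X : Fin N → Plane => V (X i)) (Measure.pi ν) := fun i =>
    (measurePreserving_eval ν i).integrable_comp_of_integrable (hv i)
  have hVe : ∀ i, ∫ X : Fin N → Plane, V (X i) ∂(Measure.pi ν) = ∫ x, V x ∂(ν i) := fun i =>
    integral_comp_eval (hv i).1
  have h1 : Integrable (fun X : Fin N → Plane =>
      ∑ i, ∑ j, if i ≠ j then gR2 (X i - X j) else 0) (Measure.pi ν) :=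
    integrable_finsetSum _ fun i _ => integrable_finsetSum _ fun j _ => (hpair i j).1
  have h2 : Integrable (fun X : Fin N → Plane => (N : ℝ) * ∑ i, V (X i)) (Measure.pi ν) :=
    (integrable_finsetSum _ fun i _ => hVi i).const_mul _
  refine ⟨h1.add h2, ?_⟩
  unfold HN2
  rw [integral_add h1 h2, integral_finsetSum _ fun i _ =>
    integrable_finsetSum _ fun j _ => (hpair i j).1, integral_const_mul,
    integral_finsetSum _ fun i _ => hVi i]
  simp_rw [integral_finsetSum _ fun j _ => (hpair _ j).1, (hpair _ _).2, hVe]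
  simp only [Finset.sum_sub_distrib, Finset.sum_ite_eq, Finset.mem_univ, if_true]
  rw [hgs, hvs, IVr2]
  ring

lemma le_integral_gR2_self {ν : Measure Plane} [IsProbabilityMeasure ν] [NullSingletonClass ν]
    {Q : Set Plane} {d N : ℝ} (hN : 0 < N) (hQ : ∀ᵐ x ∂ν, x ∈ Q)
    (hd : ∀ x ∈ Q, ∀ y ∈ Q, ‖x - y‖ ≤ d * ((1 + ‖x‖) * (1 + ‖y‖)))
    (hl : Integrable logOneAdd ν)
    (hg : Integrable (fun p : Plane × Plane => gR2 (p.1 - p.2)) (ν.prod ν)) :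
    1 / 2 * Real.log N - √N * d - 2 * ∫ x, logOneAdd x ∂ν
      ≤ ∫ p, gR2 (p.1 - p.2) ∂(ν.prod ν) := by
  have i1 : Integrable (fun p : Plane × Plane => logOneAdd p.1) (ν.prod ν) := hl.comp_fst ν
  have i2 : Integrable (fun p : Plane × Plane => logOneAdd p.2) (ν.prod ν) := hl.comp_snd ν
  have i0 : Integrable (fun _ : Plane × Plane => 1 / 2 * Real.log N - √N * d) (ν.prod ν) :=
    integrable_const _
  have i01 : Integrable (fun p : Plane × Plane =>
    1 / 2 * Real.log N - √N * d - logOneAdd p.1) (ν.prod ν) := i0.sub i1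
  have key : ∫ p : Plane × Plane, (1 / 2 * Real.log N - √N * d - logOneAdd p.1 - logOneAdd p.2)
      ∂(ν.prod ν) = 1 / 2 * Real.log N - √N * d - 2 * ∫ x, logOneAdd x ∂ν := by
    rw [integral_sub i01 i2, integral_sub i0 i1, integral_fun_fst (f := logOneAdd),
      integral_fun_snd (f := logOneAdd)]
    simp
    ring
  rw [← key]
  refine integral_mono_ae (i01.sub i2) hg ?_
  filter_upwards [ae_prod_ne ν, Measure.quasiMeasurePreserving_fst.ae hQ,
    Measure.quasiMeasurePreserving_snd.ae hQ] with p hp h1 h2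
  have hpos : 0 < ‖p.1 - p.2‖ := norm_pos_iff.2 (sub_ne_zero.2 hp)
  have hx : 0 < 1 + ‖p.1‖ := by positivity
  have hy : 0 < 1 + ‖p.2‖ := by positivity
  have hle := hd _ h1 _ h2
  have hdpos : 0 < d := by
    by_contra! hneg
    have := mul_nonpos_of_nonpos_of_nonneg hneg (mul_pos hx hy).le
    linarith
  have hlog := Real.log_le_log hpos hle
  rw [Real.log_mul hdpos.ne' (mul_pos hx hy).ne', Real.log_mul hx.ne' hy.ne'] at hlog
  have hs : 0 < √N := Real.sqrt_pos.2 hN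
  have h3 : Real.log (√N * d) ≤ √N * d := Real.log_le_self (mul_pos hs hdpos).le
  rw [Real.log_mul hs.ne' hdpos.ne', Real.log_sqrt hN.le] at h3
  simp only [gR2, logOneAdd]
  linarith

lemma exists_cell_measures {V : Plane → ℝ} {μ : Measure Plane} [IsProbabilityMeasure μ] {M : ℝ}
    (hM : 0 < M) (h : IsRegularEquilibrium V μ M) {N : ℕ} (hN : 1 ≤ N) :
    ∃ (Q : Fin N → Set Plane) (ν : Fin N → Measure Plane), (∀ i, MeasurableSet (Q i)) ∧
      (∀ i j, i ≠ j → Disjoint (Q i) (Q j)) ∧ (∀ i, IsProbabilityMeasure (ν i)) ∧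
      ∑ i, ν i = (N : ℝ≥0∞) • μ ∧
      (∀ i, (ENNReal.ofReal (N * M))⁻¹ • ν i ≤ (volume : Measure Plane).restrict (Q i)) ∧
      N / 2 * Real.log N - (10 + 2 * ∫ x, logOneAdd x ∂μ) * N
        ≤ ∑ i, ∫ p, gR2 (p.1 - p.2) ∂((ν i).prod (ν i)) := by
  have hac : μ ≪ volume := absolutelyContinuous_of_le h.density_le
  have hNpos : (0 : ℝ) < N := by exact_mod_cast hN
  have hN0 : (N : ℝ≥0∞) ≠ 0 := by exact_mod_cast (by omega : N ≠ 0)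
  obtain ⟨Q, d, hQm, hQd, hQμ, hd, hds⟩ := exists_cells hac hN
  have hQe : ∀ i, μ (Q i) = (N : ℝ≥0∞)⁻¹ := fun i => by
    rw [← ofReal_measureReal, hQμ i, one_div, ENNReal.ofReal_inv_of_pos hNpos,
      ENNReal.ofReal_natCast]
  set ν : Fin N → Measure Plane := fun i => (N : ℝ≥0∞) • μ.restrict (Q i) with hν
  have hprob : ∀ i, IsProbabilityMeasure (ν i) := fun i => ⟨by
    simp only [hν, Measure.smul_apply, Measure.restrict_apply_univ, hQe, smul_eq_mul]
    exact ENNReal.mul_inv_cancel hN0 (ENNReal.natCast_ne_top N)⟩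
  have hrestr : ∑ i, μ.restrict (Q i) = μ := by
    have h1 : μ (⋃ i, Q i) = 1 := by
      rw [measure_iUnion (fun i j hij => hQd i j hij) hQm, tsum_fintype]
      simp only [hQe, Finset.sum_const, Finset.card_univ, Fintype.card_fin, nsmul_eq_mul]
      exact ENNReal.mul_inv_cancel hN0 (ENNReal.natCast_ne_top N)
    rw [← Measure.sum_fintype, ← Measure.restrict_iUnion (fun i j hij => hQd i j hij) hQm]
    exact Measure.restrict_eq_self_of_ae_mem
      ((prob_compl_eq_zero_iff (MeasurableSet.iUnion hQm)).2 h1)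
  have hsum : ∑ i, ν i = (N : ℝ≥0∞) • μ := by
    rw [← Finset.smul_sum, hrestr]
  refine ⟨Q, ν, hQm, hQd, hprob, hsum, fun i => ?_, ?_⟩
  · refine Measure.le_iff.2 fun s hs => ?_
    have h1 : μ (s ∩ Q i) ≤ ENNReal.ofReal M * volume (s ∩ Q i) := h.density_le _
    simp only [hν, Measure.smul_apply, Measure.restrict_apply hs, smul_eq_mul]
    rw [ENNReal.ofReal_mul hNpos.le, ENNReal.ofReal_natCast]
    have hM0 : ENNReal.ofReal M ≠ 0 := by simpa using hM
    calc ((N : ℝ≥0∞) * ENNReal.ofReal M)⁻¹ * (N * μ (s ∩ Q i))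
        ≤ ((N : ℝ≥0∞) * ENNReal.ofReal M)⁻¹ * (N * (ENNReal.ofReal M * volume (s ∩ Q i))) := by
          gcongr
      _ = volume (s ∩ Q i) := by
          rw [← mul_assoc (N : ℝ≥0∞), ← mul_assoc, ENNReal.inv_mul_cancel
            (mul_ne_zero hN0 hM0) (ENNReal.mul_ne_top (ENNReal.natCast_ne_top N)
              ENNReal.ofReal_ne_top), one_mul]
  · obtain ⟨hl, hls⟩ := integral_of_sum_eq hsum h.integrable_logOneAdd
    have hgi := (integral_prod_of_sum_eq hsum h.integrable_kernel_prod).1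
    have hle : ∀ i, 1 / 2 * Real.log N - √N * d i - 2 * ∫ x, logOneAdd x ∂(ν i)
        ≤ ∫ p, gR2 (p.1 - p.2) ∂((ν i).prod (ν i)) := fun i => by
      have hνac : ν i ≪ volume := ((Measure.absolutelyContinuous_of_le
        Measure.restrict_le_self).smul_left _).trans hac
      have : NullSingletonClass (ν i) := ⟨fun x => hνac (measure_singleton x)⟩
      refine le_integral_gR2_self hNpos ?_ (hd i) (hl i) (hgi i i)
      exact Measure.ae_smul_measure (ae_restrict_mem (hQm i)) _
    refine le_trans ?_ (Finset.sum_le_sum fun i _ => hle i)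
    rw [Finset.sum_sub_distrib, Finset.sum_sub_distrib, ← Finset.mul_sum, ← Finset.mul_sum,
      ← Finset.mul_sum, hls]
    simp only [Finset.sum_const, Finset.card_univ, Fintype.card_fin, nsmul_eq_mul]
    have h1 : √N * ∑ i, d i ≤ √N * (10 * √N) := by gcongr
    have h2 : √(N : ℝ) * √N = N := Real.mul_self_sqrt hNpos.le
    nlinarith

lemma factorial_mul_le_ZN2 {N : ℕ} {β : ℝ} (hβ : 0 < β) {V : Plane → ℝ} {a : ℝ≥0∞} {E : ℝ}
    {Q : Fin N → Set Plane} {ν : Fin N → Measure Plane} [∀ i, IsProbabilityMeasure (ν i)]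
    (hQm : ∀ i, MeasurableSet (Q i)) (hQd : ∀ i j, i ≠ j → Disjoint (Q i) (Q j))
    (hle : ∀ i, a • ν i ≤ (volume : Measure Plane).restrict (Q i))
    (hE : ∀ σ : Equiv.Perm (Fin N), Integrable (HN2 N V) (Measure.pi fun i => ν (σ i)) ∧
      ∫ X, HN2 N V X ∂(Measure.pi fun i => ν (σ i)) ≤ E) :
    (N.factorial : ℝ≥0∞) * a ^ N * ENNReal.ofReal (Real.exp (-(β / 2) * E)) ≤ ZN2 N β V := by
  have hcell : ∀ σ : Equiv.Perm (Fin N), a ^ N * ENNReal.ofReal (Real.exp (-(β / 2) * E))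
      ≤ ∫⁻ X in Set.univ.pi (fun i => Q (σ i)),
        ENNReal.ofReal (Real.exp (-(β / 2) * HN2 N V X)) := fun σ => by
    have h1 : a ^ N • Measure.pi (fun i => ν (σ i))
        ≤ (volume : Measure (Fin N → Plane)).restrict (Set.univ.pi fun i => Q (σ i)) := by
      rw [volume_pi, Measure.restrict_pi_pi]
      simpa using smul_pi_le_pi (fun i => hle (σ i))
    refine le_trans ?_ (lintegral_mono' h1 le_rfl)
    rw [lintegral_smul_measure, smul_eq_mul]
    gcongr
    refine le_trans ?_ (ofReal_exp_integral_le ((hE σ).1.const_mul (-(β / 2))))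
    rw [integral_const_mul]
    refine ENNReal.ofReal_le_ofReal (Real.exp_le_exp.2 ?_)
    nlinarith [(hE σ).2]
  have hmeas : ∀ σ : Equiv.Perm (Fin N), MeasurableSet (Set.univ.pi fun i => Q (σ i)) := fun σ =>
    MeasurableSet.univ_pi fun i => hQm (σ i)
  have hdisj : Pairwise (Function.onFun Disjoint
      fun σ : Equiv.Perm (Fin N) => Set.univ.pi fun i => Q (σ i)) := fun σ τ hστ => by
    obtain ⟨i, hi⟩ : ∃ i, σ i ≠ τ i := by
      by_contra! hall
      exact hστ (Equiv.ext hall)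
    exact Set.disjoint_univ_pi.2 ⟨i, hQd _ _ hi⟩
  calc (N.factorial : ℝ≥0∞) * a ^ N * ENNReal.ofReal (Real.exp (-(β / 2) * E))
      = ∑ _σ : Equiv.Perm (Fin N), a ^ N * ENNReal.ofReal (Real.exp (-(β / 2) * E)) := by
        rw [Finset.sum_const, Finset.card_univ, Fintype.card_perm, Fintype.card_fin,
          nsmul_eq_mul, mul_assoc]
    _ ≤ ∑ σ : Equiv.Perm (Fin N), ∫⁻ X in Set.univ.pi (fun i => Q (σ i)),
        ENNReal.ofReal (Real.exp (-(β / 2) * HN2 N V X)) :=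
        Finset.sum_le_sum fun σ _ => hcell σ
    _ = ∫⁻ X in ⋃ σ : Equiv.Perm (Fin N), Set.univ.pi (fun i => Q (σ i)),
        ENNReal.ofReal (Real.exp (-(β / 2) * HN2 N V X)) := by
        rw [lintegral_iUnion hmeas hdisj,
          tsum_fintype]
    _ ≤ ZN2 N β V := setLIntegral_le_lintegral _ _

lemma ofReal_exp_le_factorial_mul {N : ℕ} (hN : 1 ≤ N) {M : ℝ} (hM : 0 < M) :
    ENNReal.ofReal (Real.exp (-(1 + Real.log M) * N))
      ≤ (N.factorial : ℝ≥0∞) * (ENNReal.ofReal (N * M))⁻¹ ^ N := by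
  have hNpos : (0 : ℝ) < N := by exact_mod_cast hN
  have hfac : (0 : ℝ) < N.factorial := by exact_mod_cast N.factorial_pos
  rw [← ENNReal.ofReal_inv_of_pos (by positivity), ← ENNReal.ofReal_pow (by positivity),
    ← ENNReal.ofReal_natCast, ← ENNReal.ofReal_mul (by positivity)]
  refine ENNReal.ofReal_le_ofReal ?_
  have h1 := Real.pow_div_factorial_le_exp (N : ℝ) hNpos.le N
  have h2 : Real.exp (-(1 + Real.log M) * N) = (Real.exp N * M ^ N)⁻¹ := by
    rw [← Real.exp_log hM, ← Real.exp_nat_mul, ← Real.exp_add, ← Real.exp_neg, Real.exp_log hM]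
    congr 1; ring
  rw [h2, inv_pow, mul_pow]
  rw [div_le_iff₀ hfac] at h1
  rw [inv_le_iff_one_le_mul₀ (by positivity)]
  have h3 : 0 < M ^ N := by positivity
  have h4 : (0 : ℝ) < (N : ℝ) ^ N := by positivity
  field_simp
  linarith

lemma ZN2_lower_bound {V : Plane → ℝ} {μ : Measure Plane} [IsProbabilityMeasure μ] {M : ℝ}
    (hM : 0 < M) (h : IsRegularEquilibrium V μ M) {β : ℝ} (hβ : 0 < β) :
    ∃ C : ℝ, ∀ᶠ N : ℕ in atTop, ENNReal.ofReal (Real.exp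
      (-(β / 2 * (N : ℝ) ^ 2 * IVr2 V μ - β / 4 * N * Real.log N) - C * N)) ≤ ZN2 N β V := by
  set L := ∫ x, logOneAdd x ∂μ
  refine ⟨β / 2 * (10 + 2 * L) + (1 + Real.log M), ?_⟩
  filter_upwards [eventually_ge_atTop 1] with N hN
  obtain ⟨Q, ν, hQm, hQd, hprob, hsum, hle, hself⟩ := exists_cell_measures hM h hN
  have hE : ∀ σ : Equiv.Perm (Fin N), Integrable (HN2 N V) (Measure.pi fun i => ν (σ i)) ∧
      ∫ X, HN2 N V X ∂(Measure.pi fun i => ν (σ i))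
        ≤ (N : ℝ) ^ 2 * IVr2 V μ - (N / 2 * Real.log N - (10 + 2 * L) * N) := fun σ => by
    obtain ⟨h1, h2⟩ := integral_HN2_pi h (ν := fun i => ν (σ i))
      (by rw [Equiv.sum_comp σ ν, hsum])
    refine ⟨h1, ?_⟩
    rw [h2, Equiv.sum_comp σ fun i => ∫ p, gR2 (p.1 - p.2) ∂((ν i).prod (ν i))]
    linarith
  refine le_trans ?_ (factorial_mul_le_ZN2 hβ hQm hQd hle hE)
  refine le_trans (le_of_eq ?_) (mul_le_mul_left (ofReal_exp_le_factorial_mul hN hM) _)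
  rw [← ENNReal.ofReal_mul (Real.exp_pos _).le, ← Real.exp_add]
  congr 2
  ring

/-- next-order expansion of the partition function of the two-dimensional
Coulomb gas: `|log Z_{N,β} + (β/2) N² I_V(μ_V) - (β/4) N log N| ≤ C N` for `N` large,
stated as a two-sided inequality in the extended reals. -/
theorem statement_13 (β : ℝ) (hβ : 0 < β) (V : Plane → ℝ) (hV : Continuous V)
    (μV : Measure Plane) (hprob : IsProbabilityMeasure μV)
    (hmin : ∀ ν : Measure Plane, IsProbabilityMeasure ν → IVE2 V μV ≤ IVE2 V ν)
    (huniq : ∀ ν : Measure Plane, IsProbabilityMeasure ν → IVE2 V ν = IVE2 V μV → ν = μV)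
    (hdens : ∃ (ρ : Plane → ℝ≥0∞) (M : ℝ), μV = volume.withDensity ρ ∧
      ∀ x, ρ x ≤ ENNReal.ofReal M)
    (hA3 : ∃ N₀ : ℕ, ∀ N ≥ N₀,
      (∫⁻ x : Plane, ENNReal.ofReal (Real.exp (-β * N * (V x / 2 - Real.log ‖x‖)))) ≠ ⊤) :
    ∃ C : ℝ, ∀ᶠ N : ℕ in atTop,
      ENNReal.log (ZN2 N β V)
          + (((β / 2) * (N : ℝ) ^ 2 * IVr2 V μV - (β / 4) * N * Real.log N : ℝ) : EReal)
        ≤ ((C * N : ℝ) : EReal) ∧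
      ((-(C * N) : ℝ) : EReal)
        ≤ ENNReal.log (ZN2 N β V)
          + (((β / 2) * (N : ℝ) ^ 2 * IVr2 V μV - (β / 4) * N * Real.log N : ℝ) : EReal) := by
  obtain ⟨ρ, M₀, hρ, hρM⟩ := hdens
  set M := max M₀ 1
  have hM : 0 < M := lt_of_lt_of_le one_pos (le_max_right _ _)
  have hle : μV ≤ ENNReal.ofReal M • (volume : Measure Plane) := by
    rw [hρ, ← withDensity_const]
    exact withDensity_mono (ae_of_all _ fun x =>
      (hρM x).trans (ENNReal.ofReal_le_ofReal (le_max_left _ _)))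
  have h := isRegularEquilibrium_of_minimizer hV hle hmin huniq
  obtain ⟨C₁, h₁⟩ := ZN2_upper_bound hV hM.le h hβ hA3
  obtain ⟨C₂, h₂⟩ := ZN2_lower_bound hM h hβ
  refine ⟨max C₁ C₂, ?_⟩
  filter_upwards [h₁, h₂] with N hu hl
  have hNnn : (0 : ℝ) ≤ N := Nat.cast_nonneg N
  have hC₁ : C₁ * N ≤ max C₁ C₂ * N := by gcongr; exact le_max_left _ _
  have hC₂ : C₂ * N ≤ max C₁ C₂ * N := by gcongr; exact le_max_right _ _
  have hu' := ENNReal.log_monotone hu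
  have hl' := ENNReal.log_monotone hl
  rw [ENNReal.log_ofReal_of_pos (Real.exp_pos _), Real.log_exp] at hu' hl'
  constructor
  · refine (add_le_add hu' le_rfl).trans ?_
    rw [← EReal.coe_add, EReal.coe_le_coe_iff]
    linarith
  · refine le_trans ?_ (add_le_add hl' le_rfl)
    rw [← EReal.coe_add, EReal.coe_le_coe_iff]
    linarith
end
end
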